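/- For any double partition λ = (λ⁺, λ⁻) and each fixed i ≥ 0, the twisted homology of the generalized braid groups stabilizes: for all sufficiently large n (depending on i) there is an isomorphism of Q-vector spaces H_i(WB_n; V(λ)_n) ≅ H_i(WB_{n+1}; V(λ)_{n+1}), where WB_n acts on V(λ)_n through the projection WB_n → W_n. -/

import Mathlib

open Equiv

/-! ### Generic representation-theoretic helpers -/

/-- The restriction of a representation to an invariant submodule. -/
def Representation.subrep {k G V : Type*} [CommSemiring k] [Monoid G] [AddCommMonoid V]
    [Module k V] (ρ : Representation k G V) (p : Submodule k V)
    (h : ∀ g : G, ∀ v ∈ p, ρ g v ∈ p) : Representation k G p where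
  toFun g := (ρ g).restrict (fun v hv => h g v hv)
  map_one' := LinearMap.ext fun v => Subtype.ext (by simp [LinearMap.restrict_apply])
  map_mul' g₁ g₂ := LinearMap.ext fun v => Subtype.ext (by
    simp [LinearMap.restrict_apply, map_mul])

/-- The representation on `H →₀ k` induced by a `G`-action on `H`: Mathlib's former definition of
`Representation.ofMulAction` (which now lives on the structure `MonoidAlgebra k H`). -/
noncomputable def Representation.ofMulActionFinsupp (k G : Type*) [CommSemiring k] [Monoid G]
    (H : Type*) [MulAction G H] : Representation k G (H →₀ k) where
  toFun g := Finsupp.lmapDomain k k (g • ·)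
  map_one' := by
    ext x y
    simp
  map_mul' x y := by
    ext z w
    simp [mul_smul]

/-- The space of `G`-equivariant linear maps between two representations. -/
def RepHom {k G V W : Type*} [CommSemiring k] [Monoid G] [AddCommMonoid V] [Module k V]
    [AddCommMonoid W] [Module k W] (ρ : Representation k G V) (σ : Representation k G W) :
    Submodule k (V →ₗ[k] W) where
  carrier := {f | ∀ g v, f (ρ g v) = σ g (f v)}
  add_mem' := by
    intro f₁ f₂ h₁ h₂ g v
    simp [h₁ g v, h₂ g v]
  zero_mem' := by intro g v; simp
  smul_mem' := by
    intro c f h g v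
    simp [h g v]

/-- A representation is irreducible if it is nonzero and has no proper nonzero invariant
submodule. -/
def IsIrreducibleRep {k G V : Type*} [CommSemiring k] [Monoid G] [AddCommMonoid V]
    [Module k V] (ρ : Representation k G V) : Prop :=
  (∃ v : V, v ≠ 0) ∧
    ∀ q : Submodule k V, (∀ g : G, ∀ v ∈ q, ρ g v ∈ q) → q = ⊥ ∨ q = ⊤

/-- The multiplicity of (an irreducible) representation `ρ` in `σ`, defined as the dimension
of the space of equivariant maps (over `ℚ` all the relevant irreducibles are absolutely
irreducible, so this is the usual multiplicity). -/
noncomputable def repMult {G V W : Type*} [Monoid G] [AddCommGroup V] [Module ℚ V]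
    [AddCommGroup W] [Module ℚ W] (ρ : Representation ℚ G V) (σ : Representation ℚ G W) : ℕ :=
  Module.finrank ℚ (RepHom ρ σ)

/-! ### The standard inclusions of symmetric groups -/

/-- `Fin m` is equivalent to the subtype of `Fin n` of elements `< m`, when `m ≤ n`. -/
def finCastEquivLe {m n : ℕ} (h : m ≤ n) : Fin m ≃ {i : Fin n // (i : ℕ) < m} where
  toFun i := ⟨⟨(i : ℕ), lt_of_lt_of_le i.isLt h⟩, i.isLt⟩
  invFun j := ⟨(j.1 : ℕ), j.2⟩
  left_inv i := rfl
  right_inv j := by ext; rfl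

/-- The standard inclusion `S_m ↪ S_n` for `m ≤ n`, acting on the first `m` letters. -/
def inclPermLe {m n : ℕ} (h : m ≤ n) : Equiv.Perm (Fin m) →* Equiv.Perm (Fin n) :=
  Equiv.Perm.extendDomainHom (finCastEquivLe h)

/-- The standard inclusion `S_n ↪ S_{n+1}`. -/
def inclPerm (n : ℕ) : Equiv.Perm (Fin n) →* Equiv.Perm (Fin (n + 1)) :=
  inclPermLe (Nat.le_succ n)

/-! ### Partitions -/

/-- A partition (of its `size`), recorded as a weakly decreasing list of positive parts. -/
structure NatPartition : Type where
  parts : List ℕ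
  sorted : parts.Pairwise (· ≥ ·)
  pos : ∀ p ∈ parts, 0 < p

namespace NatPartition

/-- The number `k` being partitioned. -/
def size (lam : NatPartition) : ℕ := lam.parts.sum

/-- The largest part `λ₁`. -/
def width (lam : NatPartition) : ℕ := lam.parts.headD 0

/-- The smallest `n` for which the padded partition `λ[n]` is defined,
namely `|λ| + λ₁`. -/
def minN (lam : NatPartition) : ℕ := lam.size + lam.width

end NatPartition

/-! ### An abstract system of irreducible `S_n`-representations `V(λ)_n`

We axiomatize the family `λ ↦ V(λ)_n` (the irreducible rational representation of `S_n`
attached to the padded partition `λ[n]`), realized inside the left regular representation: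
for each partition `λ` and each `n ≥ |λ| + λ₁` an invariant subspace of `ℚ[S_n]` which is
irreducible, such that distinct partitions give non-isomorphic representations, every
irreducible representation of `S_n` occurs, and the restriction of `V(λ)_{n+1}` to `S_n`
contains `V(λ)_n` (this pins down the labelling, by the branching rule). -/
structure SnIrrSystem : Type 1 where
  V : NatPartition → ∀ n : ℕ, Submodule ℚ (Equiv.Perm (Fin n) →₀ ℚ)
  inv : ∀ lam n (g : Equiv.Perm (Fin n)), ∀ x ∈ V lam n,
    Representation.ofMulActionFinsupp ℚ (Equiv.Perm (Fin n)) (Equiv.Perm (Fin n)) g x ∈ V lam n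
  irr : ∀ lam n, lam.minN ≤ n →
    IsIrreducibleRep ((Representation.ofMulActionFinsupp ℚ (Equiv.Perm (Fin n))
      (Equiv.Perm (Fin n))).subrep (V lam n) (inv lam n))
  noniso : ∀ lam mu n, lam.minN ≤ n → mu.minN ≤ n → lam ≠ mu →
    ∀ f : ↥(V lam n) →ₗ[ℚ] ↥(V mu n),
      f ∈ RepHom ((Representation.ofMulActionFinsupp ℚ (Equiv.Perm (Fin n))
          (Equiv.Perm (Fin n))).subrep (V lam n) (inv lam n))
        ((Representation.ofMulActionFinsupp ℚ (Equiv.Perm (Fin n))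
          (Equiv.Perm (Fin n))).subrep (V mu n) (inv mu n)) →
      ¬ Function.Bijective f
  complete : ∀ n (W : Type) [AddCommGroup W] [Module ℚ W]
    (σ : Representation ℚ (Equiv.Perm (Fin n)) W), IsIrreducibleRep σ →
    ∃ lam : NatPartition, lam.minN ≤ n ∧ ∃ f : ↥(V lam n) →ₗ[ℚ] W,
      f ∈ RepHom ((Representation.ofMulActionFinsupp ℚ (Equiv.Perm (Fin n))
          (Equiv.Perm (Fin n))).subrep (V lam n) (inv lam n)) σ ∧ Function.Bijective f
  branch : ∀ lam n, lam.minN ≤ n → ∃ f : ↥(V lam n) →ₗ[ℚ] ↥(V lam (n + 1)),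
    f ≠ 0 ∧ f ∈ RepHom ((Representation.ofMulActionFinsupp ℚ (Equiv.Perm (Fin n))
        (Equiv.Perm (Fin n))).subrep (V lam n) (inv lam n))
      (((Representation.ofMulActionFinsupp ℚ (Equiv.Perm (Fin (n + 1)))
          (Equiv.Perm (Fin (n + 1)))).subrep (V lam (n + 1)) (inv lam (n + 1))).comp
        (inclPerm n))

namespace SnIrrSystem

/-- The irreducible representation `V(λ)_n` of the system. -/
noncomputable def rep (S : SnIrrSystem) (lam : NatPartition) (n : ℕ) :
    Representation ℚ (Equiv.Perm (Fin n)) ↥(S.V lam n) :=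
  (Representation.ofMulActionFinsupp ℚ (Equiv.Perm (Fin n)) (Equiv.Perm (Fin n))).subrep
    (S.V lam n) (S.inv lam n)

/-- The multiplicity of `V(λ)_n` in a representation `σ` of `S_n`. -/
noncomputable def mult (S : SnIrrSystem) (lam : NatPartition) {n : ℕ} {W : Type*}
    [AddCommGroup W] [Module ℚ W] (σ : Representation ℚ (Equiv.Perm (Fin n)) W) : ℕ :=
  repMult (S.rep lam n) σ

end SnIrrSystem

/-! ### Representation stability for sequences of `S_n`-representations -/

section SnStability

variable {M : ℕ → Type*} [∀ n, AddCommGroup (M n)] [∀ n, Module ℚ (M n)]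

/-- A sequence of `S_n`-representations with maps `φ_n : V_n → V_{n+1}` is consistent if the
maps intertwine the `S_n`-action with the `S_{n+1}`-action via the standard inclusion. -/
def SnConsistent (ρ : ∀ n, Representation ℚ (Equiv.Perm (Fin n)) (M n))
    (φ : ∀ n, M n →ₗ[ℚ] M (n + 1)) : Prop :=
  ∀ n (g : Equiv.Perm (Fin n)) (v : M n),
    φ n (ρ n g v) = ρ (n + 1) (inclPerm n g) (φ n v)

/-- Condition II (surjectivity): the span of the `S_{n+1}`-orbit of `φ_n(V_n)` is all of
`V_{n+1}`. -/
def SnSurjSpan (ρ : ∀ n, Representation ℚ (Equiv.Perm (Fin n)) (M n))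
    (φ : ∀ n, M n →ₗ[ℚ] M (n + 1)) (n : ℕ) : Prop :=
  Submodule.span ℚ {x : M (n + 1) | ∃ (g : Equiv.Perm (Fin (n + 1))) (v : M n),
    x = ρ (n + 1) g (φ n v)} = ⊤

/-- Condition III (multiplicity stability): for each `λ`, the multiplicity of `V(λ)_n`
is eventually constant. -/
def SnMultStable (S : SnIrrSystem)
    (ρ : ∀ n, Representation ℚ (Equiv.Perm (Fin n)) (M n)) : Prop :=
  ∀ lam : NatPartition, ∃ N, lam.minN ≤ N ∧
    ∀ n, N ≤ n → S.mult lam (ρ n) = S.mult lam (ρ N)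

/-- Condition III′ (uniform multiplicity stability): the stabilization point can be chosen
independently of `λ`; moreover any `λ` for which `V(λ)_N` is not defined has multiplicity `0`
from then on. -/
def SnUnifMultStable (S : SnIrrSystem)
    (ρ : ∀ n, Representation ℚ (Equiv.Perm (Fin n)) (M n)) : Prop :=
  ∃ N, (∀ lam : NatPartition, lam.minN ≤ N → ∀ n, N ≤ n →
      S.mult lam (ρ n) = S.mult lam (ρ N)) ∧
    (∀ lam : NatPartition, N < lam.minN → ∀ n, lam.minN ≤ n → S.mult lam (ρ n) = 0)

/-- Representation stability for a consistent sequence of `S_n`-representations. -/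
def SnRepStable (S : SnIrrSystem)
    (ρ : ∀ n, Representation ℚ (Equiv.Perm (Fin n)) (M n))
    (φ : ∀ n, M n →ₗ[ℚ] M (n + 1)) : Prop :=
  (∃ N, ∀ n, N ≤ n → Function.Injective (φ n) ∧ SnSurjSpan ρ φ n) ∧ SnMultStable S ρ

/-- Uniform representation stability. -/
def SnUnifRepStable (S : SnIrrSystem)
    (ρ : ∀ n, Representation ℚ (Equiv.Perm (Fin n)) (M n))
    (φ : ∀ n, M n →ₗ[ℚ] M (n + 1)) : Prop :=
  (∃ N, ∀ n, N ≤ n → Function.Injective (φ n) ∧ SnSurjSpan ρ φ n) ∧ SnUnifMultStable S ρ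

end SnStability

open CategoryTheory

/-- The singular chain complex functor with rational coefficients: the free simplicial
`ℚ`-module on the singular simplicial set, made into a chain complex via the alternating
face map complex. -/
noncomputable def singularChains : TopCat ⥤ ChainComplex (ModuleCat ℚ) ℕ :=
  TopCat.toSSet ⋙ ((SimplicialObject.whiskering _ _).obj (ModuleCat.free ℚ)) ⋙
    AlgebraicTopology.alternatingFaceMapComplex (ModuleCat ℚ)

/-- The `i`-th singular homology functor with rational coefficients. -/
noncomputable def singularHomology (i : ℕ) : TopCat ⥤ ModuleCat ℚ :=
  singularChains ⋙ HomologicalComplex.homologyFunctor (ModuleCat ℚ) _ i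

open CategoryTheory

/-- The augmentation submodule of a representation: the span of the elements `g·v - v`. -/
def augSubmodule {G : Type} [Group G] (X : Rep.{0} ℚ G) : Submodule ℚ X :=
  Submodule.span ℚ {y : X | ∃ (g : G) (v : X), y = X.ρ g v - v}

lemma augSubmodule_mapsTo {G : Type} [Group G] {X Y : Rep.{0} ℚ G} (f : X ⟶ Y) :
    ∀ v ∈ augSubmodule X, f.hom v ∈ augSubmodule Y := by
  intro v hv
  have h : Submodule.map f.hom.toLinearMap (augSubmodule X) ≤ augSubmodule Y := by
    rw [augSubmodule, Submodule.map_span, Submodule.span_le]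
    rintro y ⟨x, ⟨g, v', rfl⟩, rfl⟩
    apply Submodule.subset_span
    refine ⟨g, f.hom v', ?_⟩
    rw [map_sub]
    exact congrArg (fun t => t - f.hom v') (Rep.hom_comm_apply f g v')
  exact h ⟨v, hv, rfl⟩

/-- The coinvariants functor `Rep ℚ G ⥤ ModuleCat ℚ`, `X ↦ X_G = X / ⟨g·v - v⟩`. -/
noncomputable def coinvFunctor (G : Type) [Group G] : Rep.{0} ℚ G ⥤ ModuleCat ℚ where
  obj X := ModuleCat.of ℚ (X ⧸ augSubmodule X)
  map {X Y} f := ModuleCat.ofHom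
    (Submodule.mapQ (augSubmodule X) (augSubmodule Y) f.hom.toLinearMap (augSubmodule_mapsTo f))
  map_id X := by
    apply ModuleCat.hom_ext
    apply Submodule.linearMap_qext
    apply LinearMap.ext
    intro v
    simp [Submodule.mapQ_apply]
  map_comp {X Y Z} f g := by
    apply ModuleCat.hom_ext
    apply Submodule.linearMap_qext
    apply LinearMap.ext
    intro v
    simp [Submodule.mapQ_apply]

instance (G : Type) [Group G] : (coinvFunctor G).Additive where
  map_add := by
    intro X Y f g
    apply ModuleCat.hom_ext
    apply Submodule.linearMap_qext
    apply LinearMap.ext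
    intro v
    rfl

/-- Group homology `H_i(G; X)` as the `i`-th left derived functor of the coinvariants
functor, evaluated at the representation `X`. -/
noncomputable def grpHomology (G : Type) [Group G] (X : Rep.{0} ℚ G) (i : ℕ) : ModuleCat ℚ :=
  ((coinvFunctor G).leftDerived i).obj X

/-- The map induced on fundamental groups by a continuous map. -/
noncomputable def pi1Map {X Y : TopCat} (q : X ⟶ Y) (x : X) :
    Aut (FundamentalGroupoid.mk x) →* Aut (FundamentalGroupoid.mk (q x)) :=
  CategoryTheory.Functor.mapAut (FundamentalGroupoid.mk x)
    (FundamentalGroupoid.fundamentalGroupoidFunctor.map q)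

/-! ### The hyperoctahedral groups -/

lemma inclPermLe_apply_lt {m n : ℕ} (h : m ≤ n) (σ : Equiv.Perm (Fin m)) (j : Fin n)
    (hj : (j : ℕ) < m) :
    inclPermLe h σ j = ⟨(σ ⟨(j : ℕ), hj⟩ : Fin m), lt_of_lt_of_le (σ ⟨(j : ℕ), hj⟩).isLt h⟩ := by
  show (σ.extendDomain (finCastEquivLe h)) j = _
  rw [Equiv.Perm.extendDomain_apply_subtype (b := j) σ (finCastEquivLe h) hj]
  rfl

lemma inclPermLe_apply_not_lt {m n : ℕ} (h : m ≤ n) (σ : Equiv.Perm (Fin m)) (j : Fin n)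
    (hj : ¬ (j : ℕ) < m) : inclPermLe h σ j = j := by
  show (σ.extendDomain (finCastEquivLe h)) j = _
  exact Equiv.Perm.extendDomain_apply_not_subtype (b := j) σ (finCastEquivLe h) hj

/-- The permutation action of `S_n` on sign vectors, as a homomorphism into `MulAut`. -/
def permMulAut (n : ℕ) : Equiv.Perm (Fin n) →* MulAut (Fin n → ℤˣ) where
  toFun σ :=
    { toFun := fun ε => ε ∘ (σ⁻¹ : Equiv.Perm (Fin n))
      invFun := fun ε => ε ∘ (σ : Equiv.Perm (Fin n))
      left_inv := fun ε => by funext i; simp [Function.comp]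
      right_inv := fun ε => by funext i; simp [Function.comp]
      map_mul' := fun ε₁ ε₂ => rfl }
  map_one' := by
    apply MulEquiv.ext
    intro ε
    funext i
    simp
  map_mul' σ τ := by
    apply MulEquiv.ext
    intro ε
    funext i
    simp [Function.comp, mul_inv_rev]

/-- The hyperoctahedral group `W_n = (ℤ/2) ≀ S_n`, realized as the semidirect product
`(ℤ/2)ⁿ ⋊ S_n` of sign vectors by permutations. -/
abbrev Wgroup (n : ℕ) : Type :=
  (Fin n → ℤˣ) ⋊[permMulAut n] Equiv.Perm (Fin n)

/-- Extension of a sign vector by `+1` in the last coordinate. -/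
def extendSigns (n : ℕ) : (Fin n → ℤˣ) →* (Fin (n + 1) → ℤˣ) where
  toFun ε := fun j => if h : (j : ℕ) < n then ε ⟨(j : ℕ), h⟩ else 1
  map_one' := by funext j; by_cases h : (j : ℕ) < n <;> simp [h]
  map_mul' ε₁ ε₂ := by funext j; by_cases h : (j : ℕ) < n <;> simp [h]

/-- The standard inclusion `W_n ↪ W_{n+1}`. -/
def inclW (n : ℕ) : Wgroup n →* Wgroup (n + 1) :=
  SemidirectProduct.map (extendSigns n) (inclPerm n) (by
    intro σ
    apply MonoidHom.ext
    intro ε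
    funext j
    by_cases hj : (j : ℕ) < n
    · have h1 : ((inclPerm n σ)⁻¹ : Equiv.Perm (Fin (n + 1))) j =
          ⟨((σ⁻¹ : Equiv.Perm (Fin n)) ⟨(j : ℕ), hj⟩ : Fin n), by
            exact lt_of_lt_of_le ((σ⁻¹ : Equiv.Perm (Fin n)) ⟨(j : ℕ), hj⟩).isLt (Nat.le_succ n)⟩ := by
        rw [← map_inv]
        exact inclPermLe_apply_lt (Nat.le_succ n) σ⁻¹ j hj
      simp only [MonoidHom.comp_apply, MulEquiv.toMonoidHom_eq_coe, MonoidHom.coe_coe]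
      show (extendSigns n) (ε ∘ (σ⁻¹ : Equiv.Perm (Fin n))) j =
        ((extendSigns n ε) ∘ ((inclPerm n σ)⁻¹ : Equiv.Perm (Fin (n + 1)))) j
      simp only [Function.comp_apply, h1, extendSigns, MonoidHom.coe_mk, OneHom.coe_mk]
      simp [hj]
    · have h1 : ((inclPerm n σ)⁻¹ : Equiv.Perm (Fin (n + 1))) j = j := by
        rw [← map_inv]
        exact inclPermLe_apply_not_lt (Nat.le_succ n) σ⁻¹ j hj
      show (extendSigns n) (ε ∘ (σ⁻¹ : Equiv.Perm (Fin n))) j =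
        ((extendSigns n ε) ∘ ((inclPerm n σ)⁻¹ : Equiv.Perm (Fin (n + 1)))) j
      simp only [Function.comp_apply, h1, extendSigns, MonoidHom.coe_mk, OneHom.coe_mk]
      simp [hj])

/-! ### Double partitions and an abstract system of irreducible `W_n`-representations -/

/-- A double partition `(λ⁺, λ⁻)`. -/
abbrev DoublePartition : Type := NatPartition × NatPartition

/-- The smallest `n` for which the padded double partition `λ[n]` is defined. -/
def DoublePartition.minN (lam : DoublePartition) : ℕ :=
  lam.1.size + lam.2.size + lam.1.width

/-- An abstract system of the irreducible rational representations `V(λ)_n` of the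
hyperoctahedral groups, indexed by double partitions `λ` padded to `n`; cf. `SnIrrSystem`. -/
structure WnIrrSystem : Type 1 where
  V : DoublePartition → ∀ n : ℕ, Submodule ℚ (Wgroup n →₀ ℚ)
  inv : ∀ lam n (g : Wgroup n), ∀ x ∈ V lam n,
    Representation.ofMulActionFinsupp ℚ (Wgroup n) (Wgroup n) g x ∈ V lam n
  irr : ∀ lam n, lam.minN ≤ n →
    IsIrreducibleRep ((Representation.ofMulActionFinsupp ℚ (Wgroup n) (Wgroup n)).subrep
      (V lam n) (inv lam n))
  noniso : ∀ lam mu n, lam.minN ≤ n → mu.minN ≤ n → lam ≠ mu →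
    ∀ f : ↥(V lam n) →ₗ[ℚ] ↥(V mu n),
      f ∈ RepHom ((Representation.ofMulActionFinsupp ℚ (Wgroup n) (Wgroup n)).subrep
          (V lam n) (inv lam n))
        ((Representation.ofMulActionFinsupp ℚ (Wgroup n) (Wgroup n)).subrep
          (V mu n) (inv mu n)) →
      ¬ Function.Bijective f
  complete : ∀ n (W : Type) [AddCommGroup W] [Module ℚ W]
    (σ : Representation ℚ (Wgroup n) W), IsIrreducibleRep σ →
    ∃ lam : DoublePartition, lam.minN ≤ n ∧ ∃ f : ↥(V lam n) →ₗ[ℚ] W,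
      f ∈ RepHom ((Representation.ofMulActionFinsupp ℚ (Wgroup n) (Wgroup n)).subrep
        (V lam n) (inv lam n)) σ ∧ Function.Bijective f
  branch : ∀ lam n, lam.minN ≤ n → ∃ f : ↥(V lam n) →ₗ[ℚ] ↥(V lam (n + 1)),
    f ≠ 0 ∧ f ∈ RepHom ((Representation.ofMulActionFinsupp ℚ (Wgroup n) (Wgroup n)).subrep
        (V lam n) (inv lam n))
      (((Representation.ofMulActionFinsupp ℚ (Wgroup (n + 1)) (Wgroup (n + 1))).subrep
          (V lam (n + 1)) (inv lam (n + 1))).comp (inclW n))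

namespace WnIrrSystem

/-- The irreducible representation `V(λ)_n` of the system. -/
noncomputable def rep (S : WnIrrSystem) (lam : DoublePartition) (n : ℕ) :
    Representation ℚ (Wgroup n) ↥(S.V lam n) :=
  (Representation.ofMulActionFinsupp ℚ (Wgroup n) (Wgroup n)).subrep (S.V lam n) (S.inv lam n)

/-- The multiplicity of `V(λ)_n` in a representation `σ` of `W_n`. -/
noncomputable def mult (S : WnIrrSystem) (lam : DoublePartition) {n : ℕ} {W : Type*}
    [AddCommGroup W] [Module ℚ W] (σ : Representation ℚ (Wgroup n) W) : ℕ :=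
  repMult (S.rep lam n) σ

end WnIrrSystem

section WnStability

variable {M : ℕ → Type*} [∀ n, AddCommGroup (M n)] [∀ n, Module ℚ (M n)]

/-- Consistency for a sequence of `W_n`-representations. -/
def WnConsistent (ρ : ∀ n, Representation ℚ (Wgroup n) (M n))
    (φ : ∀ n, M n →ₗ[ℚ] M (n + 1)) : Prop :=
  ∀ n (g : Wgroup n) (v : M n), φ n (ρ n g v) = ρ (n + 1) (inclW n g) (φ n v)

/-- Condition II (surjectivity) for `W_n`-sequences. -/
def WnSurjSpan (ρ : ∀ n, Representation ℚ (Wgroup n) (M n))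
    (φ : ∀ n, M n →ₗ[ℚ] M (n + 1)) (n : ℕ) : Prop :=
  Submodule.span ℚ {x : M (n + 1) | ∃ (g : Wgroup (n + 1)) (v : M n),
    x = ρ (n + 1) g (φ n v)} = ⊤

/-- Uniform multiplicity stability for `W_n`-sequences. -/
def WnUnifMultStable (S : WnIrrSystem)
    (ρ : ∀ n, Representation ℚ (Wgroup n) (M n)) : Prop :=
  ∃ N, (∀ lam : DoublePartition, lam.minN ≤ N → ∀ n, N ≤ n →
      S.mult lam (ρ n) = S.mult lam (ρ N)) ∧
    (∀ lam : DoublePartition, N < lam.minN → ∀ n, lam.minN ≤ n → S.mult lam (ρ n) = 0)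

/-- Uniform representation stability for `W_n`-sequences. -/
def WnUnifRepStable (S : WnIrrSystem)
    (ρ : ∀ n, Representation ℚ (Wgroup n) (M n))
    (φ : ∀ n, M n →ₗ[ℚ] M (n + 1)) : Prop :=
  (∃ N, ∀ n, N ≤ n → Function.Injective (φ n) ∧ WnSurjSpan ρ φ n) ∧ WnUnifMultStable S ρ

end WnStability

/-- The hyperplane complement `X′_n = {z ∈ ℂⁿ : z_i ≠ ±z_j (i ≠ j), z_i ≠ 0}` (recorded via
the equivalent condition `z_i² ≠ z_j²`, `z_i ≠ 0`).  It is a classifying space for the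
generalized pure braid group `WP_n = π₁(X′_n)` of type `B_n`. -/
noncomputable def hypSpace (n : ℕ) : TopCat :=
  TopCat.of {z : Fin n → ℂ //
    (∀ i j : Fin n, i ≠ j → z i ^ 2 ≠ z j ^ 2) ∧ (∀ i, z i ≠ 0)}

lemma unit_int_cast_sq (u : ℤˣ) : ((u : ℤ) : ℂ) ^ 2 = 1 := by
  have h : (u : ℤ) ^ 2 = 1 := by
    have h2 := Int.units_sq u
    calc (u : ℤ) ^ 2 = ((u ^ 2 : ℤˣ) : ℤ) := by push_cast; ring
    _ = 1 := by rw [h2]; rfl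
  calc ((u : ℤ) : ℂ) ^ 2 = (((u : ℤ) ^ 2 : ℤ) : ℂ) := by push_cast; ring
  _ = 1 := by rw [h]; norm_num

/-- The action of the hyperoctahedral group `W_n` on `X′_n`, permuting and negating the
coordinates. -/
noncomputable def hypPermMap (n : ℕ) (w : Wgroup n) : hypSpace n ⟶ hypSpace n :=
  TopCat.ofHom ⟨fun z => ⟨fun i => ((w.left i : ℤ) : ℂ) * z.1 ((w.right⁻¹ : Equiv.Perm (Fin n)) i), by
      constructor
      · intro i j hij heq
        rw [mul_pow, mul_pow, unit_int_cast_sq, unit_int_cast_sq, one_mul, one_mul] at heq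
        exact z.2.1 _ _ (fun hc => hij (by
          have := congrArg (w.right : Equiv.Perm (Fin n)) hc
          simpa using this)) heq
      · intro i
        exact mul_ne_zero (Int.cast_ne_zero.2 (w.left i).ne_zero) (z.2.2 _)⟩,
    by
      apply Continuous.subtype_mk
      exact continuous_pi fun i =>
        (continuous_const.mul ((continuous_apply _).comp continuous_subtype_val))⟩

/-- The projection `X′_{n+1} → X′_n` forgetting the last coordinate. -/
noncomputable def hypForgetMap (n : ℕ) : hypSpace (n + 1) ⟶ hypSpace n :=
  TopCat.ofHom ⟨fun z => ⟨z.1 ∘ Fin.castSucc, by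
      constructor
      · intro i j hij
        exact z.2.1 _ _ (fun hc => hij (Fin.castSucc_injective n hc))
      · intro i
        exact z.2.2 _⟩,
    by
      apply Continuous.subtype_mk
      exact continuous_pi fun i => (continuous_apply _).comp continuous_subtype_val⟩

lemma hypPermMap_one (n : ℕ) : hypPermMap n 1 = 𝟙 (hypSpace n) := by
  apply TopCat.hom_ext
  apply ContinuousMap.ext
  intro z
  apply Subtype.ext
  funext i
  show ((((1 : Wgroup n).left i : ℤ)) : ℂ) * z.1 (((1 : Wgroup n).right⁻¹ : Equiv.Perm (Fin n)) i)
    = z.1 i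
  simp

lemma hypPermMap_mul (n : ℕ) (w₁ w₂ : Wgroup n) :
    hypPermMap n (w₁ * w₂) = hypPermMap n w₂ ≫ hypPermMap n w₁ := by
  apply TopCat.hom_ext
  apply ContinuousMap.ext
  intro z
  apply Subtype.ext
  funext i
  show (((w₁ * w₂).left i : ℤ) : ℂ) * z.1 (((w₁ * w₂).right⁻¹ : Equiv.Perm (Fin n)) i) =
    ((w₁.left i : ℤ) : ℂ) * ((((w₂.left ((w₁.right⁻¹ : Equiv.Perm (Fin n)) i) : ℤ)) : ℂ) *
      z.1 ((w₂.right⁻¹ : Equiv.Perm (Fin n)) ((w₁.right⁻¹ : Equiv.Perm (Fin n)) i)))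
  simp [SemidirectProduct.mul_left, SemidirectProduct.mul_right, permMulAut, mul_inv_rev,
    Function.comp, Int.cast_mul, mul_assoc]


/-- The action of `W_n` on the hyperplane complement `X′_n`. -/
noncomputable instance hypMulAction (n : ℕ) : MulAction (Wgroup n) ↑(hypSpace n) where
  smul w z := (hypPermMap n w) z
  one_smul z := ConcreteCategory.congr_hom (hypPermMap_one n) z
  mul_smul a b z := ConcreteCategory.congr_hom (hypPermMap_mul n a b) z

/-- The space `Y′_n = X′_n/W_n`. -/
noncomputable def hypQuot (n : ℕ) : TopCat :=
  TopCat.of (Quotient (MulAction.orbitRel (Wgroup n) ↑(hypSpace n)))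

/-- A basepoint of `X′_n`: the configuration `(1, 2, …, n)`. -/
def hypBase (n : ℕ) : ↑(hypSpace n) :=
  ⟨fun i => (((i : ℕ) + 1 : ℕ) : ℂ), by
    constructor
    · intro i j hij heq
      have heq' : ((((i : ℕ) + 1 : ℕ) : ℂ)) ^ 2 = ((((j : ℕ) + 1 : ℕ) : ℂ)) ^ 2 := heq
      have h1 : (((i : ℕ) + 1) ^ 2 : ℕ) = (((j : ℕ) + 1) ^ 2 : ℕ) := by exact_mod_cast heq'
      have h2 := Nat.pow_left_injective (by norm_num) h1
      exact hij (Fin.ext (Nat.succ_injective h2))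
    · intro i
      exact Nat.cast_ne_zero.2 (Nat.succ_ne_zero _)⟩

/-- The quotient map `X′_n → Y′_n`. -/
noncomputable def hypQuotMap (n : ℕ) : hypSpace n ⟶ hypQuot n :=
  TopCat.ofHom ⟨Quotient.mk (MulAction.orbitRel (Wgroup n) ↑(hypSpace n)), continuous_quot_mk⟩

/-- The generalized braid group `WB_n = π₁(Y′_n)` of type `B_n`. -/
noncomputable def WBraidGrp (n : ℕ) : Type :=
  Aut (FundamentalGroupoid.mk ((hypQuotMap n) (hypBase n)))

noncomputable instance (n : ℕ) : Group (WBraidGrp n) := by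
  unfold WBraidGrp; infer_instance

/-- The map `WP_n = π₁(X′_n) → π₁(Y′_n) = WB_n` induced by the covering `X′_n → Y′_n`. -/
noncomputable def wpureToWBraid (n : ℕ) :
    Aut (FundamentalGroupoid.mk (hypBase n)) →* WBraidGrp n :=
  pi1Map (hypQuotMap n) (hypBase n)

section
/-! ## Loops in fundamental groups and logarithmic increments -/

namespace WB

open unitInterval CategoryTheory

section Loops

variable {X : Type} [TopologicalSpace X] {x : X}

/-- The loop attached to an automorphism, normalised so that products of automorphisms
correspond to concatenations of loops in the same order. -/
noncomputable def lp (g : Aut (FundamentalGroupoid.mk x)) : Path.Homotopic.Quotient x x := g.inv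

lemma lp_mul (g h : Aut (FundamentalGroupoid.mk x)) : lp (g * h) = (lp g).trans (lp h) := rfl

lemma lp_one : lp (1 : Aut (FundamentalGroupoid.mk x)) = .refl x := rfl

lemma lp_injective : Function.Injective (lp (x := x)) := by
  intro g h hgh
  have : g.symm = h.symm := Iso.ext hgh
  exact congrArg Iso.symm this

/-- The automorphism attached to a loop. -/
noncomputable def ofLp (γ : Path.Homotopic.Quotient x x) : Aut (FundamentalGroupoid.mk x) :=
  ((Groupoid.isoEquivHom _ _).symm
    (show FundamentalGroupoid.mk x ⟶ FundamentalGroupoid.mk x from γ)).symm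

@[simp] lemma lp_ofLp (γ : Path.Homotopic.Quotient x x) : lp (ofLp γ) = γ := rfl

@[simp] lemma ofLp_lp (g : Aut (FundamentalGroupoid.mk x)) : ofLp (lp g) = g :=
  lp_injective (lp_ofLp _)

end Loops

lemma lp_pi1Map {X Y : TopCat.{0}} (q : X ⟶ Y) (x : X) (g : Aut (FundamentalGroupoid.mk x)) :
    lp (pi1Map q x g) = (lp g).map q.hom := rfl

/-! ### Logarithmic increments -/

/-- The punctured plane. -/
abbrev Cx : Type := {z : ℂ // z ≠ 0}

/-- The exponential map onto the punctured plane. -/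
noncomputable def ex : ℂ → Cx := fun z => ⟨_, z.exp_ne_zero⟩

lemma ex_cov : IsCoveringMap ex := Complex.isCoveringMap_exp

/-- The increment of the logarithm along a path in the punctured plane. -/
noncomputable def incC (γ : C(I, Cx)) : ℂ :=
  ex_cov.liftPath γ (Complex.log (γ 0).1) (Subtype.ext (Complex.exp_log (γ 0).2).symm) 1
    - Complex.log (γ 0).1

lemma incC_eq (γ : C(I, Cx)) (Γ : C(I, ℂ)) (h : ∀ t, Complex.exp (Γ t) = (γ t).1) :
    incC γ = Γ 1 - Γ 0 := by
  have h0 : Complex.exp (Complex.log (γ 0).1 - Γ 0) = 1 := by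
    rw [Complex.exp_sub, Complex.exp_log (γ 0).2, h, div_self (γ 0).2]
  have key : (Γ + ContinuousMap.const I (Complex.log (γ 0).1 - Γ 0)) =
      ex_cov.liftPath γ (Complex.log (γ 0).1)
        (Subtype.ext (Complex.exp_log (γ 0).2).symm) := by
    rw [ex_cov.eq_liftPath_iff']
    constructor
    · funext t
      apply Subtype.ext
      show Complex.exp (Γ t + (Complex.log (γ 0).1 - Γ 0)) = _
      rw [Complex.exp_add, h0, mul_one, h]
    · simp
  rw [incC, ← key]
  simp
  ring

lemma incC_exists (γ : C(I, Cx)) (a : ℂ) (ha : Complex.exp a = (γ 0).1) :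
    ∃ Γ : C(I, ℂ), (∀ t, Complex.exp (Γ t) = (γ t).1) ∧ Γ 0 = a :=
  ⟨ex_cov.liftPath γ a (Subtype.ext ha.symm),
    fun t => congrArg Subtype.val (congrFun (ex_cov.liftPath_lifts γ a _) t),
    ex_cov.liftPath_zero _ _ _⟩

lemma incC_exp (γ : C(I, Cx)) : Complex.exp (incC γ) = (γ 1).1 / (γ 0).1 := by
  obtain ⟨Γ, h, -⟩ := incC_exists γ _ (Complex.exp_log (γ 0).2)
  rw [incC_eq γ Γ h, Complex.exp_sub, h, h]

lemma incC_trans {x y z : Cx} (γ : Path x y) (γ' : Path y z) :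
    incC (γ.trans γ') = incC γ + incC γ' := by
  obtain ⟨Γ, h, -⟩ := incC_exists γ _ (Complex.exp_log (γ 0).2)
  obtain ⟨Γ', h', h0'⟩ := incC_exists γ' (Γ 1) (by rw [h]; simp)
  let P : Path (Γ 0) (Γ 1) := ⟨Γ, rfl, rfl⟩
  let P' : Path (Γ 1) (Γ' 1) := ⟨Γ', h0', rfl⟩
  rw [incC_eq γ Γ h, incC_eq γ' Γ' h', incC_eq (γ.trans γ') (P.trans P')]
  · simp [h0']
  · intro t
    simp only [ContinuousMap.coe_coe, Path.trans_apply]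
    split_ifs
    · exact h _
    · exact h' _

lemma incC_homotopicRel {γ γ' : C(I, Cx)} (h : γ.HomotopicRel γ' {0, 1}) :
    incC γ = incC γ' := by
  have h0 : γ 0 = γ' 0 := h.some.fst_eq_snd (by simp)
  unfold incC
  rw [ex_cov.liftPath_apply_one_eq_of_homotopicRel h (Complex.log (γ 0).1)
    (Subtype.ext (Complex.exp_log (γ 0).2).symm)
    (Subtype.ext (by rw [← h0]; exact (Complex.exp_log (γ 0).2).symm))]
  congr 1
  · congr 2
    rw [h0]
  · rw [h0]

section General

variable {X : Type} [TopologicalSpace X]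

/-- The increment of `log ℓ` along a homotopy class of paths. -/
noncomputable def inc (l : C(X, Cx)) {x y : X} (γ : Path.Homotopic.Quotient x y) : ℂ :=
  _root_.Quotient.lift (s := Path.Homotopic.setoid x y) (fun γ : Path x y => incC (l.comp γ))
    (fun _ _ h => incC_homotopicRel (ContinuousMap.HomotopicRel.comp_continuousMap h l)) γ

lemma inc_mk (l : C(X, Cx)) {x y : X} (γ : Path x y) :
    inc l (Path.Homotopic.Quotient.mk γ) = incC (l.comp γ) := rfl

lemma inc_trans (l : C(X, Cx)) {x y z : X} (γ : Path.Homotopic.Quotient x y)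
    (γ' : Path.Homotopic.Quotient y z) : inc l (γ.trans γ') = inc l γ + inc l γ' := by
  obtain ⟨γ⟩ := γ
  obtain ⟨γ'⟩ := γ'
  show incC (l.comp (γ.trans γ')) = incC (l.comp γ) + incC (l.comp γ')
  have h := incC_trans (γ.map l.continuous) (γ'.map l.continuous)
  rw [← Path.map_trans] at h
  exact h

lemma inc_map {Y : Type} [TopologicalSpace Y] (l : C(Y, Cx)) (f : C(X, Y)) {x y : X}
    (γ : Path.Homotopic.Quotient x y) : inc l (γ.map f) = inc (l.comp f) γ := by
  obtain ⟨γ⟩ := γ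
  rfl

end General

end WB
end

section
/-! ## The covering `X'_n → Y'_n`, marked points and the crossed homomorphism -/

namespace WB

open unitInterval CategoryTheory Topology

lemma hyp_smul_apply (n : ℕ) (w : Wgroup n) (z : ↑(hypSpace n)) (i : Fin n) :
    (w • z).1 i = ((w.left i : ℤ) : ℂ) * z.1 ((w.right⁻¹ : Equiv.Perm (Fin n)) i) := rfl

instance hyp_contSMul (n : ℕ) : ContinuousConstSMul (Wgroup n) ↑(hypSpace n) :=
  ⟨fun w => (hypPermMap n w).hom.continuous⟩

instance (n : ℕ) : Finite (Wgroup n) := Finite.of_equiv _ SemidirectProduct.equivProd.symm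

noncomputable instance wFintype (n : ℕ) : Fintype (Wgroup n) := Fintype.ofFinite _

lemma hyp_isOpen (n : ℕ) : IsOpen {z : Fin n → ℂ |
    (∀ i j : Fin n, i ≠ j → z i ^ 2 ≠ z j ^ 2) ∧ (∀ i, z i ≠ 0)} := by
  simp only [Set.ofPred_and, Set.ofPred_forall]
  apply IsOpen.inter
  · refine isOpen_iInter_of_finite fun i => isOpen_iInter_of_finite fun j =>
      isOpen_iInter_of_finite fun _ => ?_
    exact isOpen_ne_fun (by fun_prop) (by fun_prop)
  · refine isOpen_iInter_of_finite fun i => ?_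
    exact isOpen_ne_fun (by fun_prop) (by fun_prop)

instance (n : ℕ) : T2Space ↑(hypSpace n) :=
  inferInstanceAs (T2Space {z : Fin n → ℂ //
    (∀ i j : Fin n, i ≠ j → z i ^ 2 ≠ z j ^ 2) ∧ (∀ i, z i ≠ 0)})

instance (n : ℕ) : LocallyCompactSpace ↑(hypSpace n) :=
  (hyp_isOpen n).locallyCompactSpace

lemma unit_mul_ne (e : ℤˣ) {a : ℂ} (ha : a ≠ 0) : ((e : ℤ) : ℂ) * a ≠ 0 :=
  mul_ne_zero (Int.cast_ne_zero.2 e.ne_zero) ha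

instance hyp_free (n : ℕ) : IsCancelSMul (Wgroup n) ↑(hypSpace n) := by
  rw [isCancelSMul_iff_eq_one_of_smul_eq]
  intro w z h
  have h1 : ∀ i, ((w.left i : ℤ) : ℂ) * z.1 ((w.right⁻¹ : Equiv.Perm (Fin n)) i) = z.1 i :=
    fun i => by rw [← hyp_smul_apply, h]
  have h2 : ∀ i, (w.right⁻¹ : Equiv.Perm (Fin n)) i = i := by
    intro i
    by_contra hne
    apply z.2.1 _ _ hne
    rw [← h1 i, mul_pow, unit_int_cast_sq, one_mul]
  have h3 : ∀ i, w.left i = 1 := by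
    intro i
    have := h1 i
    rw [h2, mul_eq_right₀ (z.2.2 i)] at this
    exact Units.ext (Int.cast_injective (α := ℂ) (by simpa using this))
  apply SemidirectProduct.ext
  · funext i; simp [h3]
  · rw [← inv_inj]
    ext i; simp [h2]

lemma hypCov (n : ℕ) : IsQuotientCoveringMap (hypQuotMap n) (Wgroup n) :=
  isQuotientCoveringMap_quotientMk_of_properlyDiscontinuousSMul (G := Wgroup n)
    (E := ↑(hypSpace n))

open Polynomial in
instance hyp_pathConnected (n : ℕ) : PathConnectedSpace ↑(hypSpace n) := by
  refine ⟨⟨hypBase n⟩, fun z w => ?_⟩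
  let f : ℂ → (Fin n → ℂ) := fun t i => z.1 i + t * (w.1 i - z.1 i)
  let q : Fin n → ℂ[X] := fun i => C (z.1 i) + X * C (w.1 i - z.1 i)
  have hq : ∀ i t, (q i).eval t = f t i := by intro i t; simp [q, f]
  let bad : Set ℂ := (⋃ (i : Fin n) (j : Fin n) (_ : i ≠ j), {t | f t i ^ 2 = f t j ^ 2}) ∪
    ⋃ i, {t | f t i = 0}
  have hbad : bad.Finite := by
    apply Set.Finite.union
    · refine Set.finite_iUnion fun i => Set.finite_iUnion fun j => Set.finite_iUnion fun hij => ?_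
      have hne : (q i) ^ 2 - (q j) ^ 2 ≠ 0 := by
        intro h0
        have := congrArg (eval 0) h0
        simp only [eval_sub, eval_pow, hq, eval_zero] at this
        apply z.2.1 i j hij
        simpa [f, sub_eq_zero] using this
      refine (((q i) ^ 2 - (q j) ^ 2).roots.toFinset.finite_toSet).subset fun t ht => ?_
      simp only [Finset.mem_coe, Multiset.mem_toFinset, mem_roots hne, IsRoot.def, eval_sub,
        eval_pow, hq]
      rw [sub_eq_zero]
      exact ht
    · refine Set.finite_iUnion fun i => ?_
      have hne : q i ≠ 0 := by
        intro h0
        have := congrArg (eval 0) h0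
        rw [hq] at this
        apply z.2.2 i
        simpa [f] using this
      refine ((q i).roots.toFinset.finite_toSet).subset fun t ht => ?_
      simp only [Finset.mem_coe, Multiset.mem_toFinset, mem_roots hne, IsRoot.def, hq]
      exact ht
  have hgood : ∀ t ∈ badᶜ, (∀ i j : Fin n, i ≠ j → f t i ^ 2 ≠ f t j ^ 2) ∧ (∀ i, f t i ≠ 0) := by
    intro t ht
    simp only [bad, Set.mem_compl_iff, Set.mem_union, Set.mem_iUnion, Set.mem_ofPred_eq, not_or,
      not_exists] at ht
    exact ⟨fun i j hij => ht.1 i j hij, ht.2⟩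
  have hf0 : f 0 = z.1 := by funext i; simp [f]
  have hf1 : f 1 = w.1 := by funext i; simp [f]
  have h0 : (0 : ℂ) ∈ badᶜ := by
    simp only [bad, Set.mem_compl_iff, Set.mem_union, Set.mem_iUnion, Set.mem_ofPred_eq, not_or,
      not_exists, hf0]
    exact ⟨fun i j hij => z.2.1 i j hij, z.2.2⟩
  have h1 : (1 : ℂ) ∈ badᶜ := by
    simp only [bad, Set.mem_compl_iff, Set.mem_union, Set.mem_iUnion, Set.mem_ofPred_eq, not_or,
      not_exists, hf1]
    exact ⟨fun i j hij => w.2.1 i j hij, w.2.2⟩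
  have hpc := hbad.countable.isPathConnected_compl_of_one_lt_rank
    (by rw [Complex.rank_real_complex]; exact Nat.one_lt_ofNat)
  obtain ⟨γ, hγ⟩ := hpc.joinedIn 0 h0 1 h1
  exact ⟨⟨⟨fun t => ⟨f (γ t), hgood _ (hγ t)⟩, by
      apply Continuous.subtype_mk
      simp only [f]
      fun_prop⟩,
    Subtype.ext (by show f (γ 0) = z.1; rw [γ.source, hf0]),
    Subtype.ext (by show f (γ 1) = w.1; rw [γ.target, hf1])⟩⟩

/-! ### The projection `WB_n → W_n` -/

/-- The base point in the fibre. -/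
noncomputable def fb (n : ℕ) : (hypQuotMap n) ⁻¹' {hypQuotMap n (hypBase n)} := ⟨hypBase n, rfl⟩

/-- The projection `WB_n → W_n`. -/
noncomputable def pW (n : ℕ) : WBraidGrp n →* Wgroup n where
  toFun g := ((hypCov n).fundamentalGroupToMulOpposite (fb n) (lp g)).unop
  map_one' := by
    show ((hypCov n).fundamentalGroupToMulOpposite (fb n) 1).unop = 1
    rw [map_one, MulOpposite.unop_one]
  map_mul' g h := by
    show ((hypCov n).fundamentalGroupToMulOpposite (fb n)
      ((show FundamentalGroup _ _ from lp h) * (show FundamentalGroup _ _ from lp g))).unop = _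
    rw [map_mul, MulOpposite.unop_mul]

lemma pW_smul (n : ℕ) (g : WBraidGrp n) :
    pW n g • hypBase n = ((hypCov n).isCoveringMap.monodromy (lp g) (fb n)).1 :=
  (hypCov n).unop_fundamentalGroupToMulOpposite_smul (e := fb n)

lemma pW_surjective (n : ℕ) : Function.Surjective (pW n) := by
  intro w
  obtain ⟨γ, hγ⟩ := (hypCov n).fundamentalGroupToMulOpposite_surjective (fb n) (MulOpposite.op w)
  refine ⟨ofLp γ, ?_⟩
  show ((hypCov n).fundamentalGroupToMulOpposite (fb n) (lp (ofLp γ))).unop = w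
  rw [lp_ofLp, hγ, MulOpposite.unop_op]

lemma mapOfEq_rfl {X Y : Type} [TopologicalSpace X] [TopologicalSpace Y] (f : C(X, Y)) (x : X)
    (h : f x = f x) (γ : Path.Homotopic.Quotient x x) :
    (FundamentalGroup.mapOfEq f h (show FundamentalGroup X x from γ)) =
      (show FundamentalGroup Y (f x) from γ.map f) := by
  have h1 := FundamentalGroup.mapOfEq_apply f h (show FundamentalGroup X x from γ)
  rw [h1]
  exact Path.Homotopic.Quotient.cast_rfl_rfl _

lemma pW_ker (n : ℕ) : (pW n).ker = (wpureToWBraid n).range := by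
  ext g
  have h1 : g ∈ (pW n).ker ↔ (show FundamentalGroup _ _ from lp g) ∈
      ((hypCov n).fundamentalGroupToMulOpposite (fb n)).ker := by
    rw [MonoidHom.mem_ker, MonoidHom.mem_ker, ← MulOpposite.unop_eq_one_iff]
    rfl
  rw [h1, (hypCov n).ker_fundamentalGroupToMulOpposite (fb n),
    (hypCov n).ker_monodromyPerm (fb n)]
  constructor
  · rintro ⟨γ, hγ⟩
    refine ⟨ofLp γ, lp_injective ?_⟩
    exact (mapOfEq_rfl (hypQuotMap n).hom (hypBase n) rfl γ).symm.trans hγ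
  · rintro ⟨γ, rfl⟩
    exact ⟨lp γ, mapOfEq_rfl (hypQuotMap n).hom (hypBase n) rfl (lp γ)⟩

lemma wpure_injective (n : ℕ) : Function.Injective (wpureToWBraid n) := by
  intro g h hgh
  apply lp_injective
  apply (hypCov n).isCoveringMap.injective_path_homotopic_map
  exact congrArg lp hgh

end WB
end

section
/-! ## Marked points and the crossed homomorphism -/

namespace WB

open unitInterval CategoryTheory Topology

/-- The labels of the marked points `0, ±z_1, …, ±z_n`. -/
inductive Om (n : ℕ) : Type
  | zero : Om n
  | pt (i : Fin n) (e : ℤˣ) : Om n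

/-- `Om n` as a concrete type. -/
def omEquiv (n : ℕ) : Om n ≃ Option (Fin n × ℤˣ) where
  toFun x := match x with
    | .zero => none
    | .pt i e => some (i, e)
  invFun x := match x with
    | none => .zero
    | some (i, e) => .pt i e
  left_inv x := by cases x <;> rfl
  right_inv x := by cases x <;> rfl

instance (n : ℕ) : Finite (Om n) := Finite.of_equiv _ (omEquiv n).symm

noncomputable instance (n : ℕ) : Fintype (Om n) := Fintype.ofFinite _

noncomputable instance (n : ℕ) : DecidableEq (Om n) := Classical.decEq _

instance omAction (n : ℕ) : MulAction (Wgroup n) (Om n) where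
  smul w x := match x with
    | .zero => .zero
    | .pt i e => .pt (w.right i) (w.left (w.right i) * e)
  one_smul x := by
    cases x with
    | zero => rfl
    | pt i e =>
      show Om.pt _ _ = Om.pt _ _
      simp
  mul_smul a b x := by
    cases x with
    | zero => rfl
    | pt i e =>
      show Om.pt _ _ = Om.pt _ _
      simp [permMulAut, mul_assoc]

lemma om_smul_zero (n : ℕ) (w : Wgroup n) : w • (Om.zero : Om n) = Om.zero := rfl

lemma om_smul_pt (n : ℕ) (w : Wgroup n) (i : Fin n) (e : ℤˣ) :
    w • (Om.pt i e : Om n) = Om.pt (w.right i) (w.left (w.right i) * e) := rfl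

/-- The marked point with a given label. -/
noncomputable def ptv {n : ℕ} (z : Fin n → ℂ) : Om n → ℂ
  | .zero => 0
  | .pt i e => ((e : ℤ) : ℂ) * z i

lemma ptv_smul (n : ℕ) (w : Wgroup n) (z : ↑(hypSpace n)) (x : Om n) :
    ptv (w • z).1 (w • x) = ptv z.1 x := by
  cases x with
  | zero => rfl
  | pt i e =>
    rw [om_smul_pt]
    simp only [ptv]
    rw [hyp_smul_apply]
    have h := unit_int_cast_sq (w.left (w.right i))
    have h2 : (w.right⁻¹ : Equiv.Perm (Fin n)) (w.right i) = i := w.right.symm_apply_apply i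
    rw [h2]
    simp only [Units.val_mul, Int.cast_mul]
    linear_combination (((e : ℤ) : ℂ) * z.1 i) * h

lemma ptv_injective {n : ℕ} (z : ↑(hypSpace n)) : Function.Injective (ptv z.1) := by
  have h0 : ∀ i (e : ℤˣ), ((e : ℤ) : ℂ) * z.1 i ≠ 0 := fun i e => unit_mul_ne e (z.2.2 i)
  intro x y h
  cases x with
  | zero =>
    cases y with
    | zero => rfl
    | pt i e => exact absurd h.symm (h0 i e)
  | pt i e =>
    cases y with
    | zero => exact absurd h (h0 i e)
    | pt j f =>
      simp only [ptv] at h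
      have hij : i = j := by
        by_contra hne
        apply z.2.1 i j hne
        have h2 := congrArg (fun t => t ^ 2) h
        simpa [mul_pow, unit_int_cast_sq] using h2
      subst hij
      have hef := mul_right_cancel₀ (z.2.2 i) h
      have : e = f := Units.ext (Int.cast_injective (α := ℂ) hef)
      rw [this]

lemma continuous_ptv {n : ℕ} (x : Om n) : Continuous fun z : ↑(hypSpace n) => ptv z.1 x := by
  cases x with
  | zero => exact continuous_const
  | pt i e =>
    exact continuous_const.mul ((continuous_apply i).comp continuous_subtype_val)

/-- Pairs of marked points. -/
abbrev SS (n : ℕ) : Type := Om n × Om n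

open Classical in
/-- The function `z ↦ pt x - pt y` (and `1` on the diagonal). -/
noncomputable def ell (n : ℕ) (s : SS n) : C(↑(hypSpace n), Cx) :=
  if h : s.1 = s.2 then ContinuousMap.const _ ⟨1, one_ne_zero⟩ else
    ⟨fun z => ⟨ptv z.1 s.1 - ptv z.1 s.2, sub_ne_zero.2 fun hh => h (ptv_injective z hh)⟩,
      ((continuous_ptv _).sub (continuous_ptv _)).subtype_mk _⟩

lemma ell_val_ne {n : ℕ} {s : SS n} (h : s.1 ≠ s.2) (z : ↑(hypSpace n)) :
    (ell n s z).1 = ptv z.1 s.1 - ptv z.1 s.2 := by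
  rw [ell, dif_neg h]
  rfl

lemma ell_val_eq {n : ℕ} {s : SS n} (h : s.1 = s.2) (z : ↑(hypSpace n)) :
    (ell n s z).1 = 1 := by
  rw [ell, dif_pos h]
  rfl

lemma ell_smul (n : ℕ) (w : Wgroup n) (s : SS n) (z : ↑(hypSpace n)) :
    ell n (w • s) (w • z) = ell n s z := by
  apply Subtype.ext
  by_cases h : s.1 = s.2
  · rw [ell_val_eq h, ell_val_eq (by rw [Prod.smul_fst, Prod.smul_snd, h])]
  · rw [ell_val_ne h, ell_val_ne (by
      rw [Prod.smul_fst, Prod.smul_snd]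
      exact fun hh => h (smul_left_cancel w hh)), Prod.smul_fst, Prod.smul_snd, ptv_smul, ptv_smul]

/-- The complex-valued crossed homomorphism. -/
noncomputable def uC (n : ℕ) (s : SS n) (g : WBraidGrp n) : ℂ :=
  inc (ell n s) ((hypCov n).isCoveringMap.liftPathQuotient (lp g) (fb n))

lemma uC_eq (n : ℕ) (s : SS n) (g : WBraidGrp n)
    (γ : Path (hypQuotMap n (hypBase n)) (hypQuotMap n (hypBase n)))
    (hγ : lp g = Path.Homotopic.Quotient.mk γ) (Γ : C(I, ↑(hypSpace n))) (h0 : Γ 0 = hypBase n)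
    (h : ∀ t, hypQuotMap n (Γ t) = γ t) : uC n s g = incC ((ell n s).comp Γ) := by
  have : Γ = (hypCov n).isCoveringMap.liftPath γ (hypBase n) γ.source := by
    rw [(hypCov n).isCoveringMap.eq_liftPath_iff']
    exact ⟨funext h, h0⟩
  rw [this, uC, hγ]
  rfl

lemma exists_lift (n : ℕ) (g : WBraidGrp n) :
    ∃ (γ : Path (hypQuotMap n (hypBase n)) (hypQuotMap n (hypBase n))) (Γ : C(I, ↑(hypSpace n))),
      lp g = Path.Homotopic.Quotient.mk γ ∧ Γ 0 = hypBase n ∧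
      (∀ t, hypQuotMap n (Γ t) = γ t) ∧ Γ 1 = pW n g • hypBase n := by
  obtain ⟨γ, hγ⟩ := Path.Homotopic.Quotient.mk_surjective (lp g)
  refine ⟨γ, (hypCov n).isCoveringMap.liftPath γ (hypBase n) γ.source, hγ.symm,
    (hypCov n).isCoveringMap.liftPath_zero _ _ _,
    fun t => congrFun ((hypCov n).isCoveringMap.liftPath_lifts γ (hypBase n) γ.source) t, ?_⟩
  rw [pW_smul, ← hγ]
  rfl

lemma uC_mul (n : ℕ) (s : SS n) (g h : WBraidGrp n) :
    uC n s (g * h) = uC n s g + uC n ((pW n g)⁻¹ • s) h := by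
  obtain ⟨γ, Γ, hγ, h0, hl, h1⟩ := exists_lift n g
  obtain ⟨γ', Γ', hγ', h0', hl', h1'⟩ := exists_lift n h
  rw [uC_eq n _ g γ hγ Γ h0 hl, uC_eq n _ h γ' hγ' Γ' h0' hl']
  set w := pW n g
  let P : Path (hypBase n) (w • hypBase n) := ⟨Γ, h0, h1⟩
  let P' : Path (w • hypBase n) (w • Γ' 1) :=
    ⟨⟨fun t => w • Γ' t, (continuous_const_smul w).comp Γ'.continuous⟩, by simp [h0'], rfl⟩
  rw [uC_eq n s (g * h) (γ.trans γ') (by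
      refine Eq.trans (show lp (g * h) = (lp g).trans (lp h) from rfl) ?_
      rw [hγ, hγ']
      rfl) (P.trans P')]
  · have key := incC_trans (P.map (ell n s).continuous) (P'.map (ell n s).continuous)
    rw [← Path.map_trans] at key
    refine Eq.trans key ?_
    congr 2
    ext t
    have := ell_smul n w (w⁻¹ • s) (Γ' t)
    rw [smul_inv_smul] at this
    exact congrArg Subtype.val this
  · exact Path.source _
  · intro t
    simp only [ContinuousMap.coe_coe, Path.trans_apply]
    split_ifs
    · exact hl _
    · refine Eq.trans ?_ (hl' _)
      exact ((hypCov n).map_smul w)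

lemma uC_pure (n : ℕ) (s : SS n) (g : Aut (FundamentalGroupoid.mk (hypBase n))) :
    uC n s (wpureToWBraid n g) = inc (ell n s) (lp g) := by
  obtain ⟨Γ, hΓ⟩ := Path.Homotopic.Quotient.mk_surjective (lp g)
  have h1 : lp (wpureToWBraid n g) = (lp g).map (hypQuotMap n).hom := lp_pi1Map _ _ _
  rw [← hΓ] at h1 ⊢
  rw [uC_eq n s _ (Γ.map (hypQuotMap n).hom.continuous) h1 Γ Γ.source (fun t => rfl)]
  rfl

lemma exists_lam : ∃ L : ℂ →ₗ[ℚ] ℚ, L (2 * Real.pi * Complex.I) = 1 := by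
  obtain ⟨f, hf⟩ := LinearMap.exists_leftInverse_of_injective
    (LinearMap.toSpanSingleton ℚ ℂ (2 * Real.pi * Complex.I)) (by
      rw [LinearMap.ker_eq_bot]
      intro a b hab
      exact smul_left_injective ℚ Complex.two_pi_I_ne_zero hab)
  exact ⟨f, by simpa using LinearMap.congr_fun hf 1⟩

/-- A `ℚ`-linear functional on `ℂ` with value `1` at `2πi`. -/
noncomputable def lam : ℂ →ₗ[ℚ] ℚ := exists_lam.choose

lemma lam_two_pi_I : lam (2 * Real.pi * Complex.I) = 1 := exists_lam.choose_spec

/-- The rational crossed homomorphism. -/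
noncomputable def uG (n : ℕ) (s : SS n) (g : WBraidGrp n) : ℚ := lam (uC n s g)

lemma uG_mul (n : ℕ) (s : SS n) (g h : WBraidGrp n) :
    uG n s (g * h) = uG n s g + uG n ((pW n g)⁻¹ • s) h := by
  rw [uG, uC_mul, map_add]; rfl

lemma uG_pure (n : ℕ) (s : SS n) (g : Aut (FundamentalGroupoid.mk (hypBase n))) :
    uG n s (wpureToWBraid n g) = lam (inc (ell n s) (lp g)) := by
  rw [uG, uC_pure]

/-! ### Compatibility with forgetting the last coordinate -/

/-- Labels of `X'_n` as labels of `X'_{n+1}`. -/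
def omCS {n : ℕ} : Om n → Om (n + 1)
  | .zero => .zero
  | .pt i e => .pt i.castSucc e

lemma omCS_injective {n : ℕ} : Function.Injective (omCS (n := n)) := by
  intro x y h
  cases x <;> cases y <;> simp_all [omCS]

/-- Pairs of labels of `X'_n` as pairs of labels of `X'_{n+1}`. -/
def ssCS {n : ℕ} (s : SS n) : SS (n + 1) := (omCS s.1, omCS s.2)

lemma ptv_forget {n : ℕ} (z : ↑(hypSpace (n + 1))) (x : Om n) :
    ptv (hypForgetMap n z).1 x = ptv z.1 (omCS x) := by
  cases x <;> rfl

lemma ell_forget {n : ℕ} (s : SS n) :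
    (ell n s).comp (hypForgetMap n).hom = ell (n + 1) (ssCS s) := by
  ext z
  show (ell n s (hypForgetMap n z)).1 = _
  by_cases h : s.1 = s.2
  · rw [ell_val_eq h, ell_val_eq (by simp [ssCS, h])]
  · rw [ell_val_ne h, ell_val_ne (fun hh => h (omCS_injective hh)), ptv_forget, ptv_forget]
    rfl

/-- The group `P_n`. -/
abbrev PG (n : ℕ) : Type := Aut (FundamentalGroupoid.mk (hypBase n))

lemma forget_base (n : ℕ) : hypForgetMap n (hypBase (n + 1)) = hypBase n := rfl

/-- The forgetful homomorphism `P_{n+1} → P_n`. -/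
noncomputable def phiP (n : ℕ) : PG (n + 1) →* PG n := pi1Map (hypForgetMap n) (hypBase (n + 1))

lemma lp_phiP (n : ℕ) (g : PG (n + 1)) : lp (phiP n g) = (lp g).map (hypForgetMap n).hom := rfl

/-- The rational homomorphisms on `P_n`. -/
noncomputable def uP (n : ℕ) (s : SS n) (g : PG n) : ℚ := lam (inc (ell n s) (lp g))

lemma uP_mul (n : ℕ) (s : SS n) (g h : PG n) : uP n s (g * h) = uP n s g + uP n s h := by
  rw [uP, lp_mul, inc_trans, map_add]; rfl

lemma uP_phiP (n : ℕ) (s : SS n) (g : PG (n + 1)) :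
    uP n s (phiP n g) = uP (n + 1) (ssCS s) g := by
  rw [uP, lp_phiP]
  exact congrArg lam ((inc_map (ell n s) (hypForgetMap n).hom (lp g)).trans (by rw [ell_forget]))

end WB
end

section
/-! ## A van Kampen type argument -/

namespace WB

open unitInterval CategoryTheory Topology

section VK

variable {X : Type} [TopologicalSpace X] (U : Bool → Set X)

/-- Data for the van Kampen argument. -/
structure VKData (b : X) : Prop where
  isOpen : ∀ i, IsOpen (U i)
  cover : ∀ x, ∃ i, x ∈ U i
  base : ∀ i, b ∈ U i
  conn : ∀ i x, x ∈ U i → ∃ p : Path b x, ∀ t, p t ∈ U i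
  sc : ∀ i x y (p q : Path x y), (∀ t, p t ∈ U i) → (∀ t, q t ∈ U i) → p.Homotopic q

variable {U} {b : X} (hV : VKData U b)

/-- The canonical class of paths from the base point to a point of `U i`. -/
noncomputable def VKData.c (i : Bool) (x : X) (hx : x ∈ U i) : Path b x :=
  (hV.conn i x hx).choose

lemma VKData.c_mem (i : Bool) (x : X) (hx : x ∈ U i) (t : I) : hV.c i x hx t ∈ U i :=
  (hV.conn i x hx).choose_spec t

/-- The loop `δ`. -/
noncomputable def VKData.del (x : X) (hx : ∀ i, x ∈ U i) : Path b b :=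
  (hV.c true x (hx _)).trans (hV.c false x (hx _)).symm

lemma mem_trans {x y z : X} {i : Bool} {p : Path x y} {q : Path y z} (hp : ∀ t, p t ∈ U i)
    (hq : ∀ t, q t ∈ U i) (t : I) : p.trans q t ∈ U i := by
  rw [Path.trans_apply]
  split_ifs
  · exact hp _
  · exact hq _

/-- The homotopy class of a path. -/
abbrev hq {x y : X} (p : Path x y) : Path.Homotopic.Quotient x y := Path.Homotopic.Quotient.mk p

lemma qTS {x y z : X} (p : Path.Homotopic.Quotient x y) (q : Path.Homotopic.Quotient y z) :
    (p.trans q).symm = q.symm.trans p.symm := by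
  obtain ⟨p⟩ := p
  obtain ⟨q⟩ := q
  exact congrArg hq (Path.trans_symm p q)

lemma qSS {x y : X} (p : Path.Homotopic.Quotient x y) : p.symm.symm = p := by
  obtain ⟨p⟩ := p
  exact congrArg hq (Path.symm_symm p)

lemma qRS (x : X) : (Path.Homotopic.Quotient.refl x).symm = Path.Homotopic.Quotient.refl x :=
  congrArg hq (Path.refl_symm)

/-- `δ` is constant along paths in the intersection. -/
lemma VKData.del_eq (x y : X) (hx : ∀ i, x ∈ U i) (hy : ∀ i, y ∈ U i) (p : Path x y)
    (hp : ∀ i t, p t ∈ U i) :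
    hq (hV.del x hx) = hq (hV.del y hy) := by
  have h1 : ∀ i, hq (hV.c i y (hy i)) = (hq (hV.c i x (hx i))).trans
      (hq p) := by
    intro i
    apply Path.Homotopic.Quotient.eq.2
    exact hV.sc i _ _ _ _ (hV.c_mem i y (hy i)) (mem_trans (hV.c_mem i x (hx i)) (hp i))
  have e : ∀ z (hz : ∀ i, z ∈ U i), hq (hV.del z hz) =
      (hq (hV.c true z (hz _))).trans (hq (hV.c false z (hz _))).symm :=
    fun _ _ => rfl
  rw [e, e, h1 true, h1 false, qTS,
    Path.Homotopic.Quotient.trans_assoc,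
    ← Path.Homotopic.Quotient.trans_assoc (hq p), Path.Homotopic.Quotient.trans_symm,
    Path.Homotopic.Quotient.refl_trans]

lemma VKData.del_base : hq (hV.del b hV.base) = Path.Homotopic.Quotient.refl b := by
  have h1 : ∀ i, hq (hV.c i b (hV.base i)) = Path.Homotopic.Quotient.refl b := by
    intro i
    apply Path.Homotopic.Quotient.eq.2
    exact hV.sc i _ _ _ _ (hV.c_mem i b (hV.base i)) (fun t => hV.base i)
  have e : hq (hV.del b hV.base) =
      (hq (hV.c true b (hV.base _))).trans (hq (hV.c false b (hV.base _))).symm :=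
    rfl
  rw [e, h1, h1, Path.Homotopic.Quotient.refl_trans, qRS]

lemma lp_inv (g : Aut (FundamentalGroupoid.mk b)) : lp g⁻¹ = (lp g).symm := by
  have h : (lp g).trans (lp g⁻¹) = Path.Homotopic.Quotient.refl b := by
    rw [← lp_mul, mul_inv_cancel, lp_one]
  rw [← Path.Homotopic.Quotient.refl_trans (lp g⁻¹),
    ← Path.Homotopic.Quotient.symm_trans (lp g), Path.Homotopic.Quotient.trans_assoc, h,
    Path.Homotopic.Quotient.trans_refl]

lemma hq_cast_trans {a' y z : X} (h : b = a') (p : Path a' y) (q : Path y z) (r : Path a' z)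
    (hr : (hq p).trans (hq q) = hq r) :
    (hq (p.cast h rfl)).trans (hq q) = hq (r.cast h rfl) := by
  subst h
  exact hr

/-- Generation: the loops `δ` generate the fundamental group. -/
lemma VKData.gen (H : Subgroup (Aut (FundamentalGroupoid.mk b)))
    (hH : ∀ x (hx : ∀ i, x ∈ U i), ofLp (hq (hV.del x hx)) ∈ H)
    (g : Aut (FundamentalGroupoid.mk b)) : g ∈ H := by
  obtain ⟨γ, hγ⟩ := Path.Homotopic.Quotient.mk_surjective (lp g)
  obtain ⟨t, t0, tm, ⟨N, hN⟩, hc⟩ := exists_monotone_Icc_subset_open_cover_unitInterval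
    (c := fun i => γ ⁻¹' (U i)) (fun i => (hV.isOpen i).preimage γ.continuous)
    (fun s _ => by simpa using hV.cover (γ s))
  let tr : ∀ k, Path b (γ (t k)) := fun k => (γ.subpath 0 (t k)).cast γ.source.symm rfl
  have htr : ∀ k, hq (tr (k + 1)) = (hq (tr k)).trans (hq (γ.subpath (t k) (t (k + 1)))) := by
    intro k
    refine (hq_cast_trans γ.source.symm _ _ _ ?_).symm
    exact Path.Homotopic.Quotient.eq.2 ⟨Path.Homotopy.subpathTransSubpath γ 0 (t k) (t (k + 1))⟩
  have e : ∀ z (hz : ∀ i, z ∈ U i), lp (ofLp (hq (hV.del z hz))) =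
      (hq (hV.c true z (hz _))).trans (hq (hV.c false z (hz _))).symm :=
    fun _ _ => rfl
  -- passing from one sign to the other one
  have sw : ∀ (x : X) (p : Path.Homotopic.Quotient b x) (i : Bool) (h : x ∈ U i), (∃ a ∈ H, p =
      (lp a).trans (hq (hV.c i x h))) → ∀ j (h' : x ∈ U j), ∃ a ∈ H, p =
      (lp a).trans (hq (hV.c j x h')) := by
    rintro x p i h ⟨a, ha, hp⟩ j h'
    have hx : i = j ∨ ∀ i, x ∈ U i := by
      cases i <;> cases j <;> simp_all
    rcases hx with rfl | hx
    · exact ⟨a, ha, hp⟩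
    have hd := hH x hx
    cases i <;> cases j
    · exact ⟨a, ha, hp⟩
    · refine ⟨a * (ofLp (hq (hV.del x hx)))⁻¹, H.mul_mem ha (H.inv_mem hd), ?_⟩
      have e2 : lp (ofLp (hq (hV.del x hx)))⁻¹ =
        (hq (hV.c false x (hx _))).trans (hq (hV.c true x (hx _))).symm := by
        rw [lp_inv, e, qTS, qSS]
      rw [lp_mul, e2, hp, Path.Homotopic.Quotient.trans_assoc, Path.Homotopic.Quotient.trans_assoc,
        Path.Homotopic.Quotient.symm_trans, Path.Homotopic.Quotient.trans_refl]
    · refine ⟨a * (ofLp (hq (hV.del x hx))), H.mul_mem ha hd, ?_⟩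
      rw [lp_mul, e, hp, Path.Homotopic.Quotient.trans_assoc, Path.Homotopic.Quotient.trans_assoc,
        Path.Homotopic.Quotient.symm_trans, Path.Homotopic.Quotient.trans_refl]
    · exact ⟨a, ha, hp⟩
  have key : ∀ k, ∃ i, ∃ (h : γ (t k) ∈ U i), ∃ a ∈ H,
      hq (tr k) = (lp a).trans (hq (hV.c i _ h)) := by
    intro k
    induction k with
    | zero =>
      obtain ⟨i, hi⟩ := hV.cover (γ (t 0))
      refine ⟨i, hi, 1, H.one_mem, ?_⟩
      rw [lp_one, Path.Homotopic.Quotient.refl_trans]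
      apply Path.Homotopic.Quotient.eq.2
      refine hV.sc i _ _ _ _ (fun s => ?_) (hV.c_mem i _ _)
      show γ.subpath 0 (t 0) s ∈ U i
      have hi2 := hi
      rw [t0] at hi2
      have h5 : γ.subpath 0 (t 0) s = γ 0 := by
        have : ∀ r : I, r = 0 → γ.subpath 0 r s = γ 0 := by
          rintro r rfl
          rw [Path.subpath_self]
          rfl
        exact this _ t0
      rw [h5]
      exact hi2
    | succ k ih =>
      obtain ⟨i, h, ha⟩ := ih
      obtain ⟨j, hj⟩ := hc k
      have hk : γ (t k) ∈ U j := hj ⟨le_refl _, tm (Nat.le_succ k)⟩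
      have hk' : γ (t (k + 1)) ∈ U j := hj ⟨tm (Nat.le_succ k), le_refl _⟩
      obtain ⟨a, ha, hp⟩ := sw _ _ i h ha j hk
      refine ⟨j, hk', a, ha, ?_⟩
      rw [htr, hp, Path.Homotopic.Quotient.trans_assoc]
      congr 1
      apply Path.Homotopic.Quotient.eq.2
      refine hV.sc j _ _ _ _ (mem_trans (hV.c_mem j _ _) fun s => ?_) (hV.c_mem j _ _)
      have : γ.subpath (t k) (t (k + 1)) s ∈ Set.range (γ.subpath (t k) (t (k + 1))) := ⟨s, rfl⟩
      rw [Path.range_subpath_of_le _ _ _ (tm (Nat.le_succ k))] at this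
      obtain ⟨r, hr, hr'⟩ := this
      rw [← hr']
      exact hj hr
  obtain ⟨i, h, a, ha, hp⟩ := key N
  have : lp g = lp a := by
    have hN1 := hN N le_rfl
    rw [← hγ]
    have h3 : ∀ (s : I) (hs : s = 1) (h : γ s ∈ U i),
        hq ((γ.subpath 0 s).cast γ.source.symm rfl) = (lp a).trans (hq (hV.c i _ h)) →
        hq γ = lp a := by
      rintro s rfl h hp
      have h4 : ∀ (y : X) (hy : b = y) (hyU : y ∈ U i) (q : Path b y)
        (hq' : hq q = (lp a).trans (hq (hV.c i y hyU))), hq (q.cast rfl hy) = lp a := by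
        rintro y rfl hyU q hq'
        have : hq (q.cast rfl rfl) = hq q := rfl
        rw [this, hq']
        have : hq (hV.c i b hyU) = Path.Homotopic.Quotient.refl b :=
          Path.Homotopic.Quotient.eq.2 (hV.sc i _ _ _ _ (hV.c_mem i b _) (fun t => hV.base i))
        rw [this, Path.Homotopic.Quotient.trans_refl]
      rw [← h4 _ γ.target.symm h _ hp]
      congr 1
      rw [Path.subpath_zero_one]
      rfl
    exact h3 _ hN1 h hp
  rw [lp_injective this]
  exact ha

end VK

end WB
end

section
namespace WB

open unitInterval CategoryTheory Topology

section VKcov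

variable {X : Type} [TopologicalSpace X] {U : Bool → Set X} {b : X} (hV : VKData U b)
  {G : Type} [Group G] [TopologicalSpace G] [DiscreteTopology G] (gx : X → G)

/-- Transition functions. -/
noncomputable def trF (i j : Bool) (x : X) : G :=
  match i, j with
  | true, true => 1
  | false, false => 1
  | true, false => gx x
  | false, true => (gx x)⁻¹

lemma trF_self (i : Bool) (x : X) : trF gx i i x = 1 := by cases i <;> rfl

lemma trF_comp (i j k : Bool) (x : X) : trF gx j k x * trF gx i j x = trF gx i k x := by
  cases i <;> cases j <;> cases k <;> simp [trF]

/-- The covering attached to a locally constant transition function. -/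
noncomputable def vkCore (hg : ContinuousOn gx (U true ∩ U false)) : FiberBundleCore Bool X G where
  baseSet := U
  isOpen_baseSet := hV.isOpen
  indexAt x := (hV.cover x).choose
  mem_baseSet_at x := (hV.cover x).choose_spec
  coordChange i j x f := trF gx i j x * f
  coordChange_self i x _ f := by rw [trF_self, one_mul]
  continuousOn_coordChange i j := by
    have h : ContinuousOn (trF gx i j) (U i ∩ U j) := by
      cases i <;> cases j
      · exact continuousOn_const
      · rw [Set.inter_comm]
        exact hg.inv
      · exact hg
      · exact continuousOn_const
    exact (h.comp continuousOn_fst (fun p hp => hp.1)).mul continuousOn_snd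
  coordChange_comp i j k x _ f := by rw [← mul_assoc, trF_comp]

variable (hg : ContinuousOn gx (U true ∩ U false))

lemma vkCov : IsCoveringMap (vkCore hV gx hg).proj :=
  FiberBundle.isCoveringMap (F := G) (E := (vkCore hV gx hg).Fiber)

/-- A point of the total space in a chart. -/
noncomputable def vkPt (i : Bool) (x : X) (f : G) : (vkCore hV gx hg).TotalSpace :=
  ⟨x, trF gx i ((vkCore hV gx hg).indexAt x) x * f⟩

lemma vkPt_change (i j : Bool) (x : X) (f : G) :
    vkPt hV gx hg i x f = vkPt hV gx hg j x (trF gx i j x * f) := by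
  unfold vkPt
  rw [← mul_assoc, trF_comp]

lemma vkPt_injective (i : Bool) (x : X) : Function.Injective (vkPt hV gx hg i x) := by
  intro f f' h
  have : trF gx i ((vkCore hV gx hg).indexAt x) x * f = trF gx i ((vkCore hV gx hg).indexAt x) x * f' := by
    exact eq_of_heq (Bundle.TotalSpace.mk.inj h).2
  exact mul_left_cancel this

lemma vkPt_continuous (i : Bool) (γ : C(I, X)) (hγ : ∀ t, γ t ∈ U i) (f : G) :
    Continuous fun t => vkPt hV gx hg i (γ t) f := by
  have h2 : Continuous fun t => ((vkCore hV gx hg).localTriv i).toOpenPartialHomeomorph.symm (γ t, f) := by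
    have : ContinuousOn ((vkCore hV gx hg).localTriv i).toOpenPartialHomeomorph.symm
      ((vkCore hV gx hg).localTriv i).target := OpenPartialHomeomorph.continuousOn_symm _
    refine this.comp_continuous (by fun_prop) fun t => ?_
    rw [((vkCore hV gx hg).localTriv i).mem_target]
    exact hγ t
  exact h2

lemma vk_mono (i : Bool) {x y : X} (p : Path x y) (hp : ∀ t, p t ∈ U i) (f : G) :
    (vkCov hV gx hg).monodromy (hq p) ⟨vkPt hV gx hg i x f, rfl⟩ =
      ⟨vkPt hV gx hg i y f, rfl⟩ := by
  let Γ : Path (vkPt hV gx hg i x f) (vkPt hV gx hg i y f) :=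
    ⟨⟨fun t => vkPt hV gx hg i (p t) f, vkPt_continuous hV gx hg i p hp f⟩,
      by simp, by simp⟩
  exact (vkCov hV gx hg).monodromy_map (hq Γ)

/-- The relation between loops and elements of the structure group. -/
def vkRel (g : Aut (FundamentalGroupoid.mk b)) (a : G) : Prop :=
  ∀ f : G, (vkCov hV gx hg).monodromy (lp g) ⟨vkPt hV gx hg true b f, rfl⟩ =
      ⟨vkPt hV gx hg true b (a⁻¹ * f), rfl⟩

lemma vkRel_one : vkRel hV gx hg 1 1 := by
  intro f
  rw [lp_one, (vkCov hV gx hg).monodromy_refl, inv_one, one_mul]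
  rfl

lemma vkRel_mul {g h : Aut (FundamentalGroupoid.mk b)} {a c : G} (h1 : vkRel hV gx hg g a)
    (h2 : vkRel hV gx hg h c) : vkRel hV gx hg (g * h) (a * c) := by
  intro f
  rw [lp_mul, (vkCov hV gx hg).monodromy_trans_apply, h1, h2, mul_inv_rev, mul_assoc]

lemma vkRel_inv {g : Aut (FundamentalGroupoid.mk b)} {a : G} (h1 : vkRel hV gx hg g a) :
    vkRel hV gx hg g⁻¹ a⁻¹ := by
  intro f
  have h := h1 (a * f)
  rw [inv_mul_cancel_left] at h
  rw [← h, ← (vkCov hV gx hg).monodromy_trans_apply, ← lp_mul, mul_inv_cancel, lp_one,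
    (vkCov hV gx hg).monodromy_refl, inv_inv]
  rfl

lemma vkRel_eq_one {a : G} (h1 : vkRel hV gx hg 1 a) : a = 1 := by
  have h := h1 a
  rw [lp_one, (vkCov hV gx hg).monodromy_refl, inv_mul_cancel] at h
  exact vkPt_injective hV gx hg true b (congrArg Subtype.val h)

lemma vkRel_del (hb : gx b = 1) (x : X) (hx : ∀ i, x ∈ U i) :
    vkRel hV gx hg (ofLp (hq (hV.del x hx))) (gx x)⁻¹ := by
  intro f
  have e : lp (ofLp (hq (hV.del x hx))) =
      (hq (hV.c true x (hx _))).trans (hq (hV.c false x (hx _)).symm) := rfl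
  rw [e, (vkCov hV gx hg).monodromy_trans_apply, vk_mono hV gx hg true _ (hV.c_mem _ _ _)]
  have h1 := vk_mono hV gx hg false (hV.c false x (hx _)).symm
    (fun t => hV.c_mem false x (hx _) _) (gx x * f)
  have h2 : vkPt hV gx hg true x f = vkPt hV gx hg false x (gx x * f) :=
    vkPt_change hV gx hg true false x f
  have h3 : vkPt hV gx hg false b (gx x * f) = vkPt hV gx hg true b (gx x * f) := by
    rw [vkPt_change hV gx hg false true b]
    simp [trF, hb]
  simp only [h2, inv_inv]
  rw [h1]
  exact Subtype.ext h3

end VKcov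

end WB
end

section
namespace WB

open unitInterval CategoryTheory Topology

/-- The plane with the punctures `0, …, m-1`. -/
abbrev XP (m : ℕ) : Type := {z : ℂ // ∀ j : Fin m, z ≠ ((j : ℕ) : ℂ)}

/-- The base point `m`. -/
noncomputable def xb (m : ℕ) : XP m := ⟨(m : ℂ), fun j h => by
  have := j.2
  have h' : m = (j : ℕ) := by exact_mod_cast h
  omega⟩

/-- A sign. -/
def sg (i : Bool) : ℝ := if i then 1 else -1

lemma sg_sq (i : Bool) : sg i * sg i = 1 := by cases i <;> simp [sg]

/-- Plane minus vertical rays. -/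
def UP (m : ℕ) (i : Bool) : Set (XP m) :=
  {z | (∀ j : Fin m, z.1.re ≠ (j : ℕ)) ∨ 0 < sg i * z.1.im}

lemma mem_UP {m : ℕ} {i : Bool} {z : XP m} :
    z ∈ UP m i ↔ (∀ j : Fin m, z.1.re ≠ (j : ℕ)) ∨ 0 < sg i * z.1.im := Iff.rfl

lemma UP_isOpen (m : ℕ) (i : Bool) : IsOpen (UP m i) := by
  have : UP m i = (⋂ j : Fin m, {z : XP m | z.1.re ≠ (j : ℕ)}) ∪ {z : XP m | 0 < sg i * z.1.im} := by
    ext z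
    simp [UP]
  rw [this]
  apply IsOpen.union
  · apply isOpen_iInter_of_finite
    intro j
    exact isOpen_ne_fun (Complex.continuous_re.comp continuous_subtype_val) continuous_const
  · exact isOpen_lt continuous_const
      (continuous_const.mul (Complex.continuous_im.comp continuous_subtype_val))

lemma UP_cover (m : ℕ) (z : XP m) : ∃ i, z ∈ UP m i := by
  by_cases h : ∀ j : Fin m, z.1.re ≠ (j : ℕ)
  · exact ⟨true, Or.inl h⟩
  · push Not at h
    obtain ⟨j, hj⟩ := h
    have : z.1.im ≠ 0 := fun h0 => z.2 j (Complex.ext (by simpa using hj) (by simpa using h0))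
    rcases this.lt_or_gt with h | h
    · exact ⟨false, Or.inr (by simp [sg, h])⟩
    · exact ⟨true, Or.inr (by simp [sg, h])⟩

lemma UP_base (m : ℕ) (i : Bool) : xb m ∈ UP m i := by
  refine Or.inl fun j => ?_
  have := j.2
  simp only [xb, Complex.natCast_re]
  exact_mod_cast (by omega : m ≠ j)

/-- The contraction. -/
noncomputable def ctr (m : ℕ) (i : Bool) (t : ℝ) (z : ℂ) : ℂ :=
  ((1 - max 0 (2 * t - 1) : ℝ) : ℂ) * (z + ((sg i * min 1 (2 * t) * (1 + |z.im|) : ℝ) : ℂ) * Complex.I)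
    + ((max 0 (2 * t - 1) : ℝ) : ℂ) * m

lemma ctr_cont (m : ℕ) (i : Bool) : Continuous fun p : ℝ × ℂ => ctr m i p.1 p.2 := by
  unfold ctr
  fun_prop

lemma ctr_mem (m : ℕ) (i : Bool) (t : ℝ) (ht : 0 ≤ t) (ht1 : t ≤ 1) (z : ℂ)
    (hz : (∀ j : Fin m, z.re ≠ (j : ℕ)) ∨ 0 < sg i * z.im) :
    (∀ j : Fin m, (ctr m i t z).re ≠ (j : ℕ)) ∨ 0 < sg i * (ctr m i t z).im := by
  have him : sg i * (ctr m i t z).im =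
      (1 - max 0 (2 * t - 1)) * (sg i * z.im + min 1 (2 * t) * (1 + |z.im|)) := by
    have h1 : (ctr m i t z).im = (1 - max 0 (2 * t - 1)) *
        (z.im + sg i * min 1 (2 * t) * (1 + |z.im|)) := by
      simp [ctr, -Complex.ofReal_sub, -Complex.ofReal_mul, -Complex.ofReal_add]
    rw [h1]
    linear_combination (1 - max 0 (2 * t - 1)) * (min 1 (2 * t) * (1 + |z.im|)) * sg_sq i
  have hre : (ctr m i t z).re = (1 - max 0 (2 * t - 1)) * z.re + max 0 (2 * t - 1) * m := by
    simp [ctr, -Complex.ofReal_sub, -Complex.ofReal_mul, -Complex.ofReal_add]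
  have habs : -|z.im| ≤ sg i * z.im := by
    cases i
    · simp [sg, le_abs_self]
    · simpa [sg] using neg_abs_le z.im
  rcases le_or_gt t (1/2) with h | h
  · have e1 : max 0 (2 * t - 1) = 0 := max_eq_left (by linarith)
    have e2 : min 1 (2 * t) = 2 * t := min_eq_right (by linarith)
    rw [hre, him, e1, e2]
    rcases hz with hz | hz
    · left; intro j; simpa using hz j
    · right
      have : 0 ≤ 2 * t * (1 + |z.im|) := by positivity
      linarith
  · have e1 : max 0 (2 * t - 1) = 2 * t - 1 := max_eq_right (by linarith)
    have e2 : min 1 (2 * t) = 1 := min_eq_left (by linarith)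
    rw [hre, him, e1, e2]
    rcases ht1.lt_or_eq with h1 | h1
    · right
      apply mul_pos <;> linarith
    · left
      intro j
      have := j.2
      rw [h1]
      norm_num
      omega

lemma UP_mem_of (m : ℕ) (i : Bool) (z : ℂ)
    (hz : (∀ j : Fin m, z.re ≠ (j : ℕ)) ∨ 0 < sg i * z.im) (j : Fin m) : z ≠ ((j : ℕ) : ℂ) := by
  rintro rfl
  rcases hz with hz | hz
  · exact hz j (by simp)
  · simp at hz

/-- The contraction, on the sets. -/
noncomputable def ctrU (m : ℕ) (i : Bool) (t : I) (z : UP m i) : UP m i :=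
  ⟨⟨ctr m i t z.1.1, UP_mem_of m i _ (ctr_mem m i t t.2.1 t.2.2 _ z.2)⟩,
    ctr_mem m i t t.2.1 t.2.2 _ z.2⟩

lemma ctrU_cont (m : ℕ) (i : Bool) : Continuous fun p : I × UP m i => ctrU m i p.1 p.2 := by
  refine Continuous.subtype_mk (Continuous.subtype_mk ?_ _) _
  exact (ctr_cont m i).comp (by fun_prop : Continuous fun p : I × UP m i => ((p.1 : ℝ), p.2.1.1))

instance UP_contractible (m : ℕ) (i : Bool) : ContractibleSpace (UP m i) := by
  rw [contractible_iff_id_nullhomotopic]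
  refine ⟨⟨xb m, UP_base m i⟩, ⟨⟨⟨fun p => ctrU m i p.1 p.2, ctrU_cont m i⟩, ?_, ?_⟩⟩⟩
  · intro z
    apply Subtype.ext
    apply Subtype.ext
    simp [ctrU, ctr]
  · intro z
    apply Subtype.ext
    apply Subtype.ext
    simp [ctrU, ctr, xb]
    norm_num

/-- Restrict a path to a subset. -/
def pathRestr {X : Type} [TopologicalSpace X] {U : Set X} {x y : X} (p : Path x y)
    (hp : ∀ t, p t ∈ U) :
    Path (⟨x, by simpa using hp 0⟩ : U) (⟨y, by simpa using hp 1⟩ : U) where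
  toFun t := ⟨p t, hp t⟩
  continuous_toFun := by fun_prop
  source' := by simp
  target' := by simp

lemma UP_vk (m : ℕ) : VKData (UP m) (xb m) where
  isOpen := UP_isOpen m
  cover := UP_cover m
  base := UP_base m
  conn i x hx := by
    let p : Path (⟨xb m, UP_base m i⟩ : UP m i) ⟨x, hx⟩ := PathConnectedSpace.somePath _ _
    exact ⟨p.map continuous_subtype_val, fun t => (p t).2⟩
  sc i x y p q hp hq := by
    have h := SimplyConnectedSpace.paths_homotopic (pathRestr p hp) (pathRestr q hq)
    exact h.map ⟨Subtype.val, continuous_subtype_val⟩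

/-- The strip number. -/
noncomputable def kz {m : ℕ} (z : XP m) : ℕ := min m ⌈z.1.re⌉₊

lemma lt_kz {m : ℕ} (z : XP m) (j : Fin m) : (j : ℕ) < kz z ↔ ((j : ℕ) : ℝ) < z.1.re := by
  rw [kz, lt_min_iff, Nat.lt_ceil]
  exact ⟨fun h => h.2, fun h => ⟨j.2, h⟩⟩

lemma kz_le {m : ℕ} (z : XP m) : kz z ≤ m := min_le_left _ _

lemma kz_eq {m : ℕ} (z w : XP m) (h : ∀ j : Fin m, ((j : ℕ) : ℝ) < z.1.re ↔ ((j : ℕ) : ℝ) < w.1.re) :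
    kz z = kz w := by
  simp only [← lt_kz] at h
  have h1 := kz_le z
  have h2 := kz_le w
  by_contra hne
  rcases Nat.lt_or_gt_of_ne hne with hl | hl
  · have := (h ⟨kz z, by omega⟩).2 hl
    simp at this
  · have := (h ⟨kz w, by omega⟩).1 hl
    simp at this

lemma UP_inter {m : ℕ} {z : XP m} (hz : ∀ i, z ∈ UP m i) (j : Fin m) : z.1.re ≠ (j : ℕ) := by
  rcases hz true with h | h
  · exact h j
  rcases hz false with h' | h'
  · exact h' j
  simp [sg] at h h'
  linarith

lemma kz_cont (m : ℕ) : ContinuousOn (kz (m := m)) (UP m true ∩ UP m false) := by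
  intro z hz
  apply ContinuousAt.continuousWithinAt
  have hz' : ∀ j : Fin m, z.1.re ≠ (j : ℕ) := UP_inter (fun i => by cases i; exacts [hz.2, hz.1])
  have hre : Continuous fun y : XP m => y.1.re := Complex.continuous_re.comp continuous_subtype_val
  have : ∀ᶠ y in 𝓝 z, ∀ j : Fin m, (((j : ℕ) : ℝ) < y.1.re ↔ ((j : ℕ) : ℝ) < z.1.re) := by
    rw [Filter.eventually_all]
    intro j
    rcases (hz' j).lt_or_gt with h | h
    · filter_upwards [(isOpen_lt hre continuous_const).mem_nhds h] with y hy
      exact ⟨fun h' => absurd h' (not_lt.2 (le_of_lt hy)), fun h' => absurd h' (not_lt.2 h.le)⟩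
    · filter_upwards [(isOpen_lt continuous_const hre).mem_nhds h] with y hy
      exact ⟨fun _ => h, fun _ => hy⟩
  refine ContinuousAt.congr (f := fun _ => kz z) continuousAt_const ?_
  filter_upwards [this] with y hy
  exact (kz_eq y z hy).symm

lemma del_kz (m : ℕ) (z w : XP m) (hz : ∀ i, z ∈ UP m i) (hw : ∀ i, w ∈ UP m i) (h : kz z = kz w) :
    hq ((UP_vk m).del z hz) = hq ((UP_vk m).del w hw) := by
  have key : ∀ (t : I) (j : Fin m), (((1 - (t : ℝ) : ℝ) : ℂ) * z.1 + ((t : ℝ) : ℂ) * w.1).re ≠ (j : ℕ) := by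
    intro t j
    have h1 := lt_kz z j
    have h2 := lt_kz w j
    rw [h] at h1
    have t0 := t.2.1
    have t1 := t.2.2
    have e : (((1 - (t : ℝ) : ℝ) : ℂ) * z.1 + ((t : ℝ) : ℂ) * w.1).re
        = (1 - (t : ℝ)) * z.1.re + t * w.1.re := by
      simp [-Complex.ofReal_sub]
    rw [e]
    rcases (UP_inter hz j).lt_or_gt with hl | hl
    · have hl' : w.1.re < (j : ℕ) := lt_of_le_of_ne
        (not_lt.1 fun hh => absurd (h1.1 (h2.2 hh)) (not_lt.2 hl.le)) (UP_inter hw j)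
      rcases t0.eq_or_lt with h0 | h0
      · rw [← h0]; linarith
      · nlinarith
    · have hl' : ((j : ℕ) : ℝ) < w.1.re := h2.1 (h1.2 hl)
      rcases t0.eq_or_lt with h0 | h0
      · rw [← h0]; linarith
      · nlinarith
  refine (UP_vk m).del_eq z w hz hw
    ⟨⟨fun t => ⟨((1 - (t : ℝ) : ℝ) : ℂ) * z.1 + ((t : ℝ) : ℂ) * w.1, fun j hj => key t j (by rw [hj]; simp)⟩,
      by fun_prop⟩, by simp, by simp⟩ ?_
  intro i t
  exact Or.inl (key t)

/-- The point in the `k`-th strip. -/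
noncomputable def zs (m k : ℕ) : XP m := ⟨((k - 1/2 : ℝ) : ℂ), fun j h => by
  have h1 : (k : ℝ) - 1/2 = (j : ℕ) := by exact_mod_cast h
  have h2 : (2 * k : ℝ) = 2 * (j : ℕ) + 1 := by linarith
  have h3 : 2 * k = 2 * (j : ℕ) + 1 := by exact_mod_cast h2
  omega⟩

lemma zs_mem (m k : ℕ) (i : Bool) : zs m k ∈ UP m i := by
  left
  intro j h
  exact (zs m k).2 j (Complex.ext (by simpa using h) (by simp [zs]))

lemma kz_zs (m k : ℕ) (hk : k ≤ m) : kz (zs m k) = k := by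
  have : ⌈(zs m k).1.re⌉₊ = k := by
    simp only [zs, Complex.ofReal_re]
    rcases k with _ | k
    · simp
    · rw [Nat.ceil_eq_iff (by omega)]
      push_cast
      constructor
      · simp; linarith
      · linarith
  rw [kz, this]
  omega

/-- The loop crossing the `k`-th strip. -/
noncomputable def dl (m k : ℕ) : Aut (FundamentalGroupoid.mk (xb m)) :=
  ofLp (hq ((UP_vk m).del (zs m k) (zs_mem m k)))

lemma dl_eq (m : ℕ) (z : XP m) (hz : ∀ i, z ∈ UP m i) :
    ofLp (hq ((UP_vk m).del z hz)) = dl m (kz z) := by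
  rw [dl, del_kz m z (zs m (kz z)) hz (zs_mem _ _) (kz_zs m _ (kz_le z)).symm]

lemma kz_xb (m : ℕ) : kz (xb m) = m := by simp [kz, xb]

lemma dl_top (m : ℕ) : dl m m = 1 := by
  have h := dl_eq m (xb m) (UP_base m)
  rw [kz_xb, (UP_vk m).del_base] at h
  rw [← h]
  exact lp_injective rfl

/-- The standard generators. -/
noncomputable def gam (m : ℕ) (j : Fin m) : Aut (FundamentalGroupoid.mk (xb m)) :=
  dl m j * (dl m (j + 1))⁻¹

/-- Products of generators in the free group. -/
def Gw (m k : ℕ) : FreeGroup (Fin m) := ((List.ofFn (FreeGroup.of (α := Fin m))).drop k).prod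

lemma Gw_top (m : ℕ) : Gw m m = 1 := by
  rw [Gw, List.drop_of_length_le (by simp), List.prod_nil]

lemma Gw_succ (m : ℕ) (j : Fin m) : Gw m j = FreeGroup.of j * Gw m (j + 1) := by
  rw [Gw, List.drop_eq_getElem_cons (by simp), List.prod_cons]
  simp [Gw]

lemma gam_surj (m : ℕ) : Function.Surjective (FreeGroup.lift (gam m)) := by
  rw [← MonoidHom.range_eq_top, eq_top_iff]
  intro g _
  refine (UP_vk m).gen _ (fun x hx => ?_) g
  rw [dl_eq]
  have : ∀ d k, k + d = m → dl m k ∈ (FreeGroup.lift (gam m)).range := by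
    intro d
    induction d with
    | zero => intro k hk; obtain rfl : k = m := by omega
              rw [dl_top]; exact one_mem _
    | succ d ih =>
      intro k hk
      have h1 := ih (k + 1) (by omega)
      have h2 : dl m k = gam m ⟨k, by omega⟩ * dl m (k + 1) := by simp [gam]
      rw [h2]
      exact mul_mem ⟨FreeGroup.of ⟨k, by omega⟩, by simp⟩ h1
  exact this (m - kz x) _ (by have := kz_le x; omega)

lemma gam_inj (m : ℕ) : Function.Injective (FreeGroup.lift (gam m)) := by
  let _ : TopologicalSpace (FreeGroup (Fin m)) := ⊥
  have _ : DiscreteTopology (FreeGroup (Fin m)) := ⟨rfl⟩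
  let gx : XP m → FreeGroup (Fin m) := fun z => (Gw m (kz z))⁻¹
  have hg : ContinuousOn gx (UP m true ∩ UP m false) :=
    (continuous_of_discreteTopology (f := fun k => (Gw m k)⁻¹)).comp_continuousOn (kz_cont m)
  have hb : gx (xb m) = 1 := by simp [gx, kz_xb, Gw_top]
  have hd : ∀ k ≤ m, vkRel (UP_vk m) gx hg (dl m k) (Gw m k) := by
    intro k hk
    have := vkRel_del (UP_vk m) gx hg hb (zs m k) (zs_mem m k)
    simp only [gx, kz_zs m k hk, inv_inv] at this
    exact this
  have hgam : ∀ j, vkRel (UP_vk m) gx hg (gam m j) (FreeGroup.of j) := by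
    intro j
    have := vkRel_mul _ _ _ (hd j j.2.le) (vkRel_inv _ _ _ (hd (j + 1) j.2))
    rwa [Gw_succ, mul_inv_cancel_right] at this
  have key : ∀ w, vkRel (UP_vk m) gx hg (FreeGroup.lift (gam m) w) w := by
    intro w
    induction w using FreeGroup.induction_on with
    | C1 => rw [map_one]; exact vkRel_one _ _ _
    | of j => rw [FreeGroup.lift_apply_of]; exact hgam j
    | inv_of j h => rw [map_inv]; exact vkRel_inv _ _ _ h
    | mul x y hx hy => rw [map_mul]; exact vkRel_mul _ _ _ hx hy
  rw [injective_iff_map_eq_one]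
  intro w hw
  have := key w
  rw [hw] at this
  exact vkRel_eq_one _ _ _ this

/-! ### Winding numbers -/

/-- The function `z - j`. -/
noncomputable def lj (m : ℕ) (j : Fin m) : C(XP m, Cx) :=
  ⟨fun z => ⟨z.1 - ((j : ℕ) : ℂ), sub_ne_zero.2 (z.2 j)⟩, by fun_prop⟩

/-- Branches of the logarithm. -/
noncomputable def Lb (i : Bool) (w : ℂ) : ℂ :=
  Complex.log (-(sg i : ℂ) * Complex.I * w) + (sg i : ℂ) * (Real.pi / 2 * Complex.I)

lemma Lb_exp (i : Bool) (w : ℂ) (hw : w ≠ 0) : Complex.exp (Lb i w) = w := by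
  have h1 : -(sg i : ℂ) * Complex.I * w ≠ 0 := by
    refine mul_ne_zero (mul_ne_zero ?_ Complex.I_ne_zero) hw
    cases i <;> simp [sg]
  rw [Lb, Complex.exp_add, Complex.exp_log h1]
  have h2 := Complex.exp_pi_div_two_mul_I
  cases i
  · simp [sg, Complex.exp_neg, h2]
    rw [mul_right_comm, Complex.I_mul_I]; simp
  · simp [sg, h2]
    rw [mul_right_comm, Complex.I_mul_I]; simp

lemma Lb_cont (m : ℕ) (i : Bool) (j : Fin m) {x y : XP m} (p : Path x y) (hp : ∀ t, p t ∈ UP m i) :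
    Continuous fun t => Lb i (lj m j (p t)).1 := by
  unfold Lb
  refine Continuous.add (Continuous.clog (by fun_prop) fun t => ?_) continuous_const
  rw [Complex.mem_slitPlane_iff]
  have e1 : (-(sg i : ℂ) * Complex.I * (lj m j (p t)).1).re = sg i * (p t).1.im := by
    simp [lj]
  have e2 : (-(sg i : ℂ) * Complex.I * (lj m j (p t)).1).im = -(sg i * ((p t).1.re - (j : ℕ))) := by
    simp [lj]
  rw [e1, e2]
  rcases hp t with h | h
  · right
    rw [neg_ne_zero]
    refine mul_ne_zero ?_ (sub_ne_zero.2 (h j))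
    cases i <;> simp [sg]
  · exact Or.inl h

lemma inc_path (m : ℕ) (i : Bool) (j : Fin m) {x y : XP m} (p : Path x y) (hp : ∀ t, p t ∈ UP m i) :
    inc (lj m j) (hq p) = Lb i (y.1 - (j : ℕ)) - Lb i (x.1 - (j : ℕ)) := by
  rw [inc_mk, incC_eq _ ⟨_, Lb_cont m i j p hp⟩ (fun t => Lb_exp _ _ (lj m j (p t)).2)]
  simp [lj]

lemma Lb_pos (i : Bool) (r : ℝ) (hr : 0 < r) : Lb i (r : ℂ) = Real.log r := by
  rw [Lb, mul_comm (-(sg i : ℂ) * Complex.I), Complex.log_ofReal_mul hr]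
  · cases i
    · simp [sg, Complex.log_I]
    · simp [sg, Complex.log_neg_I]
  · cases i <;> simp [sg]

lemma Lb_neg (i : Bool) (r : ℝ) (hr : r < 0) :
    Lb i (r : ℂ) = Real.log (-r) + (sg i : ℂ) * (Real.pi * Complex.I) := by
  have : -(sg i : ℂ) * Complex.I * (r : ℂ) = ((-r : ℝ) : ℂ) * (sg i * Complex.I) := by
    push_cast; ring
  rw [Lb, this, Complex.log_ofReal_mul (by linarith)]
  · cases i
    · simp [sg, Complex.log_neg_I]; ring
    · simp [sg, Complex.log_I]; ring
  · cases i <;> simp [sg]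

lemma inc_symm {X : Type} [TopologicalSpace X] (l : C(X, Cx)) {x y : X}
    (γ : Path.Homotopic.Quotient x y) : inc l γ.symm = - inc l γ := by
  have h := inc_trans l γ γ.symm
  have h0 := inc_trans l (Path.Homotopic.Quotient.refl x) (Path.Homotopic.Quotient.refl x)
  rw [Path.Homotopic.Quotient.refl_trans] at h0
  rw [Path.Homotopic.Quotient.trans_symm] at h
  linear_combination -h - h0

lemma inc_dl (m k : ℕ) (j : Fin m) :
    inc (lj m j) (lp (dl m k)) = if k ≤ (j : ℕ) then 2 * Real.pi * Complex.I else 0 := by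
  have e : lp (dl m k) = (hq ((UP_vk m).c true (zs m k) (zs_mem _ _ _))).trans
      (hq ((UP_vk m).c false (zs m k) (zs_mem _ _ _))).symm := rfl
  rw [e, inc_trans, inc_symm, inc_path m true j _ ((UP_vk m).c_mem _ _ _),
    inc_path m false j _ ((UP_vk m).c_mem _ _ _)]
  have hb : (xb m).1 - ((j : ℕ) : ℂ) = ((m - (j : ℕ) : ℝ) : ℂ) := by simp [xb]
  have hz : (zs m k).1 - ((j : ℕ) : ℂ) = ((k - 1/2 - (j : ℕ) : ℝ) : ℂ) := by simp [zs]
  have hj : ((j : ℕ) : ℝ) < m := by exact_mod_cast j.2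
  have hpos : ∀ i, Lb i ((m - (j : ℕ) : ℝ) : ℂ) = Real.log (m - (j : ℕ) : ℝ) := fun i =>
    Lb_pos _ _ (by linarith)
  rw [hb, hz, hpos, hpos]
  split_ifs with h
  · have : (k : ℝ) ≤ (j : ℕ) := by exact_mod_cast h
    rw [Lb_neg _ _ (by linarith), Lb_neg _ _ (by linarith)]
    simp [sg]; ring
  · have : ((j : ℕ) : ℝ) + 1 ≤ k := by exact_mod_cast (by omega : (j : ℕ) + 1 ≤ k)
    rw [Lb_pos _ _ (by linarith), Lb_pos _ _ (by linarith)]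
    ring

lemma inc_gam (m : ℕ) (j k : Fin m) :
    inc (lj m j) (lp (gam m k)) = if j = k then 2 * Real.pi * Complex.I else 0 := by
  rw [gam, lp_mul, lp_inv, inc_trans, inc_symm, inc_dl, inc_dl]
  by_cases h : j = k
  · subst h; simp
  · have h' : (j : ℕ) ≠ k := fun hh => h (Fin.ext hh)
    rw [if_neg h]
    by_cases h2 : (k : ℕ) ≤ j
    · rw [if_pos h2, if_pos (by omega)]; ring
    · rw [if_neg h2, if_neg (by omega)]; ring

end WB
end

section
namespace WB

open unitInterval CategoryTheory Topology

section Transport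

variable {B J : Type} [TopologicalSpace B] [Fintype J] [DecidableEq J] [Nonempty J] (q : J → B → ℂ)

/-- A lower bound for the distances of marked points. -/
noncomputable def rmin (b : B) : ℝ :=
  Finset.univ.inf' Finset.univ_nonempty
    (fun p : J × J => if p.1 = p.2 then (1 : ℝ) else ‖q p.1 b - q p.2 b‖)

lemma rmin_cont (hq : ∀ j, Continuous (q j)) : Continuous (rmin q) := by
  apply Continuous.finset_inf'_apply
  intro p _
  split_ifs
  · exact continuous_const
  · exact ((hq _).sub (hq _)).norm

lemma rmin_pos (hne : ∀ b i j, i ≠ j → q i b ≠ q j b) (b : B) : 0 < rmin q b := by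
  rw [rmin, Finset.lt_inf'_iff]
  intro p _
  split_ifs with h
  · exact one_pos
  · exact norm_pos_iff.2 (sub_ne_zero.2 (hne b _ _ h))

lemma rmin_le (b : B) {i j : J} (h : i ≠ j) : rmin q b ≤ ‖q i b - q j b‖ := by
  have := Finset.inf'_le (fun p : J × J => if p.1 = p.2 then (1 : ℝ) else ‖q p.1 b - q p.2 b‖)
    (Finset.mem_univ (i, j))
  simp only [h, if_false] at this
  exact this

/-- The elementary transport. -/
noncomputable def psi (b b' : B) (z : ℂ) : ℂ :=
  z + ∑ j, ((max (1 - ‖z - q j b‖ / rmin q b) 0 : ℝ) : ℂ) * (q j b' - q j b)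

lemma psi_self (b : B) (z : ℂ) : psi q b b z = z := by simp [psi]

lemma psi_pt (hne : ∀ b i j, i ≠ j → q i b ≠ q j b) (b b' : B) (j : J) :
    psi q b b' (q j b) = q j b' := by
  have hr := rmin_pos q hne b
  rw [psi, Finset.sum_eq_single j]
  · simp
  · intro i _ hi
    have h1 : (1 : ℝ) ≤ ‖q j b - q i b‖ / rmin q b := by
      rw [le_div_iff₀ hr, one_mul]
      exact rmin_le q b hi.symm
    rw [max_eq_right (by linarith)]
    simp
  · simp

lemma psi_inj (hne : ∀ b i j, i ≠ j → q i b ≠ q j b) (b b' : B)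
    (h : ∑ j, ‖q j b' - q j b‖ < rmin q b) : Function.Injective (psi q b b') := by
  have hr := rmin_pos q hne b
  intro z w hzw
  by_contra hne'
  have hpos : 0 < ‖z - w‖ := norm_pos_iff.2 (sub_ne_zero.2 hne')
  have e : z - w = ∑ j, (((max (1 - ‖w - q j b‖ / rmin q b) 0 : ℝ) : ℂ) -
      ((max (1 - ‖z - q j b‖ / rmin q b) 0 : ℝ) : ℂ)) * (q j b' - q j b) := by
    simp only [sub_mul, Finset.sum_sub_distrib]
    unfold psi at hzw
    linear_combination hzw
  have : ‖z - w‖ ≤ ∑ j, (‖z - w‖ / rmin q b) * ‖q j b' - q j b‖ := by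
    conv_lhs => rw [e]
    refine (norm_sum_le _ _).trans (Finset.sum_le_sum fun j _ => ?_)
    rw [norm_mul]
    refine mul_le_mul_of_nonneg_right ?_ (norm_nonneg _)
    rw [← Complex.ofReal_sub, Complex.norm_real, Real.norm_eq_abs]
    refine (abs_max_sub_max_le_abs _ _ _).trans ?_
    have : 1 - ‖w - q j b‖ / rmin q b - (1 - ‖z - q j b‖ / rmin q b) =
      (‖z - q j b‖ - ‖w - q j b‖) / rmin q b := by ring
    rw [this, abs_div, abs_of_pos hr]
    refine div_le_div_of_nonneg_right ?_ hr.le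
    refine (abs_norm_sub_norm_le _ _).trans ?_
    simp
  rw [← Finset.mul_sum, div_mul_eq_mul_div, le_div_iff₀ hr] at this
  have := mul_lt_mul_of_pos_left h hpos
  linarith

lemma psi_cont (hq : ∀ j, Continuous (q j)) (hne : ∀ b i j, i ≠ j → q i b ≠ q j b) :
    Continuous fun p : B × B × ℂ => psi q p.1 p.2.1 p.2.2 := by
  unfold psi
  have h1 : Continuous fun p : B × B × ℂ => rmin q p.1 := (rmin_cont q hq).comp continuous_fst
  refine continuous_snd.snd.add (continuous_finsetSum _ fun j _ => ?_)
  refine (Complex.continuous_ofReal.comp ?_).mul ?_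
  · refine (continuous_const.sub (Continuous.div ?_ h1 fun p => (rmin_pos q hne _).ne')).max
      continuous_const
    exact (continuous_snd.snd.sub ((hq j).comp continuous_fst)).norm
  · exact ((hq j).comp continuous_snd.fst).sub ((hq j).comp continuous_fst)

/-- Truncated time. -/
noncomputable def tm (N m : ℕ) (u : I) : I :=
  ⟨min u ((m : ℝ) / N), le_min u.2.1 (by positivity), (min_le_left _ _).trans u.2.2⟩

lemma tm_cont (N m : ℕ) : Continuous (tm N m) := by
  unfold tm
  exact Continuous.subtype_mk (by fun_prop) _

/-- Iterated transport. -/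
noncomputable def PsiN {K : Type} (h : K × I → B) (N : ℕ) : ℕ → K → I → ℂ → ℂ
  | 0, _, _, z => z
  | m + 1, k, u, z => psi q (h (k, tm N m u)) (h (k, tm N (m + 1) u)) (PsiN h N m k u z)

lemma transport {K : Type} [PseudoMetricSpace K] [CompactSpace K] (hq : ∀ j, Continuous (q j))
    (hne : ∀ b i j, i ≠ j → q i b ≠ q j b) (h : K × I → B) (hh : Continuous h) :
    ∃ Ψ : K → I → ℂ → ℂ, Continuous (fun p : K × I × ℂ => Ψ p.1 p.2.1 p.2.2) ∧
      (∀ k u, Function.Injective (Ψ k u)) ∧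
      (∀ k u j, Ψ k u (q j (h (k, 0))) = q j (h (k, u))) ∧
      (∀ k z, Ψ k 0 z = z) ∧
      (∀ k, (∀ u, h (k, u) = h (k, 0)) → ∀ u z, Ψ k u z = z) := by
  rcases isEmpty_or_nonempty K with hK | ⟨⟨k₀⟩⟩
  · refine ⟨fun _ _ z => z, by fun_prop, fun k => hK.elim k, fun k => hK.elim k, fun k => hK.elim k,
      fun k => hK.elim k⟩
  have hr := rmin_cont q hq
  obtain ⟨x₀, -, hx₀⟩ := isCompact_univ.exists_isMinOn (s := (Set.univ : Set (K × I)))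
    ⟨(k₀, 0), trivial⟩ ((hr.comp hh).continuousOn)
  let ε := rmin q (h x₀)
  have hε : 0 < ε := rmin_pos q hne _
  have hmin : ∀ x, ε ≤ rmin q (h x) := fun x => hx₀ (Set.mem_univ x)
  let g : K × I × I → ℝ := fun p => ∑ j, ‖q j (h (p.1, p.2.2)) - q j (h (p.1, p.2.1))‖
  have hg : Continuous g := by
    refine continuous_finsetSum _ fun j _ => ?_
    exact (((hq j).comp (hh.comp (by fun_prop))).sub ((hq j).comp (hh.comp (by fun_prop)))).norm
  have hgu := CompactSpace.uniformContinuous_of_continuous hg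
  obtain ⟨δ, hδ, hd⟩ := Metric.uniformContinuous_iff.1 hgu ε hε
  obtain ⟨N, hN⟩ := exists_nat_one_div_lt hδ
  have hN' : (0 : ℝ) < ((N + 1 : ℕ) : ℝ) := by positivity
  have hstep : ∀ k m u, ∑ j, ‖q j (h (k, tm (N+1) (m+1) u)) - q j (h (k, tm (N+1) m u))‖ <
      rmin q (h (k, tm (N+1) m u)) := by
    intro k m u
    refine lt_of_lt_of_le ?_ (hmin _)
    have h1 : dist (k, tm (N+1) m u, tm (N+1) (m+1) u) (k, tm (N+1) m u, tm (N+1) m u) < δ := by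
      rw [Prod.dist_eq, Prod.dist_eq]
      simp only [dist_self]
      rw [max_eq_right (le_max_of_le_right dist_nonneg), max_eq_right dist_nonneg, Subtype.dist_eq, Real.dist_eq]
      simp only [tm]
      have h2 : |min (u : ℝ) ((m + 1 : ℕ) / (N + 1 : ℕ)) - min (u : ℝ) ((m : ℝ) / (N + 1 : ℕ))| ≤
          |((m + 1 : ℕ) : ℝ) / (N + 1 : ℕ) - (m : ℝ) / (N + 1 : ℕ)| := by
        refine (abs_min_sub_min_le_max _ _ _ _).trans ?_
        rw [sub_self, abs_zero, max_eq_right (abs_nonneg _)]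
      refine lt_of_le_of_lt h2 ?_
      have : ((m + 1 : ℕ) : ℝ) / (N + 1 : ℕ) - (m : ℝ) / (N + 1 : ℕ) = 1 / (N + 1) := by
        push_cast; ring
      rw [this, abs_of_pos (by positivity)]
      exact hN
    have h2 := hd h1
    have h3 : g (k, tm (N+1) m u, tm (N+1) m u) = 0 := by simp [g]
    rw [h3, Real.dist_eq, sub_zero] at h2
    exact lt_of_le_of_lt (le_abs_self _) h2
  have t0 : ∀ u, tm (N+1) 0 u = 0 := fun u => Subtype.ext (by simp [tm, u.2.1])
  have t1 : ∀ u, tm (N+1) (N+1) u = u := fun u => Subtype.ext (by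
    simp only [tm]
    rw [div_self hN'.ne']
    exact min_eq_left u.2.2)
  refine ⟨PsiN q h (N+1) (N+1), ?_, ?_, ?_, ?_, ?_⟩
  · have : ∀ m, Continuous (fun p : K × I × ℂ => PsiN q h (N+1) m p.1 p.2.1 p.2.2) := by
      intro m
      induction m with
      | zero => exact continuous_snd.snd
      | succ m ih =>
        have c := tm_cont (N+1)
        exact (psi_cont q hq hne).comp ((hh.comp (continuous_fst.prodMk ((c m).comp continuous_snd.fst))).prodMk
          ((hh.comp (continuous_fst.prodMk ((c (m+1)).comp continuous_snd.fst))).prodMk ih))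
    exact this _
  · intro k u
    have : ∀ m, Function.Injective (PsiN q h (N+1) m k u) := by
      intro m
      induction m with
      | zero => exact Function.injective_id
      | succ m ih => exact (psi_inj q hne _ _ (hstep k m u)).comp ih
    exact this _
  · intro k u j
    have : ∀ m, PsiN q h (N+1) m k u (q j (h (k, 0))) = q j (h (k, tm (N+1) m u)) := by
      intro m
      induction m with
      | zero => rw [t0]; rfl
      | succ m ih => rw [PsiN, ih, psi_pt q hne]
    rw [this, t1]
  · intro k z
    have t2 : ∀ m, tm (N+1) m 0 = 0 := fun m => Subtype.ext (by
      simp only [tm]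
      exact min_eq_left (by simp; positivity))
    have : ∀ m, PsiN q h (N+1) m k 0 z = z := by
      intro m
      induction m with
      | zero => rfl
      | succ m ih => rw [PsiN, ih, t2, t2, psi_self]
    exact this _
  · intro k hk u z
    have : ∀ m, PsiN q h (N+1) m k u z = z := by
      intro m
      induction m with
      | zero => rfl
      | succ m ih => rw [PsiN, ih, hk, hk (tm (N+1) (m+1) u), psi_self]
    exact this _

end Transport

end WB
end

section
namespace WB

open unitInterval CategoryTheory Topology

/-- Induced map, with a change of base point. -/
noncomputable def mapAt {X Y : Type} [TopologicalSpace X] [TopologicalSpace Y] (f : C(X, Y))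
    {x : X} {y : Y} (h : f x = y) :
    Aut (FundamentalGroupoid.mk x) →* Aut (FundamentalGroupoid.mk y) := by
  subst h
  exact pi1Map (X := TopCat.of X) (Y := TopCat.of Y) (TopCat.ofHom f) x

lemma lp_mapAt {X Y : Type} [TopologicalSpace X] [TopologicalSpace Y] (f : C(X, Y))
    {x : X} {y : Y} (h : f x = y) (γ : Path x x) :
    lp (mapAt f h (ofLp (hq γ))) = hq ((γ.map f.continuous).cast h.symm h.symm) := by
  subst h
  rfl

lemma inc_mapAt {X Y : Type} [TopologicalSpace X] [TopologicalSpace Y] (f : C(X, Y))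
    {x : X} {y : Y} (h : f x = y) (l : C(Y, Cx)) (g : Aut (FundamentalGroupoid.mk x)) :
    inc l (lp (mapAt f h g)) = inc (l.comp f) (lp g) := by
  subst h
  exact inc_map l f (lp g)

section Fibre

variable (n : ℕ)

/-- The marked points, including the section. -/
noncomputable def mq (x : Option (Om n)) (b : ↑(hypSpace n)) : ℂ :=
  match x with
  | none => ((1 + ‖b.1‖ : ℝ) : ℂ)
  | some x => ptv b.1 x

lemma ptv_norm (b : ↑(hypSpace n)) (x : Om n) : ‖ptv b.1 x‖ ≤ ‖b.1‖ := by
  cases x with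
  | zero => simp [ptv]
  | pt i e =>
    have h : ‖((e : ℤ) : ℂ)‖ = 1 := by
      rcases Int.units_eq_one_or e with rfl | rfl <;> simp
    simp only [ptv, norm_mul, h, one_mul]
    exact norm_le_pi_norm b.1 i

lemma mq_none_ne (b : ↑(hypSpace n)) (x : Om n) : mq n none b ≠ ptv b.1 x := by
  intro h
  have h1 := ptv_norm n b x
  rw [← h] at h1
  simp only [mq, Complex.norm_real, Real.norm_eq_abs] at h1
  have := norm_nonneg b.1
  rw [abs_of_nonneg (by linarith)] at h1
  linarith

lemma mq_ne (b : ↑(hypSpace n)) (i j : Option (Om n)) (h : i ≠ j) : mq n i b ≠ mq n j b := by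
  cases i with
  | none =>
    cases j with
    | none => exact absurd rfl h
    | some j => exact mq_none_ne n b j
  | some i =>
    cases j with
    | none => exact (mq_none_ne n b i).symm
    | some j => exact fun hh => h (congrArg some (ptv_injective b hh))

lemma mq_cont (i : Option (Om n)) : Continuous (mq n i) := by
  cases i with
  | none =>
    unfold mq
    exact Complex.continuous_ofReal.comp (continuous_const.add continuous_subtype_val.norm)
  | some i =>
    cases i with
    | zero => exact continuous_const
    | pt i e => exact continuous_const.mul ((continuous_apply i).comp continuous_subtype_val)

variable {n}

/-- Add a last coordinate. -/
noncomputable def mkE (b : ↑(hypSpace n)) (w : ℂ) (hw : ∀ x : Om n, w ≠ ptv b.1 x) :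
    ↑(hypSpace (n + 1)) :=
  ⟨Fin.snoc (α := fun _ => ℂ) b.1 w, by
    have h0 : w ≠ 0 := hw Om.zero
    have h1 : ∀ i, w ^ 2 ≠ b.1 i ^ 2 := by
      intro i h
      rcases sq_eq_sq_iff_eq_or_eq_neg.1 h with h | h
      · exact hw (Om.pt i 1) (by simpa [ptv] using h)
      · exact hw (Om.pt i (-1)) (by simpa [ptv] using h)
    constructor
    · intro i j
      refine Fin.lastCases ?_ (fun i => ?_) i <;> refine Fin.lastCases ?_ (fun j => ?_) j
      · intro h; exact absurd rfl h
      · intro _; simpa using h1 j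
      · intro _; simpa using (h1 i).symm
      · intro h
        simpa using b.2.1 i j (fun hh => h (by rw [hh]))
    · intro i
      refine Fin.lastCases ?_ (fun i => ?_) i
      · simpa using h0
      · simpa using b.2.2 i⟩

lemma mkE_last (b : ↑(hypSpace n)) (w : ℂ) (hw) : (mkE b w hw).1 (Fin.last n) = w := by
  simp [mkE]

lemma mkE_castSucc (b : ↑(hypSpace n)) (w : ℂ) (hw) (i : Fin n) :
    (mkE b w hw).1 i.castSucc = b.1 i := by
  simp [mkE]

lemma mkE_forget (b : ↑(hypSpace n)) (w : ℂ) (hw) : hypForgetMap n (mkE b w hw) = b := by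
  apply Subtype.ext
  funext i
  exact mkE_castSucc b w hw i

lemma forget_of {e : ↑(hypSpace (n + 1))} {b : ↑(hypSpace n)} {w : ℂ}
    (h : e.1 = Fin.snoc (α := fun _ => ℂ) b.1 w) : hypForgetMap n e = b := by
  apply Subtype.ext
  funext i
  show e.1 i.castSucc = _
  rw [h]; simp

lemma last_of {e : ↑(hypSpace (n + 1))} {b : ↑(hypSpace n)} {w : ℂ}
    (h : e.1 = Fin.snoc (α := fun _ => ℂ) b.1 w) : e.1 (Fin.last n) = w := by
  rw [h]; simp

lemma last_ne (e : ↑(hypSpace (n + 1))) (x : Om n) :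
    e.1 (Fin.last n) ≠ ptv (hypForgetMap n e).1 x := by
  rw [ptv_forget]
  have h1 : e.1 (Fin.last n) = ptv e.1 (Om.pt (Fin.last n) 1) := by simp [ptv]
  rw [h1]
  intro h
  have := ptv_injective e h
  cases x with
  | zero => cases this
  | pt i e =>
    simp only [omCS, Om.pt.injEq] at this
    exact (Fin.castSucc_lt_last i).ne this.1.symm

lemma hypExt {e e' : ↑(hypSpace (n + 1))} (h1 : hypForgetMap n e = hypForgetMap n e')
    (h2 : e.1 (Fin.last n) = e'.1 (Fin.last n)) : e = e' := by
  apply Subtype.ext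
  funext i
  refine Fin.lastCases h2 (fun i => ?_) i
  exact congrFun (congrArg Subtype.val h1) i

lemma mkE_cont {T : Type} [TopologicalSpace T] (β : T → ↑(hypSpace n)) (ω : T → ℂ)
    (hβ : Continuous β) (hω : Continuous ω) (h : ∀ t x, ω t ≠ ptv (β t).1 x) :
    Continuous fun t => mkE (β t) (ω t) (h t) := by
  refine Continuous.subtype_mk (continuous_pi fun i => ?_) _
  refine Fin.lastCases ?_ (fun i => ?_) i
  · simpa using hω
  · have := (continuous_apply i).comp (continuous_subtype_val.comp hβ)
    simp only [Fin.snoc_castSucc]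
    exact this

lemma last_cont : Continuous fun e : ↑(hypSpace (n + 1)) => e.1 (Fin.last n) :=
  (continuous_apply _).comp continuous_subtype_val

lemma base_ptv (x : Om n) : ∃ j : Fin (2 * n + 1), ptv (hypBase n).1 x = ((j : ℕ) : ℂ) - n := by
  cases x with
  | zero => exact ⟨⟨n, by omega⟩, by simp [ptv]⟩
  | pt i e =>
    rcases Int.units_eq_one_or e with rfl | rfl
    · exact ⟨⟨n + i + 1, by omega⟩, by simp [ptv, hypBase]; ring⟩
    · refine ⟨⟨n - i - 1, by omega⟩, ?_⟩
      have := i.2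
      have : ((n - i - 1 : ℕ) : ℂ) = n - i - 1 := by
        rw [Nat.cast_sub (by omega), Nat.cast_sub (by omega)]; simp
      simp [ptv, hypBase, this]; ring

lemma base_ptv' (j : Fin (2 * n + 1)) : ∃ x : Om n, ptv (hypBase n).1 x = ((j : ℕ) : ℂ) - n := by
  have hj := j.2
  rcases lt_trichotomy (j : ℕ) n with h | h | h
  · refine ⟨Om.pt ⟨n - j - 1, by omega⟩ (-1), ?_⟩
    have : ((n - j - 1 : ℕ) : ℂ) = n - (j : ℕ) - 1 := by
      rw [Nat.cast_sub (by omega), Nat.cast_sub (by omega)]; simp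
    simp [ptv, hypBase, this]
  · exact ⟨Om.zero, by simp [ptv, h]⟩
  · refine ⟨Om.pt ⟨j - n - 1, by omega⟩ 1, ?_⟩
    have : ((j - n - 1 : ℕ) : ℂ) = (j : ℕ) - n - 1 := by
      rw [Nat.cast_sub (by omega), Nat.cast_sub (by omega)]; simp
    simp [ptv, hypBase, this]

variable (n)

/-- The fibre inclusion. -/
noncomputable def fi : C(XP (2 * n + 1), ↑(hypSpace (n + 1))) :=
  ⟨fun z => mkE (hypBase n) (z.1 - n) (fun x h => by
    obtain ⟨j, hj⟩ := base_ptv x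
    rw [hj] at h
    exact z.2 j (sub_left_injective h)), mkE_cont _ _ continuous_const (by fun_prop) _⟩

lemma fi_base : fi n (xb (2 * n + 1)) = hypBase (n + 1) := by
  apply hypExt
  · rw [forget_base]
    exact forget_of rfl
  · refine (last_of rfl).trans ?_
    simp [xb, hypBase]
    ring

lemma norm_base : ‖(hypBase n).1‖ = n := by
  apply le_antisymm
  · rw [pi_norm_le_iff_of_nonneg (by positivity)]
    intro i
    simp only [hypBase, Complex.norm_natCast]
    exact_mod_cast i.2
  · rcases n with _ | n
    · simp
    · refine le_trans ?_ (norm_le_pi_norm (hypBase (n+1)).1 (Fin.last n))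
      simp only [hypBase, Complex.norm_natCast]
      simp

lemma mq_base : mq n none (hypBase n) = (hypBase (n + 1)).1 (Fin.last n) := by
  simp only [mq, norm_base]
  simp [hypBase]
  ring

/-- The section. -/
noncomputable def secE : C(↑(hypSpace n), ↑(hypSpace (n + 1))) :=
  ⟨fun b => mkE b (mq n none b) (mq_none_ne n b), mkE_cont _ _ continuous_id (mq_cont n none) _⟩

lemma secE_base : secE n (hypBase n) = hypBase (n + 1) := by
  apply hypExt
  · rw [forget_base]
    exact forget_of rfl
  · exact (last_of rfl).trans (mq_base n)

lemma phiP_surj : Function.Surjective (phiP n) := by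
  intro g
  obtain ⟨γ, hγ⟩ := Path.Homotopic.Quotient.mk_surjective (lp g)
  refine ⟨mapAt (secE n) (secE_base n) (ofLp (hq γ)), ?_⟩
  apply lp_injective
  rw [lp_phiP, lp_mapAt, ← hγ]
  refine congrArg hq ?_
  apply Path.ext
  funext t
  exact forget_of rfl

lemma fi_inj : Function.Injective (mapAt (fi n) (fi_base n)) := by
  rw [injective_iff_map_eq_one]
  intro g hg
  obtain ⟨γ, hγ⟩ := Path.Homotopic.Quotient.mk_surjective (lp g)
  have hg' : g = ofLp (hq γ) := lp_injective hγ.symm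
  rw [hg'] at hg ⊢
  have h1 := lp_mapAt (fi n) (fi_base n) γ
  rw [hg, lp_one] at h1
  obtain ⟨H⟩ := Path.Homotopic.Quotient.eq.1 h1.symm
  let h : (I × I) × I → ↑(hypSpace n) := fun p => hypForgetMap n (H (σ p.2 * p.1.1, p.1.2))
  have hh : Continuous h := by
    refine (hypForgetMap n).hom.continuous.comp (H.continuous.comp ?_)
    exact (((continuous_symm.comp continuous_snd).mul continuous_fst.fst)).prodMk continuous_fst.snd
  obtain ⟨Ψ, hc, hinj, hpt, -, hconst⟩ := transport (mq n) (mq_cont n) (mq_ne n) h hh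
  have hh0 : ∀ k, h (k, 0) = hypForgetMap n (H k) := by
    intro k
    simp [h]
  have hH0 : ∀ t, H (0, t) = fi n (γ t) := fun t => by
    rw [H.apply_zero]; rfl
  have hf0 : ∀ t, hypForgetMap n (fi n (γ t)) = hypBase n := fun t => forget_of rfl
  have hh1 : ∀ k, h (k, 1) = hypBase n := by
    intro k
    simp only [h, symm_one, zero_mul]
    rw [hH0]
    exact hf0 _
  have hmem : ∀ k (j : Fin (2 * n + 1)), Ψ k 1 ((H k).1 (Fin.last n)) + n ≠ ((j : ℕ) : ℂ) := by
    intro k j hj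
    obtain ⟨x, hx⟩ := base_ptv' j
    have h2 := hpt k 1 (some x)
    rw [hh1] at h2
    have h3 : mq n (some x) (hypBase n) = Ψ k 1 ((H k).1 (Fin.last n)) := by
      show ptv _ _ = _
      rw [hx, ← hj]; ring
    rw [h3, hh0] at h2
    exact last_ne _ x (hinj k 1 h2).symm
  have hend : ∀ k : I × I, H k = hypBase (n + 1) → (∀ u, h (k, u) = h (k, 0)) →
      Ψ k 1 ((H k).1 (Fin.last n)) + n = (xb (2 * n + 1)).1 := by
    intro k hk hu
    rw [hconst k hu, hk]
    simp [hypBase, xb]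
    ring
  have hs : ∀ (s : I), H (s, 0) = hypBase (n + 1) := fun s => by simp
  have hs' : ∀ (s : I), H (s, 1) = hypBase (n + 1) := fun s => by simp
  apply lp_injective
  rw [lp_ofLp, lp_one]
  refine Path.Homotopic.Quotient.eq.2 ⟨⟨⟨⟨fun k => ⟨Ψ k 1 ((H k).1 (Fin.last n)) + n, hmem k⟩, ?_⟩, ?_, ?_⟩, ?_⟩⟩
  · refine Continuous.subtype_mk (Continuous.add ?_ continuous_const) _
    exact hc.comp (continuous_id.prodMk (continuous_const.prodMk (last_cont.comp H.continuous)))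
  · intro t
    apply Subtype.ext
    show Ψ (0, t) 1 ((H (0, t)).1 (Fin.last n)) + n = (γ t).1
    rw [hconst]
    · rw [hH0]
      have e3 : (fi n (γ t)).1 (Fin.last n) = (γ t).1 - n := last_of rfl
      rw [e3]; ring
    · intro u
      simp [h]
  · intro t
    apply Subtype.ext
    show Ψ (1, t) 1 ((H (1, t)).1 (Fin.last n)) + n = _
    have e1 : H (1, t) = hypBase (n + 1) := by rw [H.apply_one]; rfl
    have h2 := hpt (1, t) 1 none
    rw [hh1, hh0, e1, forget_base, mq_base] at h2
    rw [e1, h2]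
    simp [hypBase, xb]
    ring
  · intro s t ht
    apply Subtype.ext
    rcases ht with rfl | rfl
    · refine (hend (s, 0) (hs s) ?_).trans (congrArg Subtype.val γ.source.symm)
      intro u
      simp only [h]
      rw [hs, hs]
    · refine (hend (s, 1) (hs' s) ?_).trans (congrArg Subtype.val γ.target.symm)
      intro u
      simp only [h]
      rw [hs', hs']

lemma fi_exact (g : PG (n + 1)) (hg : phiP n g = 1) :
    g ∈ (mapAt (fi n) (fi_base n)).range := by
  obtain ⟨e, he⟩ := Path.Homotopic.Quotient.mk_surjective (lp g)
  have h1 : lp (phiP n g) = hq (e.map (hypForgetMap n).hom.continuous) := by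
    rw [lp_phiP, ← he]; rfl
  rw [hg, lp_one] at h1
  obtain ⟨H⟩ := Path.Homotopic.Quotient.eq.1 h1.symm
  let h : I × I → ↑(hypSpace n) := fun p => H (p.2, p.1)
  have hh : Continuous h := H.continuous.comp continuous_swap
  obtain ⟨Ψ, hc, hinj, hpt, hz, hconst⟩ := transport (mq n) (mq_cont n) (mq_ne n) h hh
  have hh0 : ∀ t, h (t, 0) = hypForgetMap n (e t) := fun t => H.apply_zero t
  have hh1 : ∀ t, h (t, 1) = hypBase n := fun t => H.apply_one t
  have hmem : ∀ t u (x : Om n), Ψ t u ((e t).1 (Fin.last n)) ≠ ptv (h (t, u)).1 x := by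
    intro t u x hx
    have h2 := hpt t u (some x)
    have h3 : mq n (some x) (h (t, u)) = Ψ t u ((e t).1 (Fin.last n)) := hx.symm
    rw [h3, hh0] at h2
    exact last_ne _ x (hinj t u h2).symm
  have hb : ∀ t, (t = 0 ∨ t = 1) → ∀ u, h (t, u) = hypBase n := by
    rintro t (rfl | rfl) u
    · exact (H.source u)
    · exact (H.target u)
  have het : ∀ t, (t = 0 ∨ t = 1) → e t = hypBase (n + 1) := by
    rintro t (rfl | rfl) <;> simp
  have hb2 : ∀ t, (t = 0 ∨ t = 1) → ∀ u, Ψ t u ((e t).1 (Fin.last n)) =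
      (hypBase (n + 1)).1 (Fin.last n) := by
    intro t ht u
    rw [hconst t (fun u => by rw [hb t ht, hb t ht]), het t ht]
  have hm : ∀ t (j : Fin (2 * n + 1)), Ψ t 1 ((e t).1 (Fin.last n)) + n ≠ ((j : ℕ) : ℂ) := by
    intro t j hj
    obtain ⟨x, hx⟩ := base_ptv' j
    apply hmem t 1 x
    rw [hh1, hx, ← hj]; ring
  have hxb : (hypBase (n + 1)).1 (Fin.last n) + n = (xb (2 * n + 1)).1 := by
    simp [hypBase, xb]; ring
  let γ : Path (xb (2 * n + 1)) (xb (2 * n + 1)) :=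
    ⟨⟨fun t => ⟨Ψ t 1 ((e t).1 (Fin.last n)) + n, hm t⟩, by
      refine Continuous.subtype_mk (Continuous.add ?_ continuous_const) _
      exact hc.comp (continuous_id.prodMk (continuous_const.prodMk (last_cont.comp e.continuous)))⟩,
      Subtype.ext (by
        show Ψ 0 1 ((e 0).1 (Fin.last n)) + n = _
        rw [hb2 0 (Or.inl rfl), hxb]),
      Subtype.ext (by
        show Ψ 1 1 ((e 1).1 (Fin.last n)) + n = _
        rw [hb2 1 (Or.inr rfl), hxb])⟩
  refine ⟨ofLp (hq γ), ?_⟩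
  apply lp_injective
  rw [lp_mapAt, ← he]
  symm
  refine Path.Homotopic.Quotient.eq.2 ⟨⟨⟨⟨fun p => mkE (h (p.2, p.1)) (Ψ p.2 p.1 ((e p.2).1 (Fin.last n)))
    (hmem p.2 p.1), ?_⟩, ?_, ?_⟩, ?_⟩⟩
  · refine mkE_cont _ _ (hh.comp continuous_swap) ?_ _
    exact hc.comp (continuous_snd.prodMk (continuous_fst.prodMk
      (last_cont.comp (e.continuous.comp continuous_snd))))
  · intro t
    apply hypExt
    · exact (forget_of rfl).trans (hh0 t)
    · refine (last_of rfl).trans ?_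
      exact hz t _
  · intro t
    apply hypExt
    · exact (forget_of rfl).trans ((hh1 t).trans (forget_of rfl).symm)
    · refine (last_of rfl).trans ?_
      refine Eq.trans ?_ (last_of rfl).symm
      show _ = Ψ t 1 ((e t).1 (Fin.last n)) + n - n
      ring
  · intro s t ht
    have ht' : t = 0 ∨ t = 1 := ht
    refine Eq.trans ?_ (het t ht').symm
    apply hypExt
    · exact (forget_of rfl).trans (hb t ht' s)
    · exact (last_of rfl).trans (hb2 t ht' s)

theorem fibre_data : ∃ (γ : Fin (2 * n + 1) → PG (n + 1)) (e : Fin (2 * n + 1) → SS (n + 1)),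
    (∀ j, phiP n (γ j) = 1) ∧ Function.Injective (FreeGroup.lift γ) ∧
    (∀ g, phiP n g = 1 → g ∈ (FreeGroup.lift γ).range) ∧
    (∀ j k, uP (n + 1) (e j) (γ k) = if j = k then 1 else 0) := by
  choose x hx using base_ptv' (n := n)
  have hlift : FreeGroup.lift (fun j => mapAt (fi n) (fi_base n) (gam _ j)) =
      (mapAt (fi n) (fi_base n)).comp (FreeGroup.lift (gam (2 * n + 1))) := by
    ext j; simp
  refine ⟨fun j => mapAt (fi n) (fi_base n) (gam _ j), fun j => (Om.pt (Fin.last n) 1, omCS (x j)),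
    ?_, ?_, ?_, ?_⟩
  · intro j
    obtain ⟨γ, hγ⟩ := Path.Homotopic.Quotient.mk_surjective (lp (gam (2 * n + 1) j))
    have : gam (2 * n + 1) j = ofLp (hq γ) := lp_injective hγ.symm
    show phiP n (mapAt (fi n) (fi_base n) (gam _ j)) = 1
    rw [this]
    apply lp_injective
    rw [lp_phiP, lp_mapAt, lp_one]
    refine congrArg hq ?_
    apply Path.ext
    funext t
    exact forget_of rfl
  · rw [hlift]
    exact (fi_inj n).comp (gam_inj _)
  · intro g hg
    obtain ⟨w, rfl⟩ := fi_exact n g hg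
    obtain ⟨v, rfl⟩ := gam_surj _ w
    exact ⟨v, by rw [hlift]; rfl⟩
  · intro j k
    have hell : (ell (n + 1) (Om.pt (Fin.last n) 1, omCS (x j))).comp (fi n) = lj _ j := by
      ext z
      have hne : (Om.pt (Fin.last n) 1 : Om (n + 1)) ≠ omCS (x j) := by
        intro h
        have := last_ne (fi n z) (x j)
        rw [ptv_forget, ← h] at this
        simp [ptv] at this
      show (ell (n + 1) _ (fi n z)).1 = z.1 - _
      rw [ell_val_ne hne]
      simp only
      rw [← ptv_forget]
      have e1 : hypForgetMap n (fi n z) = hypBase n := forget_of rfl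
      rw [e1, hx]
      have e2 : ptv (fi n z).1 (Om.pt (Fin.last n) 1) = z.1 - n := by
        simp only [ptv, Units.val_one, Int.cast_one, one_mul]
        exact last_of rfl
      rw [e2]; ring
    rw [uP, inc_mapAt, hell, inc_gam]
    split_ifs
    · exact lam_two_pi_I
    · exact map_zero _

instance : Subsingleton (PG 0) := by
  have : Subsingleton ↑(hypSpace 0) := ⟨fun a b => Subtype.ext (funext fun i => i.elim0)⟩
  refine ⟨fun g h => lp_injective ?_⟩
  obtain ⟨γ, hγ⟩ := Path.Homotopic.Quotient.mk_surjective (lp g)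
  obtain ⟨γ', hγ'⟩ := Path.Homotopic.Quotient.mk_surjective (lp h)
  rw [← hγ, ← hγ']
  congr 1
  apply Path.ext
  funext t
  exact Subsingleton.elim _ _

end Fibre

end WB
end

section
open CategoryTheory
namespace WB

section Cochains
variable {X Y A B : Type*} [AddCommGroup A] [AddCommGroup B]

/-- The (augmented) homogeneous coboundary. -/
def dd : ∀ {n : ℕ}, ((Fin n → X) → A) → ((Fin (n + 1) → X) → A)
  | 0, c, x => c (Fin.tail x)
  | _ + 1, c, x => c (Fin.tail x) - dd (fun y => c (Fin.cons (x 0) y)) (Fin.tail x)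

theorem dd_zero (c : (Fin 0 → X) → A) (x : Fin 1 → X) : dd c x = c (Fin.tail x) := rfl

theorem dd_succ {n : ℕ} (c : (Fin (n + 1) → X) → A) (x : Fin (n + 2) → X) :
    dd c x = c (Fin.tail x) - dd (fun y => c (Fin.cons (x 0) y)) (Fin.tail x) := rfl

theorem dd_cons {n : ℕ} (c : (Fin (n + 1) → X) → A) (p : X) (y : Fin (n + 1) → X) :
    dd c (Fin.cons p y : Fin (n + 2) → X) = c y - dd (fun z => c (Fin.cons p z)) y := by
  rw [dd_succ]; simp

theorem dd_comp (φ : A →+ B) {n : ℕ} (c : (Fin n → X) → A) (x : Fin (n + 1) → X) :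
    dd (fun y => φ (c y)) x = φ (dd c x) := by
  induction n with
  | zero => rfl
  | succ n ih => rw [dd_succ, dd_succ, map_sub, ← ih]

theorem dd_pull (f : X → Y) {n : ℕ} (c : (Fin n → Y) → A) (x : Fin (n + 1) → X) :
    dd (fun y => c (fun k => f (y k))) x = dd c (fun k => f (x k)) := by
  induction n with
  | zero => rfl
  | succ n ih =>
    rw [dd_succ, dd_succ]
    refine congrArg₂ _ rfl ?_
    have := ih (fun z => c (Fin.cons (f (x 0)) z)) (Fin.tail x)
    refine Eq.trans ?_ this
    congr 1
    funext y
    congr 1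
    funext k
    refine Fin.cases rfl (fun k => rfl) k

theorem dd_add {n : ℕ} (c c' : (Fin n → X) → A) (x : Fin (n + 1) → X) :
    dd (fun y => c y + c' y) x = dd c x + dd c' x := by
  induction n with
  | zero => rfl
  | succ n ih => simp only [dd_succ]; rw [ih]; abel

theorem dd_neg {n : ℕ} (c : (Fin n → X) → A) (x : Fin (n + 1) → X) :
    dd (fun y => - c y) x = - dd c x := dd_comp (-AddMonoidHom.id A) c x

theorem dd_sub {n : ℕ} (c c' : (Fin n → X) → A) (x : Fin (n + 1) → X) :
    dd (fun y => c y - c' y) x = dd c x - dd c' x := by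
  simp only [sub_eq_add_neg]; rw [dd_add, dd_neg]

theorem dd_zero_fun {n : ℕ} (x : Fin (n + 1) → X) :
    dd (fun _ : Fin n → X => (0 : A)) x = 0 := dd_comp (0 : A →+ A) (fun _ => 0) x

theorem dd_sum {ι : Type*} (s : Finset ι) {n : ℕ} (c : ι → (Fin n → X) → A)
    (x : Fin (n + 1) → X) :
    dd (fun y => ∑ j ∈ s, c j y) x = ∑ j ∈ s, dd (c j) x := by
  classical
  induction s using Finset.induction_on with
  | empty => simpa using dd_zero_fun x
  | insert a s ha ih =>
    simp only [Finset.sum_insert ha]; rw [dd_add, ih]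

theorem dd_dd {n : ℕ} (c : (Fin n → X) → A) (x : Fin (n + 2) → X) : dd (dd c) x = 0 := by
  induction n with
  | zero => rw [dd_succ, dd_zero, dd_zero, dd_zero]; 
            have : ∀ a b : Fin 0 → X, c a = c b := fun a b => congrArg c (Subsingleton.elim _ _)
            rw [sub_eq_zero]; exact this _ _
  | succ n ih =>
    rw [dd_succ (dd c)]
    have : (fun y => dd c (Fin.cons (x 0) y : Fin (n + 2) → X)) =
      fun y => c y - dd (fun z => c (Fin.cons (x 0) z)) y := by
      funext y; exact dd_cons c (x 0) y
    rw [this, dd_sub, ih]; simp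

/-- cone contraction -/
theorem dd_cone {n : ℕ} (c : (Fin (n + 1) → X) → A) (p : X) (y : Fin (n + 1) → X) :
    dd (fun z => c (Fin.cons p z)) y = c y - dd c (Fin.cons p y : Fin (n + 2) → X) := by
  rw [dd_cons]; abel

end Cochains

section Cup
variable {X A : Type*} [AddCommGroup A] [Module ℚ A]

/-- Front cup product with a degree one cochain. -/
def cupf (U : X → X → ℚ) {n : ℕ} (c : (Fin (n + 1) → X) → A) : (Fin (n + 2) → X) → A :=
  fun x => U (x 0) (x 1) • c (Fin.tail x)

theorem dd_wmul (w : X → ℚ) {n : ℕ} (c : (Fin (n + 1) → X) → A) (x : Fin (n + 2) → X) :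
    dd (fun y => w (y 0) • c y) x = w (x 0) • dd c x + (w (x 1) - w (x 0)) • c (Fin.tail x) := by
  rw [dd_succ, dd_succ]
  simp only [Fin.cons_zero]
  have := dd_comp (DistribSMul.toAddMonoidHom A (w (x 0)))
    (fun y => c (Fin.cons (x 0) y)) (Fin.tail x)
  simp only [DistribSMul.toAddMonoidHom_apply] at this
  rw [this]
  have h : Fin.tail x 0 = x 1 := rfl
  rw [h]
  module

theorem dd_cupf (U : X → X → ℚ) (hU : ∀ x y z, U x y + U y z = U x z) {n : ℕ}
    (c : (Fin (n + 1) → X) → A) (x : Fin (n + 3) → X) :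
    dd (cupf U c) x = - cupf U (dd c) x := by
  rw [dd_succ]
  have : (fun y => cupf U c (Fin.cons (x 0) y : Fin (n + 2) → X)) =
      fun y => (U (x 0)) (y 0) • c y := by
    funext y; simp [cupf]
  rw [this, dd_wmul]
  have h : Fin.tail x 0 = x 1 := rfl
  have h' : Fin.tail x 1 = x 2 := rfl
  rw [h, h', ← hU (x 0) (x 1) (x 2)]
  simp only [cupf, h, h']
  module

end Cup

section Equivariant
variable {H X : Type*} [Group H] [MulAction H X]
variable {A B C : Type*} [AddCommGroup A] [Module ℚ A] [AddCommGroup B] [Module ℚ B]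
  [AddCommGroup C] [Module ℚ C]

def Eqv (ρ : Representation ℚ H A) {n : ℕ} (c : (Fin n → X) → A) : Prop :=
  ∀ (h : H) (x : Fin n → X), c (fun k => h • x k) = ρ h (c x)

theorem Eqv.dd {ρ : Representation ℚ H A} {n : ℕ} {c : (Fin n → X) → A} (hc : Eqv ρ c) :
    Eqv ρ (dd c) := by
  intro h x
  rw [← dd_pull (fun y => h • y) c x]
  have : (fun y : Fin n → X => c (fun k => h • y k)) = fun y => ρ h (c y) := by
    funext y; exact hc h y
  rw [this]
  exact dd_comp (ρ h).toAddMonoidHom c x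

theorem Eqv.add {ρ : Representation ℚ H A} {n : ℕ} {c c' : (Fin n → X) → A} (hc : Eqv ρ c)
    (hc' : Eqv ρ c') : Eqv ρ (fun x => c x + c' x) := by
  intro h x; simp only [hc h x, hc' h x, map_add]

theorem Eqv.sub {ρ : Representation ℚ H A} {n : ℕ} {c c' : (Fin n → X) → A} (hc : Eqv ρ c)
    (hc' : Eqv ρ c') : Eqv ρ (fun x => c x - c' x) := by
  intro h x; simp only [hc h x, hc' h x, map_sub]

theorem Eqv.sum {ρ : Representation ℚ H A} {n : ℕ} {ι : Type*} {s : Finset ι}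
    {c : ι → (Fin n → X) → A} (hc : ∀ j ∈ s, Eqv ρ (c j)) :
    Eqv ρ (fun x => ∑ j ∈ s, c j x) := by
  intro h x; simp only [map_sum]; exact Finset.sum_congr rfl fun j hj => hc j hj h x

theorem Eqv.map {ρ : Representation ℚ H A} {σ : Representation ℚ H B} {n : ℕ}
    {c : (Fin n → X) → A} (hc : Eqv ρ c) (f : A →ₗ[ℚ] B) (hf : ∀ h a, f (ρ h a) = σ h (f a)) :
    Eqv σ (fun x => f (c x)) := by
  intro h x; simp only [hc h x, hf]

theorem Eqv.cupf {ρ : Representation ℚ H A} {n : ℕ} {c : (Fin (n + 1) → X) → A} (hc : Eqv ρ c)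
    {U : X → X → ℚ} (hU : ∀ (h : H) x y, U (h • x) (h • y) = U x y) : Eqv ρ (cupf U c) := by
  intro h x
  simp only [WB.cupf, hU, map_smul]
  rw [← hc h]; rfl

theorem lift_eqv {σ : Representation ℚ H B} {τ : Representation ℚ H C} (π : B →ₗ[ℚ] C)
    (hπ : Function.Surjective π) (hπe : ∀ h b, π (σ h b) = τ h (π b))
    (t : X → H) (ht : ∀ h x, t (h • x) = h * t x) {n : ℕ} {e : (Fin (n + 1) → X) → C}
    (he : Eqv τ e) : ∃ e' : (Fin (n + 1) → X) → B, Eqv σ e' ∧ ∀ x, π (e' x) = e x := by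
  choose s hs using hπ
  refine ⟨fun x => σ (t (x 0)) (s (τ (t (x 0))⁻¹ (e x))), ?_, ?_⟩
  · intro h x
    simp only [ht, he h x]
    rw [map_mul, Module.End.mul_apply, mul_inv_rev, map_mul, Module.End.mul_apply]
    simp
  · intro x
    simp only [hπe, hs]
    simp

/-- coinduced representation -/
def coi (ρ : Representation ℚ H A) : Representation ℚ H (H → A) where
  toFun h := LinearMap.pi fun k => (ρ h).comp (LinearMap.proj (h⁻¹ * k))
  map_one' := by ext; simp
  map_mul' g h := by
    refine LinearMap.ext fun φ => ?_
    funext k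
    simp [mul_assoc]

theorem coi_apply (ρ : Representation ℚ H A) (h : H) (φ : H → A) (k : H) :
    coi ρ h φ k = ρ h (φ (h⁻¹ * k)) := rfl

variable (H A) in
def cst : A →ₗ[ℚ] (H → A) := LinearMap.pi fun _ => LinearMap.id

theorem cst_inj : Function.Injective (cst H A) := fun a b h => congrFun h 1

theorem cst_eqv (ρ : Representation ℚ H A) (h : H) (a : A) :
    cst H A (ρ h a) = coi ρ h (cst H A a) := rfl

variable (H A) in
abbrev Coq := (H → A) ⧸ LinearMap.range (cst H A)

variable (H A) in
abbrev cpi : (H → A) →ₗ[ℚ] Coq H A := (LinearMap.range (cst H A)).mkQ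

/-- quotient of the coinduced representation -/
def coq (ρ : Representation ℚ H A) : Representation ℚ H (Coq H A) where
  toFun h := Submodule.mapQ _ _ (coi ρ h) (by rintro _ ⟨a, rfl⟩; exact ⟨ρ h a, rfl⟩)
  map_one' := by
    apply Submodule.linearMap_qext
    ext1 φ
    simp
  map_mul' g h := by
    apply Submodule.linearMap_qext
    ext1 φ
    simp [Module.End.mul_eq_comp]

theorem cpi_eqv (ρ : Representation ℚ H A) (h : H) (a : H → A) :
    cpi H A (coi ρ h a) = coq ρ h (cpi H A a) := rfl

theorem cpi_surj : Function.Surjective (cpi H A) := Submodule.mkQ_surjective _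

theorem descend (ρ : Representation ℚ H A) {n : ℕ} {b : (Fin n → X) → (H → A)}
    (hb : Eqv (coi ρ) b) (h0 : ∀ x, cpi H A (b x) = 0) :
    ∃ a : (Fin n → X) → A, Eqv ρ a ∧ ∀ x, cst H A (a x) = b x := by
  have : ∀ x, ∃ a, cst H A a = b x := fun x => by
    have := h0 x
    rwa [Submodule.mkQ_apply, Submodule.Quotient.mk_eq_zero] at this
  choose a ha using this
  refine ⟨a, fun h x => cst_inj (H := H) ?_, ha⟩
  rw [ha, hb, cst_eqv, ha]

theorem coi_acyclic (ρ : Representation ℚ H A) (p : X) {n : ℕ} {c : (Fin (n + 1) → X) → (H → A)}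
    (hc : Eqv (coi ρ) c) (hd : ∀ x, dd c x = 0) :
    ∃ e : (Fin n → X) → (H → A), Eqv (coi ρ) e ∧ ∀ x, dd e x = c x := by
  refine ⟨fun x k => c (Fin.cons (k • p) x) k, ?_, ?_⟩
  · intro h x
    funext k
    rw [coi_apply]
    have := congrFun (hc h (Fin.cons ((h⁻¹ * k) • p) x)) k
    rw [coi_apply] at this
    rw [← this]
    refine congrFun (congrArg c ?_) k
    funext j
    refine Fin.cases ?_ (fun j => rfl) j
    simp [smul_smul]
  · intro x
    funext k
    have h1 := dd_comp (Pi.evalAddMonoidHom (fun _ : H => A) k)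
      (fun x k => c (Fin.cons (k • p) x) k) x
    have h2 := dd_comp (Pi.evalAddMonoidHom (fun _ : H => A) k)
      (fun x => c (Fin.cons (k • p) x)) x
    simp only [Pi.evalAddMonoidHom_apply] at h1 h2
    rw [← h1, h2, dd_cone, hd, sub_zero]

/-- Dimension shift, combined: from `c` produce `b` and reduce to `π b`. -/
theorem shift (ρ : Representation ℚ H A) (p : X) {n : ℕ} {c : (Fin (n + 1) → X) → A}
    (hc : Eqv ρ c) (hd : ∀ x, dd c x = 0) :
    ∃ b : (Fin n → X) → (H → A), Eqv (coi ρ) b ∧ ∀ x, dd b x = cst H A (c x) := by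
  refine coi_acyclic ρ p (c := fun x => cst H A (c x)) (hc.map _ (cst_eqv ρ)) fun x => ?_
  exact (dd_comp (cst H A).toAddMonoidHom c x).trans (by rw [hd]; exact map_zero _)

omit [MulAction H X] in
theorem dd_cpi {n : ℕ} {c : (Fin (n + 1) → X) → A}
    {b : (Fin n → X) → (H → A)} (h : ∀ x, dd b x = cst H A (c x)) (x : Fin (n + 1) → X) :
    dd (fun y => cpi H A (b y)) x = 0 := by
  refine (dd_comp (cpi H A).toAddMonoidHom b x).trans ?_
  rw [h]
  show cpi H A (cst H A (c x)) = 0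
  rw [Submodule.mkQ_apply, Submodule.Quotient.mk_eq_zero]; exact ⟨_, rfl⟩

/-- Closing step: if `π b = d(π e) ` modulo something handled, get `c = d a`. -/
theorem close_up (ρ : Representation ℚ H A) {n : ℕ} {c : (Fin (n + 1) → X) → A}
    {b b' : (Fin n → X) → (H → A)} (hb : Eqv (coi ρ) b) (hb' : Eqv (coi ρ) b')
    (h : ∀ x, dd b x = cst H A (c x)) (h' : ∀ x, cpi H A (b' x) = cpi H A (b x)) :
    ∃ a : (Fin n → X) → A, Eqv ρ a ∧ (∀ x, b x = b' x + cst H A (a x)) ∧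
      ∀ x, cst H A (c x) = dd b' x + cst H A (dd a x) := by
  obtain ⟨a, ha, ha'⟩ := descend ρ (hb.sub hb') (fun x => by rw [map_sub, h', sub_self])
  have e1 : ∀ x, b x = b' x + cst H A (a x) := fun x => by rw [ha']; abel
  refine ⟨a, ha, e1, fun x => ?_⟩
  rw [← h]
  have : b = fun x => b' x + cst H A (a x) := funext e1
  rw [this, dd_add]
  congr 1
  exact dd_comp (cst H A).toAddMonoidHom a x

end Equivariant

end WB
end

section
open CategoryTheory
namespace WB

section Two
variable {X A : Type*} [AddCommGroup A]

theorem dd_one (c : (Fin 1 → X) → A) (x y : X) : dd c ![x, y] = c ![y] - c ![x] := by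
  rw [dd_succ, dd_zero]
  congr 1

theorem dd_two (c : (Fin 2 → X) → A) (x y z : X) :
    dd c ![x, y, z] = c ![y, z] - c ![x, z] + c ![x, y] := by
  rw [dd_succ]
  have : Fin.tail ![x, y, z] = ![y, z] := rfl
  rw [this, dd_one]
  have h1 : (Fin.cons (![x, y, z] 0) ![z] : Fin 2 → X) = ![x, z] := rfl
  have h2 : (Fin.cons (![x, y, z] 0) ![y] : Fin 2 → X) = ![x, y] := rfl
  rw [h1, h2]; abel

theorem coc_two {c : (Fin 2 → X) → A} (h : ∀ x, dd c x = 0) (x y z : X) :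
    c ![x, y] + c ![y, z] = c ![x, z] := by
  have := h ![x, y, z]
  rw [dd_two] at this
  have h2 : c ![x, y] + c ![y, z] - c ![x, z] = 0 := by rw [← this]; abel
  exact sub_eq_zero.1 h2

theorem eta1 (x : Fin 1 → X) : x = ![x 0] := by funext i; fin_cases i; rfl
theorem eta2 (x : Fin 2 → X) : x = ![x 0, x 1] := by funext i; fin_cases i <;> rfl

end Two

section F1
variable {H X X' : Type} [Group H] [MulAction H X] [MulAction H X']

theorem Eqv.two {A : Type} [AddCommGroup A] [Module ℚ A] {ρ : Representation ℚ H A}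
    {c : (Fin 2 → X) → A} (hc : Eqv ρ c) (h : H) (x y : X) :
    c ![h • x, h • y] = ρ h (c ![x, y]) := by
  rw [← hc]; congr 1; funext i; fin_cases i <;> rfl

theorem Eqv.one {A : Type} [AddCommGroup A] [Module ℚ A] {ρ : Representation ℚ H A}
    {c : (Fin 1 → X) → A} (hc : Eqv ρ c) (h : H) (x : X) :
    c ![h • x] = ρ h (c ![x]) := by
  rw [← hc]; congr 1; funext i; fin_cases i; rfl

theorem restrict_cob (ι : X' → X) (hι : ∀ (h : H) x, ι (h • x) = h • ι x)
    (r : X → X') (hr : ∀ (h : H) x, r (h • x) = h • r x)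
    (t : X → H) (ht : ∀ h x, t (h • x) = h * t x) (p : X') (n : ℕ) :
    ∀ {A : Type} [AddCommGroup A] [Module ℚ A] (ρ : Representation ℚ H A)
      (c : (Fin (n + 2) → X) → A), Eqv ρ c → (∀ x, dd c x = 0) →
      (∃ e : (Fin (n + 1) → X') → A, Eqv ρ e ∧ ∀ x, dd e x = c (fun k => ι (x k))) →
      ∃ e : (Fin (n + 1) → X) → A, Eqv ρ e ∧ ∀ x, dd e x = c x := by
  have pull : ∀ {A : Type} [AddCommGroup A] [Module ℚ A] (ρ : Representation ℚ H A) (m : ℕ)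
      (c : (Fin m → X) → A), Eqv ρ c → Eqv ρ (fun x : Fin m → X' => c (fun k => ι (x k))) := by
    intro A _ _ ρ m c hc h x
    simp only [hι]
    exact hc h _
  induction n with
  | zero =>
    rintro A _ _ ρ c hc hd ⟨e, he, hde⟩
    refine ⟨fun x => e ![r (x 0)] + c ![ι (r (x 0)), x 0], ?_, ?_⟩
    · intro h x
      simp only [hr, hι, he.one, hc.two, map_add]
    · intro x
      rw [eta2 x, dd_one]
      simp only [Matrix.cons_val_zero]
      have h1 : e ![r (x 1)] - e ![r (x 0)] = c ![ι (r (x 0)), ι (r (x 1))] := by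
        rw [← dd_one, hde]
        congr 1; funext i; fin_cases i <;> rfl
      have h2 := coc_two hd (ι (r (x 0))) (ι (r (x 1))) (x 1)
      have h3 := coc_two hd (ι (r (x 0))) (x 0) (x 1)
      rw [← h1, ← h3] at h2
      have h4 : c ![x 0, x 1] = (c ![ι (r (x 0)), x 0] + c ![x 0, x 1]) -
        c ![ι (r (x 0)), x 0] := by abel
      rw [h4, ← h2]; abel
  | succ n ih =>
    rintro A _ _ ρ c hc hd ⟨e, he, hde⟩
    obtain ⟨b, hb, hdb⟩ := shift ρ (ι p) hc hd
    -- restrict b to X'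
    have hk : ∃ k : (Fin (n + 1) → X') → (H → A), Eqv (coi ρ) k ∧
        ∀ x, dd k x = b (fun j => ι (x j)) - cst H A (e x) := by
      refine coi_acyclic ρ p (c := fun x => b (fun j => ι (x j)) - cst H A (e x))
        ((pull _ _ b hb).sub (he.map _ (cst_eqv ρ))) ?_
      intro x
      rw [dd_sub, dd_pull, hdb]
      have := dd_comp (cst H A).toAddMonoidHom e x
      simp only [LinearMap.toAddMonoidHom_coe] at this
      rw [this, hde, sub_self]
    obtain ⟨k, hk, hdk⟩ := hk
    obtain ⟨m, hm, hdm⟩ := ih (coq ρ) (fun y => cpi H A (b y)) (hb.map _ (cpi_eqv ρ))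
      (dd_cpi hdb) ⟨fun y => cpi H A (k y), hk.map _ (cpi_eqv ρ), fun x => by
        have := dd_comp (cpi H A).toAddMonoidHom k x
        simp only [LinearMap.toAddMonoidHom_coe] at this
        rw [this, hdk, map_sub]
        have h0 : cpi H A (cst H A (e x)) = 0 := by
          rw [Submodule.mkQ_apply, Submodule.Quotient.mk_eq_zero]; exact ⟨_, rfl⟩
        rw [h0, sub_zero]⟩
    obtain ⟨m', hm', hm2⟩ := lift_eqv (cpi H A) cpi_surj (cpi_eqv ρ) t ht hm
    obtain ⟨a, ha, -, hca⟩ := close_up ρ hb hm'.dd hdb (fun x => by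
      have := dd_comp (cpi H A).toAddMonoidHom m' x
      simp only [LinearMap.toAddMonoidHom_coe] at this
      rw [← this, ← hdm]
      congr 1; funext y; exact hm2 y)
    refine ⟨a, ha, fun x => cst_inj (H := H) ?_⟩
    rw [hca x, dd_dd, zero_add]

end F1

section Free
variable {J X : Type} [MulAction (FreeGroup J) X]

/-- Crossed homomorphisms on free groups with prescribed values on generators. -/
theorem crossed {B : Type} [AddCommGroup B] [Module ℚ B] (σ : Representation ℚ (FreeGroup J) B)
    (b : J → B) : ∃ z : FreeGroup J → B, (∀ g h, z (g * h) = z g + σ g (z h)) ∧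
      ∀ j, z (FreeGroup.of j) = b j := by
  have inv1 : ∀ (g : FreeGroup J) x, σ g (σ g⁻¹ x) = x := by
    intro g x; rw [← Module.End.mul_apply, ← map_mul]; simp
  have inv2 : ∀ (g : FreeGroup J) x, σ g⁻¹ (σ g x) = x := by
    intro g x; rw [← Module.End.mul_apply, ← map_mul]; simp
  let φ : FreeGroup J →* Equiv.Perm B := FreeGroup.lift fun j =>
    { toFun := fun x => σ (FreeGroup.of j) x + b j
      invFun := fun x => σ (FreeGroup.of j)⁻¹ (x - b j)
      left_inv := fun x => by simp [inv2]
      right_inv := fun x => by simp [inv1] }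
  have hgen : ∀ j x, φ (FreeGroup.of j) x = σ (FreeGroup.of j) x + b j := by
    intro j x; simp [φ]
  have key : ∀ g x, φ g x = σ g x + φ g 0 := by
    intro g
    induction g using FreeGroup.induction_on with
    | C1 => intro x; simp
    | of j => intro x; rw [hgen, hgen]; simp
    | inv_of j _ =>
      intro x
      have h1 : ∀ y, φ (FreeGroup.of j)⁻¹ y = σ (FreeGroup.of j)⁻¹ (y - b j) := by
        intro y
        rw [map_inv, Equiv.Perm.inv_eq_iff_eq, hgen, inv1]; abel
      rw [h1, h1, ← map_add]; congr 1; abel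
    | mul g h hg hh =>
      intro x
      rw [map_mul, Equiv.Perm.mul_apply, Equiv.Perm.mul_apply, hh, hg, hg (φ h 0), map_add,
        map_mul, Module.End.mul_apply]; abel
  refine ⟨fun g => φ g 0, fun g h => ?_, fun j => ?_⟩
  · simp only
    rw [map_mul, Equiv.Perm.mul_apply, key]; abel
  · simp only
    rw [hgen]; simp

theorem crossed_ext {B : Type} [AddCommGroup B] [Module ℚ B]
    (σ : Representation ℚ (FreeGroup J) B) {z z' : FreeGroup J → B}
    (hz : ∀ g h, z (g * h) = z g + σ g (z h)) (hz' : ∀ g h, z' (g * h) = z' g + σ g (z' h))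
    (h : ∀ j, z (FreeGroup.of j) = z' (FreeGroup.of j)) (g) : z g = z' g := by
  have one : ∀ {z : FreeGroup J → B}, (∀ g h, z (g * h) = z g + σ g (z h)) → z 1 = 0 := by
    intro z hz
    have := hz 1 1
    simpa using this
  have inv : ∀ {z : FreeGroup J → B}, (∀ g h, z (g * h) = z g + σ g (z h)) →
      ∀ g, z g⁻¹ = - σ g⁻¹ (z g) := by
    intro z hz g
    have := hz g⁻¹ g
    rw [inv_mul_cancel, one hz] at this
    exact eq_neg_of_add_eq_zero_left this.symm
  induction g using FreeGroup.induction_on with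
  | C1 => rw [one hz, one hz']
  | of j => exact h j
  | inv_of j _ => rw [inv hz, inv hz', h]
  | mul g k hg hk => rw [hz, hz', hg, hk]

variable (t : X → FreeGroup J) (ht : ∀ h x, t (h • x) = h * t x)
include ht

theorem lift_one {B C : Type} [AddCommGroup B] [Module ℚ B] [AddCommGroup C] [Module ℚ C]
    {σ : Representation ℚ (FreeGroup J) B} {τ : Representation ℚ (FreeGroup J) C}
    (π : B →ₗ[ℚ] C) (hπ : Function.Surjective π) (hπe : ∀ h b, π (σ h b) = τ h (π b))
    (p : X) {c : (Fin 2 → X) → C} (hc : Eqv τ c) (hd : ∀ x, dd c x = 0) :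
    ∃ c' : (Fin 2 → X) → B, Eqv σ c' ∧ (∀ x, dd c' x = 0) ∧ ∀ x, π (c' x) = c x := by
  choose s hs using hπ
  have hz : ∀ g h, c ![p, (g * h) • p] = c ![p, g • p] + τ g (c ![p, h • p]) := by
    intro g h
    rw [← hc.two, smul_smul, coc_two hd]
  obtain ⟨z, hz1, hz2⟩ := crossed σ (fun j => s (c ![p, FreeGroup.of j • p]))
  have hzz : ∀ g, π (z g) = c ![p, g • p] := by
    refine crossed_ext τ (z := fun g => π (z g)) (z' := fun g => c ![p, g • p]) ?_ hz ?_
    · intro g h; simp only [hz1, map_add, hπe]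
    · intro j; simp only [hz2, hs]
  let E : X → B := fun x => z (t x) + σ (t x) (s (c ![p, (t x)⁻¹ • x]))
  have hE : ∀ h x, E (h • x) = z h + σ h (E x) := by
    intro h x
    simp only [E, ht, hz1, map_add, map_mul, Module.End.mul_apply, mul_inv_rev, smul_smul]
    simp only [mul_assoc, inv_mul_cancel, mul_one]; abel
  have hπE : ∀ x, π (E x) = c ![p, x] := by
    intro x
    simp only [E, map_add, hzz, hπe, hs]
    rw [← hc.two, coc_two hd]; simp
  refine ⟨fun x => E (x 1) - E (x 0), ?_, ?_, ?_⟩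
  · intro h x
    simp only [hE, map_sub]; abel
  · intro x
    have : (fun x : Fin 2 → X => E (x 1) - E (x 0)) = dd (fun y : Fin 1 → X => E (y 0)) := by
      funext x; rw [eta2 x, dd_one]; rfl
    rw [this, dd_dd]
  · intro x
    rw [map_sub, hπE, hπE]
    have := coc_two hd p (x 0) (x 1)
    rw [← this, eta2 x]
    simp

theorem free_acyclic (p : X) (n : ℕ) :
    ∀ {A : Type} [AddCommGroup A] [Module ℚ A] (ρ : Representation ℚ (FreeGroup J) A)
      (c : (Fin (n + 3) → X) → A), Eqv ρ c → (∀ x, dd c x = 0) →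
      ∃ e : (Fin (n + 2) → X) → A, Eqv ρ e ∧ ∀ x, dd e x = c x := by
  induction n with
  | zero =>
    intro A _ _ ρ c hc hd
    obtain ⟨b, hb, hdb⟩ := shift ρ p hc hd
    obtain ⟨b', hb', hdb', hπ⟩ := lift_one t ht (cpi _ A) cpi_surj (cpi_eqv ρ) p
      (c := fun y => cpi _ A (b y)) (hb.map _ (cpi_eqv ρ)) (dd_cpi hdb)
    obtain ⟨a, ha, -, hca⟩ := close_up ρ hb hb' hdb hπ
    refine ⟨a, ha, fun x => cst_inj (H := FreeGroup J) ?_⟩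
    rw [hca x, hdb']; exact (zero_add _).symm
  | succ n ih =>
    intro A _ _ ρ c hc hd
    obtain ⟨b, hb, hdb⟩ := shift ρ p hc hd
    obtain ⟨m, hm, hdm⟩ := ih (coq ρ) (fun y => cpi _ A (b y)) (hb.map _ (cpi_eqv ρ))
      (dd_cpi hdb)
    obtain ⟨m', hm', hm2⟩ := lift_eqv (cpi _ A) cpi_surj (cpi_eqv ρ) t ht hm
    obtain ⟨a, ha, -, hca⟩ := close_up ρ hb hm'.dd hdb (fun x => by
      have := dd_comp (cpi _ A).toAddMonoidHom m' x
      simp only [LinearMap.toAddMonoidHom_coe] at this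
      rw [← this, ← hdm]
      congr 1; funext y; exact hm2 y)
    refine ⟨a, ha, fun x => cst_inj (H := FreeGroup J) ?_⟩
    rw [hca x, dd_dd, zero_add]

end Free

end WB
end

section
open CategoryTheory
namespace WB

section Ext
variable {P Q J : Type} [Group P] [Group Q] (f : P →* Q) (hf : Function.Surjective f)
  (γ : J → P) (hγ : ∀ j, f (γ j) = 1) (hinj : Function.Injective (FreeGroup.lift γ))
  (hker : ∀ g, f g = 1 → g ∈ (FreeGroup.lift γ).range)

include hf hγ hinj hker in
theorem ext_acyclic {M : Type} [AddCommGroup M] [Module ℚ M] (σ : Representation ℚ Q M) {n : ℕ}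
    {c : (Fin (n + 3) → P) → (Q → M)}
    (hc : Eqv ((coi σ).comp f) c) (hd : ∀ x, dd c x = 0) :
    ∃ e : (Fin (n + 2) → P) → (Q → M), Eqv ((coi σ).comp f) e ∧ ∀ x, dd e x = c x := by
  letI : MulAction (FreeGroup J) P := MulAction.compHom P (FreeGroup.lift γ)
  have hsm : ∀ (w : FreeGroup J) (p : P), w • p = FreeGroup.lift γ w * p := fun w p => rfl
  have hfl : ∀ w, f (FreeGroup.lift γ w) = 1 := by
    intro w
    have : f.comp (FreeGroup.lift γ) = 1 := by ext j; simp [hγ]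
    exact DFunLike.congr_fun this w
  choose s hs using hf
  have hex : ∀ p : P, ∃ w, FreeGroup.lift γ w = p * (s (f p))⁻¹ := fun p =>
    hker _ (by simp [hs])
  choose t ht using hex
  have ht' : ∀ (h : FreeGroup J) x, t (h • x) = h * t x := by
    intro h x
    apply hinj
    rw [map_mul, ht, ht, hsm, map_mul, hfl, one_mul, mul_assoc]
  have hc1 : Eqv (1 : Representation ℚ (FreeGroup J) M) (fun x : Fin (n + 3) → P => c x 1) := by
    intro h x
    have := congrFun (hc (FreeGroup.lift γ h) x) 1
    rw [MonoidHom.comp_apply, hfl] at this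
    simp only [hsm]
    simpa using this
  obtain ⟨e, he, hde⟩ := free_acyclic t ht' (1 : P) n 1 (fun x : Fin (n + 3) → P => c x 1) hc1
    (fun x => (dd_comp (Pi.evalAddMonoidHom (fun _ : Q => M) 1) c x).trans (by rw [hd]; rfl))
  have hinv : ∀ (g g' : P) (x : Fin (n + 2) → P), f g = f g' →
      e (fun k => g * x k) = e (fun k => g' * x k) := by
    intro g g' x hg
    obtain ⟨w, hw⟩ := hker (g * g'⁻¹) (by simp [hg])
    have := he w (fun k => g' * x k)
    simp only [hsm, hw] at this
    simpa using this
  refine ⟨fun x q => σ q (e (fun k => (s q)⁻¹ * x k)), ?_, ?_⟩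
  · intro h x
    funext q
    rw [MonoidHom.comp_apply, coi_apply, ← Module.End.mul_apply, ← map_mul]
    simp only [smul_eq_mul]
    rw [show f h * ((f h)⁻¹ * q) = q by group]
    congr 1
    have := hinv ((s q)⁻¹ * h) (s ((f h)⁻¹ * q))⁻¹ x (by simp [hs])
    simpa [mul_assoc] using this
  · intro x
    funext q
    have h1 := dd_comp (Pi.evalAddMonoidHom (fun _ : Q => M) q)
      (fun x q => σ q (e (fun k => (s q)⁻¹ * x k))) x
    have h2 := dd_comp (σ q).toAddMonoidHom (fun x => e (fun k => (s q)⁻¹ * x k)) x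
    have h3 := dd_pull (fun y => (s q)⁻¹ * y) e x
    simp only [Pi.evalAddMonoidHom_apply, LinearMap.toAddMonoidHom_coe] at h1 h2
    rw [← h1, h2, h3, hde]
    have := congrFun (hc (s q)⁻¹ x) 1
    rw [MonoidHom.comp_apply, coi_apply] at this
    simp only [smul_eq_mul, map_inv, hs, inv_inv, mul_one] at this
    rw [this, ← Module.End.mul_apply, ← map_mul]; simp

variable [Fintype J] [DecidableEq J] (u : J → P → ℚ) (hu : ∀ j g h, u j (g * h) = u j g + u j h)
  (huγ : ∀ j k, u j (γ k) = if j = k then 1 else 0)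

def UU (u : P → ℚ) (x y : P) : ℚ := u y - u x

omit [Group P] in
theorem UU_add (u : P → ℚ) (x y z : P) : UU u x y + UU u y z = UU u x z := by
  simp only [UU]; ring

theorem UU_inv {u : P → ℚ} (hu : ∀ g h, u (g * h) = u g + u h) (h x y : P) :
    UU u (h • x) (h • y) = UU u x y := by
  simp only [UU, smul_eq_mul, hu]; ring

include hf hγ hker hu huγ in
theorem ext_base {M : Type} [AddCommGroup M] [Module ℚ M] (σ : Representation ℚ Q M)
    (c : (Fin 2 → P) → M) (hc : Eqv (σ.comp f) c) (hd : ∀ x, dd c x = 0) :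
    ∃ (c0 : (Fin 2 → Q) → M) (cj : J → (Fin 1 → Q) → M) (e : (Fin 1 → P) → M),
      Eqv σ c0 ∧ (∀ x, dd c0 x = 0) ∧ (∀ j, Eqv σ (cj j)) ∧ (∀ j x, dd (cj j) x = 0) ∧
      Eqv (σ.comp f) e ∧ ∀ x, c x = c0 (fun k => f (x k)) +
        ∑ j, cupf (UU (u j)) (fun y => cj j (fun k => f (y k))) x + dd e x := by
  have hfl : ∀ w, f (FreeGroup.lift γ w) = 1 := by
    intro w
    have : f.comp (FreeGroup.lift γ) = 1 := by ext j; simp [hγ]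
    exact DFunLike.congr_fun this w
  have hself : ∀ x, c ![x, x] = 0 := by
    intro x
    have := coc_two hd x x x
    simpa using this
  have hsymm : ∀ x y, c ![y, x] = - c ![x, y] := by
    intro x y
    have := coc_two hd y x y
    rw [hself] at this
    exact eq_neg_of_add_eq_zero_left this
  -- on the kernel
  have hK : ∀ (k x : P), f k = 1 → c ![x, k * x] = c ![1, k] := by
    intro k x hk
    have h1 := hc.two k x 1
    rw [MonoidHom.comp_apply, hk, map_one] at h1
    simp only [smul_eq_mul, mul_one, Module.End.one_apply] at h1
    have h2 := coc_two hd 1 x (k * x)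
    have h3 := coc_two hd 1 (k * x) k
    rw [h1, ← h2, hsymm 1 x] at h3
    rw [← h3]; abel
  have hmulK : ∀ k l : P, f k = 1 → c ![1, k * l] = c ![1, k] + c ![1, l] := by
    intro k l hk
    rw [← coc_two hd 1 l (k * l), hK k l hk, add_comm]
  have hu1 : ∀ j, u j 1 = 0 := by
    intro j
    have := hu j 1 1
    simpa using this
  have huK : ∀ g : P, f g = 1 → c ![1, g] = ∑ j, u j g • c ![1, γ j] := by
    intro g hg
    obtain ⟨w, rfl⟩ := hker g hg
    refine crossed_ext (1 : Representation ℚ (FreeGroup J) M)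
      (z := fun w => c ![1, FreeGroup.lift γ w])
      (z' := fun w => ∑ j, u j (FreeGroup.lift γ w) • c ![1, γ j]) ?_ ?_ ?_ w
    · intro g h
      simp only [map_mul]
      rw [hmulK _ _ (hfl g)]; rfl
    · intro g h
      simp only [map_mul, hu, add_smul, Finset.sum_add_distrib]; rfl
    · intro j
      simp [huγ]
  have hconj : ∀ (p : P) j, σ (f p) (c ![1, γ j]) = c ![1, γ j] := by
    intro p j
    have h1 := hc.two p 1 (γ j)
    have h2 := hK (p * γ j * p⁻¹) p (by simp [hγ])
    simp only [smul_eq_mul, mul_one, MonoidHom.comp_apply] at h1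
    rw [inv_mul_cancel_right, h1] at h2
    rw [h2, huK _ (by simp [hγ])]
    have h3 : ∀ i, u i (p * γ j * p⁻¹) = u i (γ j) := by
      intro i
      have : u i (p * p⁻¹) = 0 := by rw [mul_inv_cancel, hu1]
      rw [hu] at this
      rw [hu, hu]; linarith
    simp [h3, huγ]
  -- descend
  choose s hs using hf
  set c' : P → P → M := fun x y => c ![x, y] - ∑ j, UU (u j) x y • c ![1, γ j] with hc'
  have hadd : ∀ x y z, c' x y + c' y z = c' x z := by
    intro x y z
    simp only [hc']
    rw [← coc_two hd x y z]
    simp only [← UU_add _ x y z, add_smul, Finset.sum_add_distrib]; abel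
  have hcK : ∀ x y, f x = f y → c' x y = 0 := by
    intro x y hxy
    have hk : f (y * x⁻¹) = 1 := by simp [hxy]
    have h1 := hK (y * x⁻¹) x hk
    rw [inv_mul_cancel_right, huK _ hk] at h1
    simp only [hc', h1, UU]
    rw [sub_eq_zero]
    refine Finset.sum_congr rfl fun j _ => ?_
    congr 1
    have := hu j (y * x⁻¹) x
    rw [inv_mul_cancel_right] at this
    linarith
  have hc'f : ∀ x y x' y', f x = f x' → f y = f y' → c' x y = c' x' y' := by
    intro x y x' y' hx hy
    rw [← hadd x x' y, hcK x x' hx, ← hadd x' y' y, hcK y' y hy.symm]; simp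
  have hc'e : ∀ h x y, c' (h * x) (h * y) = σ (f h) (c' x y) := by
    intro h x y
    have h1 := hc.two h x y
    simp only [smul_eq_mul, MonoidHom.comp_apply] at h1
    simp only [hc', h1, map_sub, map_sum, map_smul, hconj]
    congr 1
    refine Finset.sum_congr rfl fun j _ => ?_
    rw [← UU_inv (hu j) h x y]; rfl
  refine ⟨fun x => c' (s (x 0)) (s (x 1)), fun j _ => c ![1, γ j], fun _ => 0, ?_, ?_, ?_, ?_, ?_,
    ?_⟩
  · intro h x
    simp only
    obtain ⟨p, rfl⟩ : ∃ p, f p = h := ⟨s h, hs h⟩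
    rw [← hc'e]
    exact hc'f _ _ _ _ (by simp [hs]) (by simp [hs])
  · intro x
    have : (fun x : Fin 2 → Q => c' (s (x 0)) (s (x 1))) =
        dd (fun y : Fin 1 → Q => c' 1 (s (y 0))) := by
      funext x
      rw [eta2 x, dd_one]
      simp only [Matrix.cons_val_zero, Matrix.cons_val_one]
      rw [← hadd 1 (s (x 0)) (s (x 1))]; abel
    rw [this, dd_dd]
  · intro j h x
    obtain ⟨p, rfl⟩ : ∃ p, f p = h := ⟨s h, hs h⟩
    exact (hconj p j).symm
  · intro j x
    rw [eta2 x, dd_one, sub_self]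
  · intro h x; simp
  · intro x
    rw [dd_zero_fun, add_zero]
    simp only
    rw [hc'f (s (f (x 0))) (s (f (x 1))) (x 0) (x 1) (hs _) (hs _)]
    simp only [hc', cupf]
    rw [sub_add_cancel, ← eta2 x]

include hf hγ hinj hker hu huγ in
theorem ext_gen (n : ℕ) : ∀ {M : Type} [AddCommGroup M] [Module ℚ M] (σ : Representation ℚ Q M)
    (c : (Fin (n + 2) → P) → M) (_ : Eqv (σ.comp f) c) (_ : ∀ x, dd c x = 0),
    ∃ (c0 : (Fin (n + 2) → Q) → M) (cj : J → (Fin (n + 1) → Q) → M) (e : (Fin (n + 1) → P) → M),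
      Eqv σ c0 ∧ (∀ x, dd c0 x = 0) ∧ (∀ j, Eqv σ (cj j)) ∧ (∀ j x, dd (cj j) x = 0) ∧
      Eqv (σ.comp f) e ∧ ∀ x, c x = c0 (fun k => f (x k)) +
        ∑ j, cupf (UU (u j)) (fun y => cj j (fun k => f (y k))) x + dd e x := by
  induction n with
  | zero => exact fun σ c hc hd => ext_base f hf γ hγ hker u hu huγ σ c hc hd
  | succ n ih =>
    intro M _ _ σ c hc hd
    have pull : ∀ {A : Type} [AddCommGroup A] [Module ℚ A] (ρ : Representation ℚ Q A) (m : ℕ)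
        (c : (Fin m → Q) → A), Eqv ρ c →
        Eqv (ρ.comp f) (fun x : Fin m → P => c (fun k => f (x k))) := by
      intro A _ _ ρ m c hc h x
      simp only [smul_eq_mul, map_mul]
      exact hc (f h) _
    obtain ⟨b, hb, hdb⟩ := ext_acyclic f hf γ hγ hinj hker σ
      (c := fun x => cst Q M (c x))
      (hc.map (σ := (coi σ).comp f) _ (fun h a => cst_eqv σ (f h) a))
      (fun x => (dd_comp (cst Q M).toAddMonoidHom c x).trans (by rw [hd]; exact map_zero _))
    obtain ⟨c0, cj, e, hc0, hdc0, hcj, hdcj, he, hsum⟩ := ih (coq σ) (fun x => cpi Q M (b x))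
      (hb.map (σ := (coq σ).comp f) _ (fun h a => cpi_eqv σ (f h) a)) (dd_cpi hdb)
    obtain ⟨c0', hc0', hπ0⟩ := lift_eqv (cpi Q M) cpi_surj (cpi_eqv σ) (fun q : Q => q)
      (fun h x => rfl) hc0
    have hl := fun j => lift_eqv (cpi Q M) cpi_surj (cpi_eqv σ) (fun q : Q => q)
      (fun h x => rfl) (hcj j)
    choose cj' hcj' hπj using hl
    obtain ⟨e', he', hπe⟩ := lift_eqv (σ := (coi σ).comp f) (cpi Q M) cpi_surj
      (fun h a => cpi_eqv σ (f h) a) (fun q : P => q)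
      (fun h x => rfl) he
    have dpi : ∀ {X : Type} {m : ℕ} (g : (Fin m → X) → (Q → M)) x,
        dd (fun y => cpi Q M (g y)) x = cpi Q M (dd g x) :=
      fun g x => dd_comp (cpi Q M).toAddMonoidHom g x
    have dcst : ∀ {X : Type} {m : ℕ} (g : (Fin m → X) → M) x,
        dd (fun y => cst Q M (g y)) x = cst Q M (dd g x) :=
      fun g x => dd_comp (cst Q M).toAddMonoidHom g x
    obtain ⟨d0, hd0, hd0'⟩ := descend σ hc0'.dd (fun x => by
      rw [← dpi, funext hπ0]; exact hdc0 x)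
    have hl := fun j => descend σ (hcj' j).dd (fun x => by
      rw [← dpi, funext (hπj j)]; exact hdcj j x)
    choose dj hdj hdj' using hl
    -- the modified b
    set b' : (Fin (n + 2) → P) → (Q → M) := fun x => c0' (fun k => f (x k)) +
        ∑ j, cupf (UU (u j)) (fun y => cj' j (fun k => f (y k))) x + dd e' x with hb'
    have hb'e : Eqv ((coi σ).comp f) b' := by
      refine ((pull _ _ _ hc0').add (Eqv.sum fun j _ => ?_)).add he'.dd
      exact (pull _ _ _ (hcj' j)).cupf (UU_inv (hu j))
    have hbb : ∀ x, cpi Q M (b' x) = cpi Q M (b x) := by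
      intro x
      have h1 : cpi Q M (b x) = _ := hsum x
      rw [h1]
      simp only [hb', map_add, map_sum, cupf, map_smul, hπ0, hπj]
      congr 1
      rw [← dpi, funext hπe]
    have hex : ∀ x, ∃ a, cst Q M a = b x - b' x := fun x => by
      have : cpi Q M (b x - b' x) = 0 := by rw [map_sub, hbb, sub_self]
      rwa [Submodule.mkQ_apply, Submodule.Quotient.mk_eq_zero] at this
    choose a ha using hex
    have hae : Eqv (σ.comp f) a := by
      intro h x
      apply cst_inj (H := Q)
      rw [ha, hb, hb'e, ← map_sub, ← ha]; rfl
    refine ⟨d0, fun j x => - dj j x, a, hd0, ?_, ?_, ?_, hae, ?_⟩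
    · intro x
      apply cst_inj (H := Q)
      rw [← dcst, funext hd0', dd_dd, map_zero]
    · intro j h x
      simp only [hdj j h x, map_neg]
    · intro j x
      rw [dd_neg, neg_eq_zero]
      apply cst_inj (H := Q)
      rw [← dcst, funext (hdj' j), dd_dd, map_zero]
    · intro x
      apply cst_inj (H := Q)
      have h1 : b = fun x => b' x + cst Q M (a x) := by
        funext x; rw [ha]; abel
      rw [← hdb x, h1, dd_add, dcst, map_add]
      congr 1
      rw [hb']
      rw [dd_add, dd_add, dd_dd, add_zero, dd_sum, map_add]
      congr 1
      · rw [dd_pull, ← hd0']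
      · rw [map_sum]
        refine Finset.sum_congr rfl fun j _ => ?_
        rw [dd_cupf _ (UU_add _)]
        simp only [cupf, map_smul, map_neg, smul_neg]
        rw [dd_pull, ← hdj']

end Ext

end WB
end

section
open CategoryTheory
namespace WB

section Gen
variable (H : Type) {X S : Type} [Group H] [MulAction H X] (U : S → X → X → ℚ)

def prodU {i : ℕ} (s : Fin i → S) (x : Fin (i + 1) → X) : ℚ :=
  ∏ k : Fin i, U (s k) (x k.castSucc) (x k.succ)

theorem prodU_succ {i : ℕ} (s : Fin (i + 1) → S) (x : Fin (i + 2) → X) :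
    prodU U s x = cupf (U (s 0)) (prodU U (Fin.tail s)) x := by
  simp only [prodU, cupf, Fin.prod_univ_succ (n := i), smul_eq_mul]
  rfl

variable (X) in
/-- Invariant coboundaries in degree `i` (zero in degree `0`). -/
def cob (i : ℕ) : Submodule ℚ ((Fin (i + 1) → X) → ℚ) where
  carrier := {c | ∃ e : (Fin i → X) → ℚ, Eqv (1 : Representation ℚ H ℚ) e ∧ (i = 0 → e = 0) ∧
    ∀ x, dd e x = c x}
  add_mem' := by
    rintro a b ⟨e, h1, h2, h3⟩ ⟨e', h1', h2', h3'⟩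
    refine ⟨fun x => e x + e' x, h1.add h1', fun h => ?_, fun x => ?_⟩
    · rw [h2 h, h2' h]; simp; rfl
    · rw [dd_add, h3, h3']; rfl
  zero_mem' := ⟨fun _ => 0, fun h x => by simp, fun h => rfl, fun x => dd_zero_fun x⟩
  smul_mem' := by
    rintro r a ⟨e, h1, h2, h3⟩
    refine ⟨fun x => r • e x, fun h x => ?_, fun h => ?_, fun x => ?_⟩
    · simp only [h1 h x]; rfl
    · rw [h2 h]; simp; rfl
    · exact (dd_comp (DistribSMul.toAddMonoidHom ℚ r) e x).trans
        (congrArg (fun t => r • t) (h3 x))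

/-- products and coboundaries -/
def genM (i : ℕ) : Submodule ℚ ((Fin (i + 1) → X) → ℚ) :=
  Submodule.span ℚ (Set.range (fun s : Fin i → S => prodU U s)) ⊔ cob H X i

theorem genM_cup (s : S) (hU : ∀ s x y z, U s x y + U s y z = U s x z)
    (hUi : ∀ s (h : H) x y, U s (h • x) (h • y) = U s x y) {i : ℕ} {c : (Fin (i + 1) → X) → ℚ}
    (hc : c ∈ genM H U i) : cupf (U s) c ∈ genM H U (i + 1) := by
  let L : ((Fin (i + 1) → X) → ℚ) →ₗ[ℚ] ((Fin (i + 2) → X) → ℚ) :=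
    { toFun := fun c => cupf (U s) c
      map_add' := fun a b => by funext x; simp [cupf, mul_add]
      map_smul' := fun a b => by funext x; simp only [cupf, Pi.smul_apply, RingHom.id_apply, smul_eq_mul]; ring }
  have : genM H U i ≤ (genM H U (i + 1)).comap L := by
    refine sup_le (Submodule.span_le.2 ?_) ?_
    · rintro _ ⟨t, rfl⟩
      refine (le_sup_left : _ ≤ genM H U (i + 1)) (Submodule.subset_span ⟨Fin.cons s t, ?_⟩)
      funext x
      simp only [prodU_succ]
      rfl
    · rintro c ⟨e, h1, h2, h3⟩
      refine (le_sup_right : _ ≤ genM H U (i + 1)) ?_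
      cases i with
      | zero =>
        have : c = 0 := by
          funext x
          rw [← h3, h2 rfl]; exact dd_zero_fun x
        rw [this, map_zero]; exact zero_mem _
      | succ i =>
        rw [← neg_mem_iff]
        refine ⟨cupf (U s) e, h1.cupf (hUi s), fun h => by simp at h, fun x => ?_⟩
        rw [dd_cupf _ (hU s)]
        have : dd e = c := funext h3
        rw [this]; rfl
  exact this hc

theorem genM_pull {H' X' S' : Type} [Group H'] [MulAction H' X'] (U' : S' → X' → X' → ℚ)
    (f : H' →* H) (g : X' → X) (hg : ∀ (h : H') x, g (h • x) = f h • g x) (a : S → S')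
    (hU : ∀ s x y, U' (a s) x y = U s (g x) (g y)) {i : ℕ} {c : (Fin (i + 1) → X) → ℚ}
    (hc : c ∈ genM H U i) : (fun x => c (fun k => g (x k))) ∈ genM H' U' i := by
  have : genM H U i ≤ (genM H' U' i).comap
      (LinearMap.funLeft ℚ ℚ (fun (x : Fin (i + 1) → X') k => g (x k))) := by
    refine sup_le (Submodule.span_le.2 ?_) ?_
    · rintro _ ⟨t, rfl⟩
      refine (le_sup_left : _ ≤ genM H' U' i) (Submodule.subset_span ⟨fun k => a (t k), ?_⟩)
      funext x
      simp only [prodU, hU, LinearMap.funLeft_apply]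
    · rintro c ⟨e, h1, h2, h3⟩
      refine (le_sup_right : _ ≤ genM H' U' i) ⟨fun x => e (fun k => g (x k)), ?_, ?_, ?_⟩
      · intro h x
        simp only [hg]
        exact h1 (f h) _
      · intro h; subst h; rw [h2 rfl]; rfl
      · intro x
        rw [dd_pull, h3]; rfl
  exact this hc

theorem genM_zero [Nonempty X] {c : (Fin 1 → X) → ℚ} (hd : ∀ x, dd c x = 0) : c ∈ genM H U 0 := by
  obtain ⟨p⟩ := ‹Nonempty X›
  refine (le_sup_left : _ ≤ genM H U 0) ?_
  have : c = c ![p] • prodU U (fun k : Fin 0 => k.elim0) := by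
    funext x
    have := hd ![p, x 0]
    rw [dd_one, sub_eq_zero, ← eta1 x] at this
    simp [this, prodU]
  rw [this]
  exact Submodule.smul_mem _ _ (Submodule.subset_span ⟨_, rfl⟩)

end Gen

/-- Every invariant rational cocycle on the pure group is generated by products of degree one. -/
theorem pure_gen (n : ℕ) : ∀ (i : ℕ) (c : (Fin (i + 1) → PG n) → ℚ),
    Eqv (1 : Representation ℚ (PG n) ℚ) c → (∀ x, dd c x = 0) →
    c ∈ genM (PG n) (fun s => UU (uP n s)) i := by
  induction n with
  | zero =>
    intro i c hc hd
    cases i with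
    | zero => exact genM_zero _ _ hd
    | succ i =>
      refine (le_sup_right : _ ≤ genM (PG 0) _ (i + 1))
        ⟨fun x => c (Fin.cons 1 x), ?_, fun h => by simp at h, fun x => ?_⟩
      · intro h x
        rw [Subsingleton.elim h 1]; simp
      · rw [dd_cone, hd, sub_zero]
  | succ n ih =>
    intro i c hc hd
    cases i with
    | zero => exact genM_zero _ _ hd
    | succ i =>
      obtain ⟨γ, e, h1, h2, h3, h4⟩ := fibre_data n
      obtain ⟨c0, cj, e', hc0, hdc0, hcj, hdcj, he', hsum⟩ :=
        ext_gen (phiP n) (phiP_surj n) γ h1 h2 h3 (fun j => uP (n + 1) (e j))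
          (fun j g h => uP_mul _ _ _ _) (fun j k => h4 j k) i 1 c (fun h x => hc h x) hd
      have hpull : ∀ {m : ℕ} {c : (Fin (m + 1) → PG n) → ℚ},
          c ∈ genM (PG n) (fun s => UU (uP n s)) m →
          (fun x : Fin (m + 1) → PG (n + 1) => c (fun k => phiP n (x k))) ∈
            genM (PG (n + 1)) (fun s => UU (uP (n + 1) s)) m := by
        intro m c hc
        refine genM_pull (PG n) _ _ (phiP n) (phiP n) (fun h x => map_mul _ _ _) ssCS ?_ hc
        intro s x y
        simp only [UU, uP_phiP]
      have : c = (fun x => c0 (fun k => phiP n (x k))) +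
          ∑ j, cupf (UU (uP (n + 1) (e j))) (fun y => cj j (fun k => phiP n (y k))) +
          fun x => dd e' x := by
        funext x
        rw [hsum x]; simp
      rw [this]
      refine add_mem (add_mem (hpull (ih _ _ hc0 hdc0)) (sum_mem fun j _ => ?_)) ?_
      · exact genM_cup (PG (n + 1)) (fun s => UU (uP (n + 1) s)) (e j) (fun s => UU_add _)
          (fun s => UU_inv (uP_mul _ s)) (hpull (ih _ _ (hcj j) (hdcj j)))
      · exact (le_sup_right : _ ≤ genM (PG (n + 1)) _ (i + 1)) ⟨e', fun h x => he' h x,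
          fun h => by simp at h, fun x => rfl⟩

end WB
end

section
open CategoryTheory
namespace WB

theorem dd_prodU {X S : Type} (U : S → X → X → ℚ)
    (hU : ∀ s x y z, U s x y + U s y z = U s x z) : ∀ {i : ℕ} (s : Fin i → S)
    (x : Fin (i + 2) → X), dd (prodU U s) x = 0
  | 0, s, x => by
      have h : (prodU U s : (Fin 1 → X) → ℚ) = fun _ => 1 := by funext y; simp [prodU]
      rw [h, dd_succ, dd_zero]; simp
  | i + 1, s, x => by
      have h : (prodU U s : (Fin (i + 2) → X) → ℚ) = cupf (U (s 0)) (prodU U (Fin.tail s)) := by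
        funext y; exact prodU_succ U s y
      rw [h, dd_cupf _ (hU _)]
      simp [cupf, dd_prodU U hU]

/-- linear combination of products -/
def lcU {X S : Type} [Fintype S] (U : S → X → X → ℚ) {i : ℕ} {A : Type} [AddCommGroup A]
    [Module ℚ A] (a : (Fin i → S) → A) (x : Fin (i + 1) → X) : A :=
  ∑ s, prodU U s x • a s

theorem dd_lcU {X S : Type} [Fintype S] (U : S → X → X → ℚ)
    (hU : ∀ s x y z, U s x y + U s y z = U s x z) {i : ℕ} {A : Type} [AddCommGroup A]
    [Module ℚ A] (a : (Fin i → S) → A) (x : Fin (i + 2) → X) : dd (lcU U a) x = 0 := by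
  unfold lcU
  rw [dd_sum]
  refine Finset.sum_eq_zero fun s _ => ?_
  have := dd_comp (LinearMap.toSpanSingleton ℚ A (a s)).toAddMonoidHom (prodU U s) x
  rw [dd_prodU U hU, map_zero] at this
  exact this

structure TD (G P W S : Type) [Group G] [Group P] [Group W] [MulAction W S] where
  π : G →* W
  ι : P →* G
  surj : Function.Surjective π
  inj : Function.Injective ι
  ker : π.ker = ι.range
  u : S → G → ℚ
  u_mul : ∀ s g h, u s (g * h) = u s g + u ((π g)⁻¹ • s) h
  gen : ∀ (i : ℕ) (c : (Fin (i + 1) → P) → ℚ),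
    Eqv (1 : Representation ℚ P ℚ) c → (∀ x, dd c x = 0) →
    c ∈ genM P (fun s => UU (fun p => u s (ι p))) i

namespace TD
variable {G P W S : Type} [Group G] [Group P] [Group W] [MulAction W S] (T : TD G P W S)

def UG (s : S) (x y : G) : ℚ := UU (T.u s) x y
def UP (s : S) (x y : P) : ℚ := UU (fun p => T.u s (T.ι p)) x y

theorem UG_add (s : S) (x y z) : T.UG s x y + T.UG s y z = T.UG s x z := UU_add _ _ _ _
theorem UP_add (s : S) (x y z) : T.UP s x y + T.UP s y z = T.UP s x z := UU_add _ _ _ _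

theorem UG_mul (s : S) (k x y : G) : T.UG s (k * x) (k * y) = T.UG ((T.π k)⁻¹ • s) x y := by
  simp only [UG, UU, T.u_mul]; ring

theorem pi_iota (p : P) : T.π (T.ι p) = 1 := by
  rw [← MonoidHom.mem_ker, T.ker]; exact ⟨p, rfl⟩

/-- `P` acts on `G` through `ι`. -/
@[reducible] def act : MulAction P G := MulAction.compHom G T.ι

theorem exists_r : ∃ r : G → P, ∀ p g, r (T.ι p * g) = p * r g := by
  classical
  let q : G → G ⧸ T.ι.range := fun g => (QuotientGroup.mk g⁻¹)
  have hq : ∀ g, ∃ p, T.ι p = g * (q g).out := by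
    intro g
    have : (QuotientGroup.mk (q g).out : G ⧸ T.ι.range) = QuotientGroup.mk g⁻¹ :=
      Quotient.out_eq' _
    rw [eq_comm, QuotientGroup.eq, inv_inv] at this
    exact this
  choose r hr using hq
  refine ⟨r, fun p g => T.inj ?_⟩
  have : q (T.ι p * g) = q g := by
    simp only [q, mul_inv_rev]
    rw [eq_comm, QuotientGroup.eq]
    simp
  rw [map_mul, hr, hr, this, mul_assoc]

theorem prodU_mul {i : ℕ} (s : Fin i → S) (k : G) (x : Fin (i + 1) → G) :
    prodU T.UG s (fun j => k * x j) = prodU T.UG (fun j => (T.π k)⁻¹ • s j) x := by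
  simp only [prodU, T.UG_mul]

theorem prodU_mul' {i : ℕ} (s : Fin i → S) (k : G) (x : Fin (i + 1) → G) :
    prodU T.UG (fun j => (T.π k) • s j) (fun j => k * x j) = prodU T.UG s x := by
  rw [prodU_mul]; simp

theorem prodU_iota {i : ℕ} (s : Fin i → S) (x : Fin (i + 1) → P) :
    prodU T.UG s (fun k => T.ι (x k)) = prodU T.UP s x := rfl

/-- Coboundaries of `P`-invariant cochains on `G`. -/
def cobG (i : ℕ) : Submodule ℚ ((Fin (i + 1) → G) → ℚ) :=
  letI := T.act
  cob P G i

theorem cobG_translate {i : ℕ} {c : (Fin (i + 1) → G) → ℚ} (hc : c ∈ T.cobG i) (k : G) :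
    (fun x => c (fun j => k * x j)) ∈ T.cobG i := by
  letI := T.act
  obtain ⟨e, h1, h2, h3⟩ := hc
  refine ⟨fun x => e (fun j => k * x j), fun p x => ?_, fun h => ?_, fun x => ?_⟩
  · obtain ⟨p', hp'⟩ : k * T.ι p * k⁻¹ ∈ T.ι.range := by
      rw [← T.ker, MonoidHom.mem_ker]; simp [pi_iota]
    have := h1 p' (fun j => k * x j)
    refine Eq.trans (congrArg e ?_) this
    funext j
    show k * (T.ι p * x j) = T.ι p' * (k * x j)
    rw [hp']; group
  · rw [h2 h]; rfl
  · exact (dd_pull _ _ _).trans (h3 _)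

theorem cob_restrict {i : ℕ} {c : (Fin (i + 1) → G) → ℚ} (hc : c ∈ T.cobG i) :
    (fun x => c (fun j => T.ι (x j))) ∈ cob P P i := by
  letI := T.act
  obtain ⟨e, h1, h2, h3⟩ := hc
  refine ⟨fun x => e (fun j => T.ι (x j)), fun p x => ?_, fun h => ?_, fun x => ?_⟩
  · refine Eq.trans (congrArg e ?_) (h1 p _)
    funext j
    exact map_mul _ _ _
  · rw [h2 h]; rfl
  · exact (dd_pull _ _ _).trans (h3 _)

theorem cob_of_restrict {i : ℕ} {c : (Fin (i + 1) → G) → ℚ}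
    (hinv : ∀ (p : P) x, c (fun j => T.ι p * x j) = c x) (hd : ∀ x, dd c x = 0)
    (hc : (fun x => c (fun j => T.ι (x j))) ∈ cob P P i) : c ∈ T.cobG i := by
  letI := T.act
  obtain ⟨e, h1, h2, h3⟩ := hc
  cases i with
  | zero =>
    have : c = 0 := by
      funext x
      have h := hd ![1, x 0]
      rw [dd_one, sub_eq_zero, ← eta1 x] at h
      have h4 := h3 ![1]
      rw [h2 rfl] at h4
      have h5 : dd (0 : (Fin 0 → P) → ℚ) ![1] = 0 := dd_zero_fun _
      rw [h5] at h4
      rw [h]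
      refine Eq.trans (congrArg c ?_) h4.symm
      funext j; fin_cases j; simp
    rw [this]; exact zero_mem _
  | succ i =>
    obtain ⟨r, hr⟩ := T.exists_r
    obtain ⟨e', h1', h3'⟩ := restrict_cob (H := P) (X := G) (X' := P) T.ι
      (fun h x => map_mul _ _ _) r hr r hr 1 i (1 : Representation ℚ P ℚ) c
      (fun p x => hinv p x) hd ⟨e, h1, h3⟩
    exact ⟨e', h1', fun h => by simp at h, h3'⟩

variable [Fintype S]

theorem lcU_inv {A : Type} [AddCommGroup A] [Module ℚ A] {i : ℕ} (b : (Fin i → S) → A) (p : P) (x) :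
    lcU T.UG b (fun j => T.ι p * x j) = lcU T.UG b x := by
  simp only [lcU, prodU_mul, pi_iota]; simp

theorem lcU_smul {A : Type} [AddCommGroup A] [Module ℚ A] {i : ℕ} (b : (Fin i → S) → A) (k : G)
    (x) : lcU T.UG b (fun j => k * x j) = lcU T.UG (fun s => b (fun j => T.π k • s j)) x := by
  simp only [lcU]
  refine (Fintype.sum_equiv (Equiv.arrowCongr (Equiv.refl _) (MulAction.toPerm (T.π k))) _ _
    fun s => ?_).symm
  have : (Equiv.arrowCongr (Equiv.refl (Fin i)) (MulAction.toPerm (T.π k))) s =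
    fun j => T.π k • s j := rfl
  rw [this, prodU_mul']

/-- relations among the products on `P`. -/
def J (i : ℕ) : Submodule ℚ ((Fin i → S) → ℚ) :=
  (cob P P i).comap (σ₁₂ := RingHom.id ℚ)
    { toFun := fun b => lcU T.UP b
      map_add' := fun a b => by funext x; simp [lcU, mul_add, Finset.sum_add_distrib]
      map_smul' := fun a b => by
        funext x; simp only [lcU, Pi.smul_apply, RingHom.id_apply, smul_eq_mul, Finset.mul_sum]
        refine Finset.sum_congr rfl fun _ _ => by ring }

theorem mem_J {i : ℕ} {b : (Fin i → S) → ℚ} : b ∈ T.J i ↔ lcU T.UP b ∈ cob P P i := Iff.rfl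

theorem mem_J' {i : ℕ} {b : (Fin i → S) → ℚ} : b ∈ T.J i ↔ lcU T.UG b ∈ T.cobG i := by
  rw [mem_J]
  constructor
  · intro h
    exact T.cob_of_restrict (T.lcU_inv b) (dd_lcU _ T.UG_add b) h
  · intro h
    exact T.cob_restrict h

theorem J_smul {i : ℕ} {b : (Fin i → S) → ℚ} (h : b ∈ T.J i) (w : W) :
    (fun s => b (fun j => w • s j)) ∈ T.J i := by
  obtain ⟨k, rfl⟩ := T.surj w
  rw [mem_J'] at h ⊢
  convert T.cobG_translate h k using 1
  funext x
  rw [lcU_smul]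

theorem orth_decomp {α : Type} [Fintype α] (J : Submodule ℚ (α → ℚ)) (b : α → ℚ) :
    ∃ b' , b - b' ∈ J ∧ ∀ y ∈ J, ∑ s, b' s * y s = 0 := by
  classical
  let B : LinearMap.BilinForm ℚ (α → ℚ) := dotProductBilin ℚ ℚ
  have hB : ∀ x y, B x y = ∑ s, x s * y s := fun x y => rfl
  have hr : B.IsRefl := by
    intro x y h; rw [hB] at h ⊢; rw [← h]; exact Finset.sum_congr rfl fun _ _ => mul_comm _ _
  have hc : IsCompl J (B.orthogonal J) := by
    rw [LinearMap.BilinForm.isCompl_orthogonal_iff_disjoint hr, Submodule.disjoint_def]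
    intro x hx hx'
    have := hx' x hx
    rw [hB] at this
    rw [Finset.sum_eq_zero_iff_of_nonneg (fun s _ => mul_self_nonneg _)] at this
    funext s
    simpa using this s (Finset.mem_univ _)
  obtain ⟨y, hy, z, hz, h⟩ := Submodule.mem_sup.1 (hc.sup_eq_top.ge (Submodule.mem_top (x := b)))
  refine ⟨z, by rw [← h]; simpa using hy, fun y' hy' => ?_⟩
  have := hz y' hy'
  rw [hB] at this
  rw [← this]; exact Finset.sum_congr rfl fun _ _ => mul_comm _ _

theorem scalar_gen {i : ℕ} {c : (Fin (i + 1) → G) → ℚ}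
    (hinv : ∀ (p : P) x, c (fun j => T.ι p * x j) = c x) (hd : ∀ x, dd c x = 0) :
    ∃ b : (Fin i → S) → ℚ, (∀ y ∈ T.J i, ∑ s, b s * y s = 0) ∧
      (fun x => c x - lcU T.UG b x) ∈ T.cobG i := by
  have h := T.gen i (fun x => c (fun j => T.ι (x j)))
    (fun p x => by
      have := hinv p (fun j => T.ι (x j))
      simp only [smul_eq_mul, map_mul]
      exact this)
    (fun x => by rw [dd_pull]; exact hd _)
  obtain ⟨y, hy, z, hz, h⟩ := Submodule.mem_sup.1 h
  obtain ⟨b, hb⟩ := (Submodule.mem_span_range_iff_exists_fun ℚ).1 hy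
  obtain ⟨b', h1, h2⟩ := orth_decomp (T.J i) b
  refine ⟨b', h2, ?_⟩
  have h3 : (fun x => c x - lcU T.UG b x) ∈ T.cobG i := by
    refine T.cob_of_restrict (fun p x => by rw [hinv, lcU_inv]) (fun x => ?_) ?_
    · rw [dd_sub, hd, dd_lcU _ T.UG_add, sub_zero]
    · convert hz using 1
      funext x
      have h5 := congrFun h x
      simp only [Pi.add_apply] at h5
      rw [← h5, ← hb]
      simp only [lcU, prodU_iota, smul_eq_mul, Finset.sum_apply, Pi.smul_apply]
      rw [add_sub_right_comm, add_eq_right, sub_eq_zero]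
      exact Finset.sum_congr rfl fun _ _ => mul_comm _ _
  convert add_mem h3 (T.mem_J'.1 h1) using 1
  funext x
  simp [lcU, mul_sub, Finset.sum_sub_distrib]

end TD
end WB
end

section
open CategoryTheory
namespace WB
namespace TD
variable {G P W S : Type} [Group G] [Group P] [Group W] [MulAction W S] (T : TD G P W S)
  [Fintype S]
variable {V : Type} [AddCommGroup V] [Module ℚ V] (σ : Representation ℚ W V)

/-- The space of invariant coefficient systems orthogonal to the relations. -/
def D (i : ℕ) : Submodule ℚ ((Fin i → S) → (V →ₗ[ℚ] ℚ)) where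
  carrier := {a | (∀ (w : W) s v, a (fun j => w • s j) (σ w v) = a s v) ∧
    ∀ v, ∀ y ∈ T.J i, ∑ s, a s v * y s = 0}
  add_mem' := by
    rintro a b ⟨h1, h2⟩ ⟨h3, h4⟩
    refine ⟨fun w s v => by simp [h1, h3], fun v y hy => ?_⟩
    have := h2 v y hy
    have := h4 v y hy
    simp only [Pi.add_apply, LinearMap.add_apply, add_mul, Finset.sum_add_distrib, *, add_zero]
  zero_mem' := ⟨fun w s v => by simp, fun v y hy => by simp⟩
  smul_mem' := by
    rintro r a ⟨h1, h2⟩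
    refine ⟨fun w s v => by simp [h1], fun v y hy => ?_⟩
    have := h2 v y hy
    simp only [Pi.smul_apply, LinearMap.smul_apply, smul_eq_mul, mul_assoc, ← Finset.mul_sum, this,
      mul_zero]

/-- dual representation of `G`. -/
def rhoD : Representation ℚ G (V →ₗ[ℚ] ℚ) where
  toFun g := (σ (T.π g)⁻¹).dualMap
  map_one' := by ext f v; simp
  map_mul' g h := by ext f v; simp

theorem rhoD_apply (g : G) (f : V →ₗ[ℚ] ℚ) (v : V) : T.rhoD σ g f v = f (σ (T.π g)⁻¹ v) := rfl

theorem eqv_iff {m : ℕ} {c : (Fin m → G) → (V →ₗ[ℚ] ℚ)} :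
    Eqv (T.rhoD σ) c ↔ ∀ (g : G) x v, c (fun k => g * x k) (σ (T.π g) v) = c x v := by
  constructor
  · intro h g x v
    have := h g x
    simp only [smul_eq_mul] at this
    rw [this, rhoD_apply, ← Module.End.mul_apply, ← map_mul]; simp
  · intro h g x
    ext v
    have := h g x (σ (T.π g)⁻¹ v)
    rw [← Module.End.mul_apply, ← map_mul, mul_inv_cancel] at this
    rw [rhoD_apply, ← this]; simp

theorem theta_eqv {i : ℕ} {a : (Fin i → S) → (V →ₗ[ℚ] ℚ)} (ha : a ∈ T.D σ i) :
    Eqv (T.rhoD σ) (lcU T.UG a) := by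
  rw [eqv_iff]
  intro g x v
  rw [lcU_smul]
  simp [lcU, ha.1]

omit [Fintype S] in
theorem dd_apply {X : Type} {m : ℕ} (e : (Fin m → X) → (V →ₗ[ℚ] ℚ)) (x) (v : V) :
    dd e x v = dd (fun y => e y v) x :=
  (dd_comp (LinearMap.applyₗ (R := ℚ) (M₂ := ℚ) v).toAddMonoidHom e x).symm

theorem theta_inj {i : ℕ} {a : (Fin i → S) → (V →ₗ[ℚ] ℚ)} (ha : a ∈ T.D σ i)
    {e : (Fin i → G) → (V →ₗ[ℚ] ℚ)} (he : Eqv (T.rhoD σ) e) (he0 : i = 0 → e = 0)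
    (h : ∀ x, lcU T.UG a x = dd e x) : a = 0 := by
  have key : ∀ v, (fun s => a s v) ∈ T.J i := by
    intro v
    rw [mem_J']
    refine ⟨fun x => e x v, fun p x => ?_, fun h => ?_, fun x => ?_⟩
    · have := (T.eqv_iff σ).1 he (T.ι p) x v
      rw [pi_iota, map_one] at this
      exact this
    · rw [he0 h]; rfl
    · rw [← dd_apply, ← h]; simp [lcU]
  funext s
  ext v
  have := ha.2 v _ (key v)
  rw [Finset.sum_eq_zero_iff_of_nonneg (fun s _ => mul_self_nonneg _)] at this
  simpa using this s (Finset.mem_univ _)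

theorem theta_gen [Fintype W] [FiniteDimensional ℚ V] {i : ℕ}
    {c : (Fin (i + 1) → G) → (V →ₗ[ℚ] ℚ)} (hc : Eqv (T.rhoD σ) c) (hd : ∀ x, dd c x = 0) :
    ∃ a ∈ T.D σ i, ∃ e : (Fin i → G) → (V →ₗ[ℚ] ℚ), Eqv (T.rhoD σ) e ∧ (i = 0 → e = 0) ∧
      ∀ x, c x = lcU T.UG a x + dd e x := by
  classical
  let β := Module.finBasis ℚ V
  have hc' := (T.eqv_iff σ).1 hc
  have step : ∀ v, ∃ b : (Fin i → S) → ℚ, (∀ y ∈ T.J i, ∑ s, b s * y s = 0) ∧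
      (fun x => c x v - lcU T.UG b x) ∈ T.cobG i := by
    intro v
    refine T.scalar_gen (fun p x => ?_) (fun x => ?_)
    · have := hc' (T.ι p) x v
      rw [pi_iota] at this
      simpa using this
    · rw [← dd_apply, hd]; rfl
  choose b hb1 hb2 using fun j => step (β j)
  choose e he1 he2 he3 using hb2
  -- assemble
  let a0 : (Fin i → S) → (V →ₗ[ℚ] ℚ) := fun s => ∑ j, b j s • β.coord j
  let e0 : (Fin i → G) → (V →ₗ[ℚ] ℚ) := fun x => ∑ j, e j x • β.coord j
  have ha0 : ∀ v, ∀ y ∈ T.J i, ∑ s, a0 s v * y s = 0 := by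
    intro v y hy
    have : ∀ s, a0 s v * y s = ∑ j, (β.coord j v) * (b j s * y s) := by
      intro s
      simp only [a0, LinearMap.sum_apply, LinearMap.smul_apply, smul_eq_mul, Finset.sum_mul]
      exact Finset.sum_congr rfl fun _ _ => by ring
    simp only [this]
    rw [Finset.sum_comm]
    refine Finset.sum_eq_zero fun j _ => ?_
    rw [← Finset.mul_sum, hb1 j y hy, mul_zero]
  have he0 : ∀ (p : P) x, e0 (fun k => T.ι p * x k) = e0 x := by
    intro p x
    exact Finset.sum_congr rfl fun j _ => congrArg (· • _) (he1 j p x)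
  have hce : ∀ x, c x = lcU T.UG a0 x + dd e0 x := by
    intro x
    refine β.ext fun j => ?_
    rw [LinearMap.add_apply, dd_apply]
    have h1 : (fun y => e0 y (β j)) = e j := by
      funext y; simp [e0, Finsupp.single_apply]
    have h2 : lcU T.UG a0 x (β j) = lcU T.UG (b j) x := by
      simp [lcU, a0, Finsupp.single_apply]
    rw [h1, h2, he3]
    ring
  -- average
  choose τ hτ using T.surj
  let N : ℚ := Fintype.card W
  have hN : N ≠ 0 := by simp [N]
  have he0' : ∀ g h : G, T.π g = T.π h → ∀ x : Fin i → G, e0 (fun k => g * x k) = e0 (fun k => h * x k) := by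
    intro g h hgh x
    obtain ⟨p, hp⟩ : g * h⁻¹ ∈ T.ι.range := by
      rw [← T.ker, MonoidHom.mem_ker]; simp [hgh]
    rw [← he0 p (fun k => h * x k)]
    congr 1
    funext k
    rw [hp]; group
  refine ⟨fun s => N⁻¹ • ∑ w, (σ w).dualMap (a0 (fun j => w • s j)), ⟨fun w s v => ?_, fun v y hy => ?_⟩,
    fun x => N⁻¹ • ∑ w, (σ w).dualMap (e0 (fun j => τ w * x j)), ?_, ?_, ?_⟩
  · simp only [LinearMap.smul_apply, LinearMap.sum_apply, LinearMap.dualMap_apply]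
    congr 1
    refine Fintype.sum_equiv (Equiv.mulRight w) _ _ fun w' => ?_
    simp [mul_smul]
  · simp only [LinearMap.smul_apply, LinearMap.sum_apply, LinearMap.dualMap_apply, smul_eq_mul,
      mul_assoc, ← Finset.mul_sum, Finset.sum_mul]
    rw [Finset.sum_comm]
    simp only [Finset.mul_sum]
    rw [Finset.sum_eq_zero]
    · intro w _
      rw [← Finset.mul_sum]
      have h1 := ha0 (σ w v) _ (T.J_smul hy w⁻¹)
      rw [← Fintype.sum_equiv (Equiv.arrowCongr (Equiv.refl _) (MulAction.toPerm w))
        (fun s => a0 (fun j => w • s j) (σ w v) * y s) _ ?_] at h1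
      · rw [h1, mul_zero]
      · intro s
        have : (Equiv.arrowCongr (Equiv.refl (Fin i)) (MulAction.toPerm w)) s =
          fun j => w • s j := rfl
        rw [this]; simp
  · rw [eqv_iff]
    intro g x v
    simp only [LinearMap.smul_apply, LinearMap.sum_apply, LinearMap.dualMap_apply]
    congr 1
    refine Fintype.sum_equiv (Equiv.mulRight (T.π g)) _ _ fun w' => ?_
    simp only [← mul_assoc, Equiv.coe_mulRight, map_mul, Module.End.mul_apply]
    rw [he0' (τ w' * g) (τ (w' * T.π g))]
    simp [hτ]
  · intro h
    have : e0 = 0 := by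
      funext x
      refine Finset.sum_eq_zero fun j _ => ?_
      rw [he2 j h]; simp
    funext x
    simp [this]
  · intro x
    have h0 : c x = N⁻¹ • ∑ w, (σ w).dualMap (c (fun j => τ w * x j)) := by
      ext v
      simp only [LinearMap.smul_apply, LinearMap.sum_apply, LinearMap.dualMap_apply]
      have : ∀ w, c (fun j => τ w * x j) (σ w v) = c x v := by
        intro w
        have := hc' (τ w) x v
        rwa [hτ] at this
      simp only [this, Finset.sum_const, Finset.card_univ, nsmul_eq_mul, smul_eq_mul]
      rw [← mul_assoc, inv_mul_cancel₀ hN, one_mul]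
    have h1 : dd (fun x => N⁻¹ • ∑ w, (σ w).dualMap (e0 (fun j => τ w * x j))) x =
        N⁻¹ • ∑ w, (σ w).dualMap (dd e0 (fun j => τ w * x j)) := by
      have := dd_comp (DistribSMul.toAddMonoidHom (V →ₗ[ℚ] ℚ) N⁻¹)
        (fun x => ∑ w, (σ w).dualMap (e0 (fun j => τ w * x j))) x
      refine this.trans ?_
      rw [dd_sum, DistribSMul.toAddMonoidHom_apply]
      refine congrArg (N⁻¹ • ·) (Finset.sum_congr rfl fun w _ => ?_)
      refine (dd_comp (σ w).dualMap.toAddMonoidHom (fun y => e0 (fun j => τ w * y j)) x).trans ?_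
      rw [dd_pull]; rfl
    rw [h1, h0]
    have h2 : lcU T.UG (fun s => N⁻¹ • ∑ w, (σ w).dualMap (a0 (fun j => w • s j))) x =
        N⁻¹ • ∑ w, (σ w).dualMap (lcU T.UG a0 (fun j => τ w * x j)) := by
      simp only [lcU_smul, hτ]
      simp only [lcU, Finset.smul_sum, map_sum, map_smul]
      rw [Finset.sum_comm]
      refine Finset.sum_congr rfl fun w _ => Finset.sum_congr rfl fun s _ => smul_comm _ _ _
    rw [h2, ← smul_add, ← Finset.sum_add_distrib]
    simp only [← map_add, ← hce]

end TD
end WB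
end

section
open CategoryTheory
namespace WB
namespace Res
variable {G : Type} [Group G] {V : Type} [AddCommGroup V] [Module ℚ V] (ρ : Representation ℚ G V)

variable (G V) in
abbrev M (m : ℕ) : Type := (Fin m → G) →₀ V

/-- boundary -/
noncomputable def bd (m : ℕ) : M G V (m + 1) →ₗ[ℚ] M G V m :=
  Finsupp.lsum ℚ (fun x => dd (fun y => Finsupp.lsingle (R := ℚ) y) x)

theorem bd_comp_single {m : ℕ} (x : Fin (m + 1) → G) :
    (bd m : M G V (m + 1) →ₗ[ℚ] M G V m) ∘ₗ Finsupp.lsingle x =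
      dd (fun y => Finsupp.lsingle (R := ℚ) y) x := by
  ext1 v; simp [bd]

theorem comp_dd {X A B : Type} [AddCommGroup A] [Module ℚ A] [AddCommGroup B] [Module ℚ B] {m : ℕ}
    (L : A →ₗ[ℚ] B) (c : (Fin m → X) → (V →ₗ[ℚ] A)) (x) :
    L ∘ₗ dd c x = dd (fun y => L ∘ₗ c y) x :=
  (dd_comp (LinearMap.compRight ℚ (M := V) L).toAddMonoidHom c x).symm

theorem dd_comp_right {X A : Type} [AddCommGroup A] [Module ℚ A] {m : ℕ}
    (L : V →ₗ[ℚ] V) (c : (Fin m → X) → (V →ₗ[ℚ] A)) (x) :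
    dd c x ∘ₗ L = dd (fun y => c y ∘ₗ L) x :=
  (dd_comp (LinearMap.lcomp ℚ A L).toAddMonoidHom c x).symm

theorem comp_bd_single {A : Type} [AddCommGroup A] [Module ℚ A] {m : ℕ} (L : M G V m →ₗ[ℚ] A)
    (x : Fin (m + 1) → G) :
    L ∘ₗ bd m ∘ₗ Finsupp.lsingle x = dd (fun y => L ∘ₗ Finsupp.lsingle y) x := by
  rw [bd_comp_single, comp_dd]

theorem bd_bd (m : ℕ) : (bd m : M G V (m + 1) →ₗ[ℚ] M G V m) ∘ₗ bd (m + 1) = 0 := by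
  refine Finsupp.lhom_ext' fun x => ?_
  rw [LinearMap.comp_assoc, comp_bd_single]
  simp only [bd_comp_single]
  rw [LinearMap.zero_comp]
  exact dd_dd _ x

/-- contraction -/
noncomputable def hh (m : ℕ) : M G V m →ₗ[ℚ] M G V (m + 1) :=
  Finsupp.lsum ℚ (fun y => Finsupp.lsingle (R := ℚ) (Fin.cons 1 y : Fin (m + 1) → G))

theorem hh_single {m : ℕ} (y : Fin m → G) : (hh m : M G V m →ₗ[ℚ] _) ∘ₗ Finsupp.lsingle y =
    Finsupp.lsingle (Fin.cons 1 y : Fin (m + 1) → G) := by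
  ext1 v; simp [hh]

theorem bd_hh_zero : (bd 0 : M G V 1 →ₗ[ℚ] _) ∘ₗ hh 0 = LinearMap.id := by
  refine Finsupp.lhom_ext' fun x => ?_
  rw [LinearMap.comp_assoc, hh_single, bd_comp_single, dd_zero]
  rfl

theorem bd_hh (m : ℕ) : (bd (m + 1) : M G V (m + 2) →ₗ[ℚ] _) ∘ₗ hh (m + 1) =
    LinearMap.id - hh m ∘ₗ bd m := by
  refine Finsupp.lhom_ext' fun x => ?_
  rw [LinearMap.comp_assoc, hh_single, bd_comp_single, dd_cons, LinearMap.sub_comp,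
    LinearMap.comp_assoc, comp_bd_single]
  simp only [hh_single]
  rfl

theorem bd_hh_ker (m : ℕ) (x : M G V (m + 1)) (hx : bd m x = 0) :
    bd (m + 1) (hh (m + 1) x) = x := by
  have := LinearMap.congr_fun (bd_hh (G := G) (V := V) m) x
  simp only [LinearMap.comp_apply, LinearMap.sub_apply, hx, map_zero, sub_zero] at this
  exact this

/-- action -/
noncomputable def rM (m : ℕ) : Representation ℚ G (M G V m) where
  toFun g := Finsupp.lsum ℚ (fun x => Finsupp.lsingle (R := ℚ) (fun k => g * x k) ∘ₗ ρ g)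
  map_one' := by
    refine Finsupp.lhom_ext' fun x => ?_
    ext1 v; simp
  map_mul' g h := by
    refine Finsupp.lhom_ext' fun x => ?_
    ext1 v; simp [mul_assoc]

theorem rM_single {m : ℕ} (g : G) (x : Fin m → G) (v : V) :
    rM ρ m g (Finsupp.single x v) = Finsupp.single (fun k => g * x k) (ρ g v) := by
  simp [rM]

theorem rM_comp {m : ℕ} (g : G) (x : Fin m → G) :
    rM ρ m g ∘ₗ Finsupp.lsingle x = Finsupp.lsingle (fun k => g * x k) ∘ₗ ρ g := by
  ext1 v; simp [rM]

theorem bd_eqv (m : ℕ) (g : G) : bd m ∘ₗ rM ρ (m + 1) g = rM ρ m g ∘ₗ bd m := by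
  refine Finsupp.lhom_ext' fun x => ?_
  rw [LinearMap.comp_assoc, LinearMap.comp_assoc, comp_bd_single, rM_comp, ← LinearMap.comp_assoc,
    bd_comp_single]
  simp only [rM_comp]
  rw [← dd_pull (fun y => g * y), dd_comp_right]

noncomputable def bdI (m : ℕ) : (rM ρ (m + 1)).IntertwiningMap (rM ρ m) :=
  { bd m with isIntertwining' := bd_eqv ρ m }

noncomputable def RM (m : ℕ) : Rep.{0} ℚ G := Rep.of (rM ρ m)

noncomputable def bdR (m : ℕ) : RM ρ (m + 1) ⟶ RM ρ m := Rep.ofHom (bdI ρ m)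

theorem bdR_apply (m : ℕ) (x : M G V (m + 1)) : (bdR ρ m).hom x = bd m x := rfl

theorem bdR_comp (m : ℕ) : bdR ρ (m + 1) ≫ bdR ρ m = 0 := by
  ext x
  exact LinearMap.congr_fun (bd_bd m) x

noncomputable def SC (m : ℕ) : ShortComplex (Rep.{0} ℚ G) :=
  ShortComplex.mk (bdR ρ (m + 1)) (bdR ρ m) (bdR_comp ρ m)

theorem SC_exact (m : ℕ) : (SC ρ m).Exact := by
  rw [← ShortComplex.exact_map_iff_of_faithful _ (forget₂ (Rep.{0} ℚ G) (ModuleCat ℚ)),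
    ShortComplex.moduleCat_exact_iff]
  intro x hx
  have hx' : bd m (x : M G V (m + 1)) = 0 := hx
  exact ⟨hh (m + 1) x, bd_hh_ker m x hx'⟩

theorem epi0 : Epi (bdR ρ 0) := by
  rw [Rep.epi_iff_surjective]
  intro x
  exact ⟨hh 0 x, LinearMap.congr_fun (bd_hh_zero (G := G) (V := V)) x⟩

instance projRM (m : ℕ) : Projective (RM ρ (m + 1)) where
  factors {E X} f e he := by
    rw [Rep.epi_iff_surjective] at he
    obtain ⟨s, hs⟩ := LinearMap.exists_rightInverse_of_surjective e.hom.toLinearMap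
      (LinearMap.range_eq_top.2 he)
    have hs' : ∀ y, e.hom (s y) = y := LinearMap.congr_fun hs
    let fl : M G V (m + 1) →ₗ[ℚ] X := f.hom.toLinearMap
    have hf : ∀ g y, fl (rM ρ (m + 1) g y) = X.ρ g (fl y) := fun g y => Rep.hom_comm_apply f g y
    let L : M G V (m + 1) →ₗ[ℚ] E := Finsupp.lsum ℚ (fun x => E.ρ (x 0) ∘ₗ s ∘ₗ fl ∘ₗ
      Finsupp.lsingle (fun k => (x 0)⁻¹ * x k) ∘ₗ ρ (x 0)⁻¹)
    have hL : ∀ x v, L (Finsupp.single x v) = E.ρ (x 0) (s (fl (Finsupp.single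
      (fun k => (x 0)⁻¹ * x k) (ρ (x 0)⁻¹ v)))) := by intro x v; simp [L]
    refine ⟨Rep.ofHom (ρ := rM ρ (m + 1)) (σ := E.ρ) { L with
      isIntertwining' := fun g => ?_ }, ?_⟩
    · refine Finsupp.lhom_ext fun x v => ?_
      show L (rM ρ (m + 1) g (Finsupp.single x v)) = E.ρ g (L (Finsupp.single x v))
      rw [rM_single, hL, hL]
      have h1 : (fun k => (g * x 0)⁻¹ * (g * x k)) = fun k => (x 0)⁻¹ * x k := by
        funext k; group
      have h2 : ρ (g * x 0)⁻¹ (ρ g v) = ρ (x 0)⁻¹ v := by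
        rw [← Module.End.mul_apply, ← map_mul]; congr 2; group
      rw [h1, h2, map_mul, Module.End.mul_apply]
    · apply Rep.hom_ext
      apply Representation.IntertwiningMap.toLinearMap_injective
      refine Finsupp.lhom_ext fun x v => ?_
      show e.hom (L (Finsupp.single x v)) = fl (Finsupp.single x v)
      rw [hL]
      have := Rep.hom_comm_apply e (x 0) (s (fl (Finsupp.single
      (fun k => (x 0)⁻¹ * x k) (ρ (x 0)⁻¹ v))))
      refine this.trans ?_
      rw [hs', ← hf, rM_single]
      congr 2
      · funext k; group
      · rw [← Module.End.mul_apply, ← map_mul]; simp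

noncomputable def CC : ChainComplex (Rep.{0} ℚ G) ℕ :=
  ChainComplex.of (fun m => RM ρ (m + 1)) (fun m => bdR ρ (m + 1)) (fun m => bdR_comp ρ (m + 1))

theorem CC_d (m : ℕ) : (CC ρ).d (m + 1) m = bdR ρ (m + 1) := 
  ChainComplex.of_d (fun m => RM ρ (m + 1)) (fun m => bdR ρ (m + 1)) m

theorem CC_exact (n : ℕ) : (CC ρ).ExactAt (n + 1) := by
  rw [HomologicalComplex.exactAt_iff' _ (n + 1 + 1) (n + 1) n (by simp) (by simp)]
  have : (CC ρ).sc' (n + 1 + 1) (n + 1) n = SC ρ (n + 1) := by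
    unfold HomologicalComplex.sc' HomologicalComplex.shortComplexFunctor' SC
    simp only [CC_d]
    rfl
  rw [this]
  exact SC_exact ρ (n + 1)

noncomputable def PR : ProjectiveResolution (RM ρ 0) where
  complex := CC ρ
  projective n := projRM ρ n
  π := (ChainComplex.toSingle₀Equiv _ _).symm ⟨bdR ρ 0, by
          rw [CC_d]; exact bdR_comp ρ 0⟩
  quasiIso := ⟨fun n => by
    cases n
    · rw [ChainComplex.quasiIsoAt₀_iff, ShortComplex.quasiIso_iff_of_zeros']
      · refine (ShortComplex.exact_and_epi_g_iff_of_iso ?_).2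
          ⟨SC_exact ρ 0, epi0 ρ⟩
        exact ShortComplex.isoMk (Iso.refl _) (Iso.refl _) (Iso.refl _)
          (by simp [CC_d, SC]; rfl) (by simp [SC]; rfl)
      all_goals rfl
    · rw [quasiIsoAt_iff_exactAt']
      · apply CC_exact
      · apply ChainComplex.exactAt_succ_single_obj⟩

end Res
end WB
end

section
open CategoryTheory
namespace WB

theorem lin_dual {A B C D : Type} [AddCommGroup A] [Module ℚ A] [AddCommGroup B] [Module ℚ B]
    [AddCommGroup C] [Module ℚ C] [AddCommGroup D] [Module ℚ D] [FiniteDimensional ℚ D]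
    (f : A →ₗ[ℚ] B) (g : B →ₗ[ℚ] C) (Θ : D →ₗ[ℚ] (B →ₗ[ℚ] ℚ))
    (h1 : ∀ a, Θ a ∘ₗ f = 0)
    (h2 : ∀ φ : B →ₗ[ℚ] ℚ, φ ∘ₗ f = 0 → ∃ a, ∃ ψ : C →ₗ[ℚ] ℚ, φ = Θ a + ψ ∘ₗ g)
    (h3 : ∀ a, ∀ ψ : C →ₗ[ℚ] ℚ, Θ a = ψ ∘ₗ g → a = 0)
    (f' : A →ₗ[ℚ] LinearMap.ker g) (hf' : ∀ x, (f' x : B) = f x) :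
    FiniteDimensional ℚ (LinearMap.ker g ⧸ LinearMap.range f') ∧
      Module.finrank ℚ (LinearMap.ker g ⧸ LinearMap.range f') = Module.finrank ℚ D := by
  let Q := LinearMap.ker g ⧸ LinearMap.range f'
  have hR : ∀ a, LinearMap.range f' ≤ LinearMap.ker (Θ a ∘ₗ (LinearMap.ker g).subtype) := by
    rintro a _ ⟨x, rfl⟩
    have := LinearMap.congr_fun (h1 a) x
    simpa [hf'] using this
  let E : D →ₗ[ℚ] Module.Dual ℚ Q :=
    { toFun := fun a => (LinearMap.range f').liftQ (Θ a ∘ₗ (LinearMap.ker g).subtype) (hR a)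
      map_add' := fun a b => by
        apply Submodule.linearMap_qext; ext x; simp
      map_smul' := fun r a => by
        apply Submodule.linearMap_qext; ext x; simp }
  have hE : ∀ a (x : LinearMap.ker g), E a (Submodule.Quotient.mk x) = Θ a x := fun a x => rfl
  have hinj : Function.Injective E := by
    rw [injective_iff_map_eq_zero]
    intro a ha
    have hk : Θ a ∈ (LinearMap.ker g).dualAnnihilator := by
      rw [Submodule.mem_dualAnnihilator]
      intro x hx
      rw [← hE a ⟨x, hx⟩, ha]; rfl
    rw [← LinearMap.range_dualMap_eq_dualAnnihilator_ker] at hk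
    obtain ⟨ψ, hψ⟩ := hk
    exact h3 a ψ hψ.symm
  have hsurj : Function.Surjective E := by
    intro q
    obtain ⟨φ, hφ⟩ := LinearMap.exists_extend (q ∘ₗ (LinearMap.range f').mkQ)
    obtain ⟨a, ψ, h⟩ := h2 φ (by
      ext x
      have := LinearMap.congr_fun hφ (f' x)
      simp only [LinearMap.comp_apply, Submodule.subtype_apply, hf'] at this
      rw [LinearMap.comp_apply, this]
      have h0 : (LinearMap.range f').mkQ (f' x) = 0 := by
        simp
      rw [h0]; simp)
    refine ⟨a, ?_⟩
    apply Submodule.linearMap_qext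
    ext x
    have hx : g x = 0 := x.2
    have h5 : φ x = q ((LinearMap.range f').mkQ x) := LinearMap.congr_fun hφ x
    rw [LinearMap.comp_apply, LinearMap.comp_apply, ← h5, h]
    simp only [LinearMap.add_apply, LinearMap.comp_apply, hx, map_zero, add_zero]
    rfl
  let e : D ≃ₗ[ℚ] Module.Dual ℚ Q := LinearEquiv.ofBijective E ⟨hinj, hsurj⟩
  have hfd : FiniteDimensional ℚ (Module.Dual ℚ Q) := e.finiteDimensional
  have hQ : FiniteDimensional ℚ Q := (Module.finite_dual_iff ℚ).1 hfd
  refine ⟨hQ, ?_⟩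
  rw [e.finrank_eq]
  exact Subspace.dual_finrank_eq.symm

namespace Res
variable {G : Type} [Group G] {V : Type} [AddCommGroup V] [Module ℚ V] (ρ : Representation ℚ G V)

noncomputable def isoZ : RM ρ 0 ≅ Rep.of ρ where
  hom := Rep.ofHom (ρ := rM ρ 0) (σ := ρ)
    { Finsupp.lsum ℚ (fun _ => (LinearMap.id : V →ₗ[ℚ] V)) with
      isIntertwining' := fun g => by
        refine Finsupp.lhom_ext fun x v => ?_
        show (Finsupp.lsum ℚ (fun _ => (LinearMap.id : V →ₗ[ℚ] V))) (rM ρ 0 g (Finsupp.single x v)) =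
          ρ g ((Finsupp.lsum ℚ (fun _ => (LinearMap.id : V →ₗ[ℚ] V))) (Finsupp.single x v))
        rw [rM_single]; simp }
  inv := Rep.ofHom (ρ := ρ) (σ := rM ρ 0)
    { (Finsupp.lsingle (fun k : Fin 0 => k.elim0) : V →ₗ[ℚ] M G V 0) with
      isIntertwining' := fun g => by
        ext1 v
        show Finsupp.single _ (ρ g v) = rM ρ 0 g (Finsupp.single _ v)
        rw [rM_single]
        congr 1
        exact Subsingleton.elim _ _ }
  hom_inv_id := by
    apply Rep.hom_ext
    apply Representation.IntertwiningMap.toLinearMap_injective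
    refine Finsupp.lhom_ext fun x v => ?_
    show Finsupp.single _ ((Finsupp.lsum ℚ (fun _ => (LinearMap.id : V →ₗ[ℚ] V)))
      (Finsupp.single x v)) = Finsupp.single x v
    rw [Subsingleton.elim x (fun k : Fin 0 => k.elim0)]
    simp
  inv_hom_id := by
    apply Rep.hom_ext
    apply Representation.IntertwiningMap.toLinearMap_injective
    ext1 v
    show (Finsupp.lsum ℚ (fun _ => (LinearMap.id : V →ₗ[ℚ] V)))
      (Finsupp.single _ v) = v
    simp

noncomputable def aug (m : ℕ) : Submodule ℚ (M G V m) := augSubmodule (RM ρ m)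

/-- coinvariants of the chain modules -/
abbrev Co (m : ℕ) : Type := M G V m ⧸ aug ρ m

noncomputable def bdC (m : ℕ) : Co ρ (m + 1) →ₗ[ℚ] Co ρ m :=
  Submodule.mapQ (aug ρ (m + 1)) (aug ρ m) (bd m)
    (augSubmodule_mapsTo (bdR ρ m))

/-- dual action -/
def rhoDual : Representation ℚ G (V →ₗ[ℚ] ℚ) where
  toFun g := (ρ g⁻¹).dualMap
  map_one' := by ext f v; simp
  map_mul' g h := by ext f v; simp

/-- functional to cochain -/
noncomputable def toC {m : ℕ} (φ : Co ρ m →ₗ[ℚ] ℚ) (x : Fin m → G) : V →ₗ[ℚ] ℚ :=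
  φ ∘ₗ (aug ρ m).mkQ ∘ₗ Finsupp.lsingle x

theorem mkQ_rM {m : ℕ} (g : G) (y : M G V m) :
    (aug ρ m).mkQ (rM ρ m g y) = (aug ρ m).mkQ y := by
  rw [← sub_eq_zero, ← map_sub]
  have h : rM ρ m g y - y ∈ aug ρ m := by
    have h2 : ∀ z : RM ρ m, (RM ρ m).ρ g z - z ∈ augSubmodule (RM ρ m) :=
      fun z => Submodule.subset_span ⟨g, z, rfl⟩
    exact h2 y
  rw [Submodule.mkQ_apply]
  exact (Submodule.Quotient.mk_eq_zero (aug ρ m)).2 h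

theorem toC_eqv {m : ℕ} (φ : Co ρ m →ₗ[ℚ] ℚ) : Eqv (rhoDual ρ) (toC ρ φ) := by
  intro g x
  ext v
  show φ ((aug ρ m).mkQ (Finsupp.single (fun k => g * x k) v)) =
    φ ((aug ρ m).mkQ (Finsupp.single x (ρ g⁻¹ v)))
  rw [← mkQ_rM ρ g (Finsupp.single x (ρ g⁻¹ v)), rM_single, ← Module.End.mul_apply, ← map_mul]
  simp

theorem toC_inj {m : ℕ} {φ ψ : Co ρ m →ₗ[ℚ] ℚ} (h : toC ρ φ = toC ρ ψ) : φ = ψ := by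
  apply Submodule.linearMap_qext
  refine Finsupp.lhom_ext' fun x => ?_
  exact congrFun h x

theorem toC_surj {m : ℕ} {c : (Fin m → G) → (V →ₗ[ℚ] ℚ)} (hc : Eqv (rhoDual ρ) c) :
    ∃ φ, toC ρ φ = c := by
  refine ⟨(aug ρ m).liftQ (Finsupp.lsum ℚ c) ?_, ?_⟩
  · refine Submodule.span_le.2 ?_
    rintro _ ⟨g, y', rfl⟩
    let y : M G V m := y'
    show (Finsupp.lsum ℚ c) (rM ρ m g y - y) = 0
    rw [map_sub, sub_eq_zero]
    have : Finsupp.lsum ℚ c ∘ₗ rM ρ m g = Finsupp.lsum ℚ c := by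
      refine Finsupp.lhom_ext fun x v => ?_
      rw [LinearMap.comp_apply, rM_single]
      have := hc g x
      simp only [smul_eq_mul] at this
      simp [this, rhoDual]
    exact LinearMap.congr_fun this y
  · funext x
    ext v
    show (Finsupp.lsum ℚ c) (Finsupp.single x v) = _
    simp

theorem toC_bd {m : ℕ} (φ : Co ρ m →ₗ[ℚ] ℚ) : toC ρ (φ ∘ₗ bdC ρ m) = dd (toC ρ φ) := by
  funext x
  exact comp_bd_single (φ ∘ₗ (aug ρ m).mkQ) x

theorem toC_add {m : ℕ} (φ ψ : Co ρ m →ₗ[ℚ] ℚ) (x) : toC ρ (φ + ψ) x = toC ρ φ x + toC ρ ψ x := rfl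

noncomputable def FC : ChainComplex (ModuleCat ℚ) ℕ :=
  ((coinvFunctor G).mapHomologicalComplex _).obj (CC ρ)

noncomputable def homIso (i : ℕ) : grpHomology G (Rep.of ρ) i ≅ (FC ρ).homology i :=
  ((coinvFunctor G).leftDerived i).mapIso (isoZ ρ).symm ≪≫
    (PR ρ).isoLeftDerivedObj (coinvFunctor G) i

/-- general computation. -/
theorem hom_dim {D : Type} [AddCommGroup D] [Module ℚ D] [FiniteDimensional ℚ D] (i : ℕ)
    (Θ : D →ₗ[ℚ] ((Fin (i + 1) → G) → (V →ₗ[ℚ] ℚ)))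
    (h0 : ∀ a, Eqv (rhoDual ρ) (Θ a)) (h1 : ∀ a x, dd (Θ a) x = 0)
    (h2 : ∀ c, Eqv (rhoDual ρ) c → (∀ x, dd c x = 0) → ∃ a, ∃ e : (Fin i → G) → (V →ₗ[ℚ] ℚ),
      Eqv (rhoDual ρ) e ∧ (i = 0 → e = 0) ∧ ∀ x, c x = Θ a x + dd e x)
    (h3 : ∀ a, ∀ e : (Fin i → G) → (V →ₗ[ℚ] ℚ), Eqv (rhoDual ρ) e → (i = 0 → e = 0) →
      (∀ x, Θ a x = dd e x) → a = 0) :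
    FiniteDimensional ℚ (grpHomology G (Rep.of ρ) i) ∧
      Module.finrank ℚ (grpHomology G (Rep.of ρ) i) = Module.finrank ℚ D := by
  -- the functional form of Θ
  choose F hF using fun a => toC_surj ρ (h0 a)
  let Θ' : D →ₗ[ℚ] (Co ρ (i + 1) →ₗ[ℚ] ℚ) :=
    { toFun := F
      map_add' := fun a b => toC_inj ρ (by
        funext x; rw [toC_add, hF, hF, hF, map_add]; rfl)
      map_smul' := fun r a => toC_inj ρ (by
        rw [hF, map_smul, ← hF]; rfl) }
  have hΘ' : ∀ a, toC ρ (Θ' a) = Θ a := hF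
  -- transfer lemma
  have key : ∀ (C : Type) [AddCommGroup C] [Module ℚ C] (g : Co ρ (i + 1) →ₗ[ℚ] C)
      (_ : ∀ ψ : C →ₗ[ℚ] ℚ, ∃ e : (Fin i → G) → (V →ₗ[ℚ] ℚ), Eqv (rhoDual ρ) e ∧ (i = 0 → e = 0) ∧
        ∀ x, toC ρ (ψ ∘ₗ g) x = dd e x)
      (_ : ∀ e : (Fin i → G) → (V →ₗ[ℚ] ℚ), Eqv (rhoDual ρ) e → (i = 0 → e = 0) →
        ∃ ψ : C →ₗ[ℚ] ℚ, ∀ x, toC ρ (ψ ∘ₗ g) x = dd e x)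
      (f' : Co ρ (i + 2) →ₗ[ℚ] LinearMap.ker g) (_ : ∀ x, (f' x : Co ρ (i + 1)) = bdC ρ (i + 1) x),
      FiniteDimensional ℚ (LinearMap.ker g ⧸ LinearMap.range f') ∧
      Module.finrank ℚ (LinearMap.ker g ⧸ LinearMap.range f') = Module.finrank ℚ D := by
    intro C _ _ g hg1 hg2 f' hf'
    refine lin_dual (bdC ρ (i + 1)) g Θ' (fun a => toC_inj ρ ?_) (fun φ hφ => ?_)
      (fun a ψ h => ?_) f' hf'
    · rw [toC_bd, hΘ']
      funext x
      rw [h1]; rfl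
    · obtain ⟨a, e, he1, he2, he3⟩ := h2 (toC ρ φ) (toC_eqv ρ φ) (fun x => by
        rw [← toC_bd, hφ]; rfl)
      obtain ⟨ψ, hψ⟩ := hg2 e he1 he2
      refine ⟨a, ψ, toC_inj ρ (funext fun x => ?_)⟩
      rw [toC_add, hψ, hΘ', he3]
    · obtain ⟨e, he1, he2, he3⟩ := hg1 ψ
      refine h3 a e he1 he2 (fun x => ?_)
      rw [← he3, ← h, hΘ']
  have fin : ∀ (k : ℕ) (hk : (ComplexShape.down ℕ).next i = k),
      (FiniteDimensional ℚ ((FC ρ).sc' (i + 1) i k).moduleCatLeftHomologyData.H ∧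
        Module.finrank ℚ ((FC ρ).sc' (i + 1) i k).moduleCatLeftHomologyData.H =
          Module.finrank ℚ D) →
      FiniteDimensional ℚ (grpHomology G (Rep.of ρ) i) ∧
      Module.finrank ℚ (grpHomology G (Rep.of ρ) i) = Module.finrank ℚ D := by
    intro k hk ⟨hh1, hh2⟩
    let iso : grpHomology G (Rep.of ρ) i ≅
        ((FC ρ).sc' (i + 1) i k).moduleCatLeftHomologyData.H :=
      homIso ρ i ≪≫ ShortComplex.homologyMapIso ((FC ρ).isoSc' (i + 1) i k (by simp) hk) ≪≫
        ((FC ρ).sc' (i + 1) i k).moduleCatHomologyIso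
    let L := iso.toLinearEquiv
    exact ⟨L.symm.finiteDimensional, by rw [← hh2]; exact L.finrank_eq⟩
  have hd : ∀ m, (FC ρ).d (m + 1) m = ModuleCat.ofHom (bdC ρ (m + 1)) := by
    intro m
    show (coinvFunctor G).map ((CC ρ).d (m + 1) m) = _
    rw [CC_d]; rfl
  cases i with
  | zero =>
    refine fin 0 (by simp) ?_
    have h00 : (FC ρ).d 0 0 = 0 := (FC ρ).shape _ _ (by simp)
    refine key ((FC ρ).X 0) ((FC ρ).d 0 0).hom (fun ψ => ⟨fun _ => 0, fun g x => by simp, fun _ => rfl,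
      fun x => ?_⟩) (fun e he1 he2 => ⟨0, fun x => ?_⟩)
      ((FC ρ).sc' 1 0 0).moduleCatToCycles (fun x => ?_)
    · rw [h00]
      have : toC ρ (ψ ∘ₗ ModuleCat.Hom.hom (0 : (FC ρ).X 0 ⟶ (FC ρ).X 0)) x = 0 := by
        ext v
        exact map_zero ψ
      rw [this]
      exact (dd_zero_fun (A := V →ₗ[ℚ] ℚ) x).symm
    · rw [he2 rfl]
      exact (dd_zero_fun (A := V →ₗ[ℚ] ℚ) x).symm
    · exact LinearMap.congr_fun (congrArg ModuleCat.Hom.hom (hd 0)) x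
  | succ i =>
    refine fin i (by simp) ?_
    refine key ((FC ρ).X i) ((FC ρ).d (i + 1) i).hom (fun ψ => ?_) (fun e he1 he2 => ?_) _
      (fun x => ?_)
    · refine ⟨toC ρ (m := i + 1) ψ, toC_eqv ρ _, fun h => by simp at h, fun x => ?_⟩
      rw [hd]; exact congrFun (toC_bd ρ (m := i + 1) ψ) x
    · obtain ⟨ψ, hψ⟩ := toC_surj ρ he1
      refine ⟨ψ, fun x => ?_⟩
      rw [hd, ← hψ]; exact congrFun (toC_bd ρ (m := i + 1) ψ) x
    · exact LinearMap.congr_fun (congrArg ModuleCat.Hom.hom (hd (i + 1))) x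

end Res

/-- The homology of `G` has dimension equal to that of `D`. -/
theorem TD.hom_dim {G P W S : Type} [Group G] [Group P] [Group W] [MulAction W S] (T : TD G P W S)
    [Fintype S] [Fintype W] {V : Type} [AddCommGroup V] [Module ℚ V] [FiniteDimensional ℚ V]
    (σ : Representation ℚ W V) (i : ℕ) :
    FiniteDimensional ℚ (grpHomology G (Rep.of (σ.comp T.π)) i) ∧
      Module.finrank ℚ (grpHomology G (Rep.of (σ.comp T.π)) i) = Module.finrank ℚ (T.D σ i) := by
  have hρ : Res.rhoDual (σ.comp T.π) = T.rhoD σ := by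
    ext g f v
    simp [Res.rhoDual, TD.rhoD]
  refine Res.hom_dim (σ.comp T.π) (D := T.D σ i) i
    { toFun := fun a => lcU T.UG a.1
      map_add' := fun a b => by
        funext x; simp [lcU, Finset.sum_add_distrib]
      map_smul' := fun r a => by
        funext x
        simp only [lcU, Submodule.coe_smul, Pi.smul_apply, RingHom.id_apply, Finset.smul_sum]
        exact Finset.sum_congr rfl fun s _ => smul_comm _ _ _ } ?_ ?_ ?_ ?_
  · intro a; rw [hρ]; exact T.theta_eqv σ a.2
  · intro a x; exact dd_lcU _ T.UG_add a.1 x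
  · intro c hc hd
    rw [hρ] at hc
    obtain ⟨a, ha, e, h⟩ := T.theta_gen σ hc hd
    exact ⟨⟨a, ha⟩, e, by rw [hρ]; exact h⟩
  · intro a e he he0 h
    rw [hρ] at he
    exact Subtype.ext (T.theta_inj σ a.2 he he0 h)

end WB
end

section
open CategoryTheory
namespace WB

/-- `w` fixes the labels of the indices in `U`. -/
def Fx {n : ℕ} (U : Finset (Fin n)) (w : Wgroup n) : Prop :=
  ∀ i ∈ U, w.right i = i ∧ w.left i = 1

theorem Fx.mono {n : ℕ} {U U' : Finset (Fin n)} (h : U' ⊆ U) {w : Wgroup n} (hw : Fx U w) : Fx U' w :=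
  fun i hi => hw i (h hi)

theorem mul_left_apply {n : ℕ} (a b : Wgroup n) (i : Fin n) :
    (a * b).left i = a.left i * b.left (a.right.symm i) := rfl

theorem mul_right_apply {n : ℕ} (a b : Wgroup n) (i : Fin n) :
    (a * b).right i = a.right (b.right i) := rfl

theorem Fx_iff {n : ℕ} {U : Finset (Fin n)} {w : Wgroup n} :
    Fx U w ↔ ∀ i ∈ U, w • Om.pt i 1 = (Om.pt i 1 : Om n) := by
  refine forall₂_congr fun i _ => ?_
  rw [om_smul_pt]
  simp only [Om.pt.injEq, mul_one]
  constructor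
  · rintro ⟨h1, h2⟩; rw [h1]; exact ⟨rfl, h2⟩
  · rintro ⟨h1, h2⟩; rw [h1] at h2; exact ⟨h1, h2⟩

theorem smul_pt_neg {n : ℕ} (w : Wgroup n) {i j : Fin n} {e : ℤˣ} (d : ℤˣ)
    (h : w • Om.pt i e = (Om.pt j d : Om n)) (c : ℤˣ) :
    w • Om.pt i (e * c) = (Om.pt j (d * c) : Om n) := by
  rw [om_smul_pt] at h ⊢
  simp only [Om.pt.injEq] at h ⊢
  obtain ⟨h1, h2⟩ := h
  exact ⟨h1, by rw [← mul_assoc, h2]⟩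

theorem Fx.smul {n : ℕ} {U : Finset (Fin n)} {w : Wgroup n} (h : Fx U w) {i} (hi : i ∈ U) (e : ℤˣ) :
    w • Om.pt i e = (Om.pt i e : Om n) := by
  have := smul_pt_neg w _ (Fx_iff.1 h i hi) e
  simpa using this

theorem Fx.conj {n : ℕ} {U : Finset (Fin n)} {w : Wgroup n} (τ : Wgroup n)
    (h : Fx (U.image τ.right) w) : Fx U (τ⁻¹ * w * τ) := by
  rw [Fx_iff]
  intro i hi
  rw [mul_smul, mul_smul, om_smul_pt n τ, h.smul (Finset.mem_image_of_mem _ hi), ← om_smul_pt n τ,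
    inv_smul_smul]

theorem Fx.image {n : ℕ} {U : Finset (Fin n)} {w : Wgroup n} (h : Fx U w) : U.image w.right = U := by
  ext j
  simp only [Finset.mem_image]
  constructor
  · rintro ⟨a, ha, rfl⟩; rw [(h a ha).1]; exact ha
  · intro hj; exact ⟨j, hj, (h j hj).1⟩

theorem Fx_univ {n : ℕ} {w : Wgroup n} (h : Fx Finset.univ w) : w = 1 := by
  ext i
  · rw [(h i (Finset.mem_univ _)).2]; rfl
  · rw [(h i (Finset.mem_univ _)).1]; rfl

/-- castSucc on finsets -/
def cS {n : ℕ} (U : Finset (Fin n)) : Finset (Fin (n + 1)) := U.image Fin.castSucc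

/-- preimage under castSucc -/
def pS {n : ℕ} (U : Finset (Fin (n + 1))) : Finset (Fin n) :=
  Finset.univ.filter fun i => i.castSucc ∈ U

theorem mem_pS {n : ℕ} {U : Finset (Fin (n + 1))} {i : Fin n} : i ∈ pS U ↔ i.castSucc ∈ U := by
  simp [pS]

theorem mem_cS {n : ℕ} {U : Finset (Fin n)} {i : Fin n} : i.castSucc ∈ cS U ↔ i ∈ U := by
  simp [cS]

theorem last_notMem_cS {n : ℕ} {U : Finset (Fin n)} : Fin.last n ∉ cS U := by
  simp only [cS, Finset.mem_image, not_exists, not_and]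
  intro i _ h
  exact (Fin.castSucc_lt_last i).ne h

theorem card_cS {n : ℕ} (U : Finset (Fin n)) : (cS U).card = U.card :=
  Finset.card_image_of_injective _ (Fin.castSucc_injective n)

theorem cS_pS {n : ℕ} (U : Finset (Fin (n + 1))) : cS (pS U) = U.erase (Fin.last n) := by
  ext j
  refine Fin.lastCases ?_ (fun j => ?_) j
  · simp [last_notMem_cS]
  · rw [mem_cS, mem_pS, Finset.mem_erase]
    simp [(Fin.castSucc_lt_last j).ne]

theorem card_pS_le {n : ℕ} (U : Finset (Fin (n + 1))) : (pS U).card ≤ U.card := by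
  rw [← card_cS, cS_pS]; exact Finset.card_erase_le

theorem card_pS_lt {n : ℕ} {U : Finset (Fin (n + 1))} (h : Fin.last n ∈ U) :
    (pS U).card < U.card := by
  rw [← card_cS, cS_pS]; exact Finset.card_erase_lt_of_mem h

theorem inclW_right_cs {n : ℕ} (w : Wgroup n) (i : Fin n) :
    (inclW n w).right i.castSucc = (w.right i).castSucc := by
  show inclPermLe (Nat.le_succ n) w.right i.castSucc = _
  rw [inclPermLe_apply_lt (Nat.le_succ n) w.right i.castSucc i.2]
  rfl

theorem inclW_right_last {n : ℕ} (w : Wgroup n) :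
    (inclW n w).right (Fin.last n) = Fin.last n := by
  show inclPermLe (Nat.le_succ n) w.right (Fin.last n) = _
  rw [inclPermLe_apply_not_lt (Nat.le_succ n) w.right (Fin.last n) (by simp)]

theorem inclW_left_cs {n : ℕ} (w : Wgroup n) (i : Fin n) :
    (inclW n w).left i.castSucc = w.left i := by
  show extendSigns n w.left i.castSucc = _
  simp [extendSigns]

theorem inclW_left_last {n : ℕ} (w : Wgroup n) :
    (inclW n w).left (Fin.last n) = 1 := by
  show extendSigns n w.left (Fin.last n) = _
  simp [extendSigns]

theorem omCS_smul {n : ℕ} (w : Wgroup n) (x : Om n) : omCS (w • x) = inclW n w • omCS x := by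
  cases x with
  | zero => rfl
  | pt i e =>
    rw [om_smul_pt]
    show Om.pt _ _ = inclW n w • Om.pt i.castSucc e
    rw [om_smul_pt, inclW_right_cs, inclW_left_cs]

theorem ssCS_smul {n : ℕ} (w : Wgroup n) (x : SS n) : ssCS (w • x) = inclW n w • ssCS x :=
  Prod.ext (omCS_smul w x.1) (omCS_smul w x.2)

theorem Fx_inclW {n : ℕ} {U : Finset (Fin (n + 1))} {w : Wgroup n} (h : Fx (pS U) w) :
    Fx U (inclW n w) := by
  intro i
  refine Fin.lastCases (fun _ => ?_) (fun i hi => ?_) i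
  · exact ⟨inclW_right_last w, inclW_left_last w⟩
  · have := h i (mem_pS.2 hi)
    rw [inclW_right_cs, inclW_left_cs, this.1]
    exact ⟨rfl, this.2⟩

theorem exists_inclW {n : ℕ} (v : Wgroup (n + 1)) (h1 : v.right (Fin.last n) = Fin.last n)
    (h2 : v.left (Fin.last n) = 1) : ∃ w, inclW n w = v := by
  have hp : ∀ i : Fin n, v.right i.castSucc ≠ Fin.last n := fun i h =>
    (Fin.castSucc_lt_last i).ne (v.right.injective (h.trans h1.symm))
  have hinj : Function.Injective (fun i : Fin n => (v.right i.castSucc).castPred (hp i)) := by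
    intro a b hab
    have := congrArg Fin.castSucc hab
    simp only [Fin.castSucc_castPred] at this
    exact Fin.castSucc_injective n (v.right.injective this)
  let σ : Equiv.Perm (Fin n) := Equiv.ofBijective _ (Finite.injective_iff_bijective.1 hinj)
  have hσ : ∀ i, (σ i).castSucc = v.right i.castSucc := fun i => Fin.castSucc_castPred _ (hp i)
  refine ⟨⟨fun i => v.left i.castSucc, σ⟩, ?_⟩
  apply SemidirectProduct.ext
  · funext i
    refine Fin.lastCases ?_ (fun i => ?_) i
    · rw [inclW_left_last, h2]
    · rw [inclW_left_cs]
  · apply Equiv.ext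
    intro i
    refine Fin.lastCases ?_ (fun i => ?_) i
    · rw [inclW_right_last, h1]
    · rw [inclW_right_cs, ← hσ]

/-- index set of a label -/
def idx {n : ℕ} : Om n → Finset (Fin n)
  | .zero => ∅
  | .pt i _ => {i}

theorem card_idx {n : ℕ} (x : Om n) : (idx x).card ≤ 1 := by
  cases x <;> simp [idx]

/-- indices occurring in a tuple of pairs -/
def supp {n i : ℕ} (s : Fin i → SS n) : Finset (Fin n) :=
  Finset.univ.biUnion fun j => idx (s j).1 ∪ idx (s j).2

theorem card_supp {n i : ℕ} (s : Fin i → SS n) : (supp s).card ≤ 2 * i := by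
  refine (Finset.card_biUnion_le_card_mul _ _ 2 fun j _ => ?_).trans ?_
  · exact (Finset.card_union_le _ _).trans (by have := card_idx (s j).1; have := card_idx (s j).2; omega)
  · simp [mul_comm]

theorem Fx.om {n : ℕ} {x : Om n} {w : Wgroup n} (h : Fx (idx x) w) : w • x = x := by
  cases x with
  | zero => rfl
  | pt i e => exact h.smul (by simp [idx]) e

theorem idx_sub {n i : ℕ} (s : Fin i → SS n) (j) : idx (s j).1 ⊆ supp s ∧ idx (s j).2 ⊆ supp s := by
  have h : idx (s j).1 ∪ idx (s j).2 ⊆ supp s :=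
    Finset.subset_biUnion_of_mem (fun j => idx (s j).1 ∪ idx (s j).2) (Finset.mem_univ j)
  exact ⟨Finset.subset_union_left.trans h, Finset.subset_union_right.trans h⟩

theorem Fx.ss {n i : ℕ} {s : Fin i → SS n} {w : Wgroup n} (h : Fx (supp s) w) :
    (fun j => w • s j) = s := by
  funext j
  exact Prod.ext (Fx.om (h.mono (idx_sub s j).1)) (Fx.om (h.mono (idx_sub s j).2))

/-- a transposition as an element of `W` -/
def swW {n : ℕ} (a b : Fin n) : Wgroup n := ⟨1, Equiv.swap a b⟩

theorem om_lift {n : ℕ} (x : Om (n + 1)) {l : Fin (n + 1)} (h : l ∉ idx x) :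
    ∃ x', omCS x' = swW l (Fin.last n) • x := by
  cases x with
  | zero => exact ⟨.zero, rfl⟩
  | pt i e =>
    have hi : i ≠ l := fun hh => h (by simp [idx, hh])
    have h2 : Equiv.swap l (Fin.last n) i ≠ Fin.last n := by
      intro hh
      have := congrArg (Equiv.swap l (Fin.last n)) hh
      simp at this
      exact hi this
    refine ⟨.pt ((Equiv.swap l (Fin.last n) i).castPred h2) e, ?_⟩
    rw [om_smul_pt]
    simp [omCS, swW]

theorem ss_lift {n i : ℕ} (s : Fin i → SS (n + 1)) {l : Fin (n + 1)} (h : l ∉ supp s) :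
    ∃ s' : Fin i → SS n, (fun j => ssCS (s' j)) = fun j => swW l (Fin.last n) • s j := by
  choose a ha using fun j => om_lift (s j).1 (fun hh => h ((idx_sub s j).1 hh))
  choose b hb using fun j => om_lift (s j).2 (fun hh => h ((idx_sub s j).2 hh))
  exact ⟨fun j => (a j, b j), funext fun j => Prod.ext (ha j) (hb j)⟩

/-- Straightening. -/
theorem straighten {n : ℕ} (μ : Wgroup (n + 1)) (U : Finset (Fin n))
    (h : Fin.last n ∉ (cS U).image μ.right) :
    ∃ (τ : Wgroup n) (r : Wgroup (n + 1)), Fx (cS U) r ∧ inclW n τ = μ * r := by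
  let p := μ.right.symm (Fin.last n)
  have hp : p ∉ cS U := fun hh => h (Finset.mem_image.2 ⟨p, hh, by simp [p]⟩)
  let r : Wgroup (n + 1) := ⟨Function.update 1 p (μ.left (Fin.last n)), Equiv.swap p (Fin.last n)⟩
  have hr : Fx (cS U) r := by
    intro j hj
    have h1 : j ≠ p := fun hh => hp (hh ▸ hj)
    have h2 : j ≠ Fin.last n := fun hh => last_notMem_cS (hh ▸ hj)
    exact ⟨Equiv.swap_apply_of_ne_of_ne h1 h2, by simp [r, h1]⟩
  obtain ⟨τ, hτ⟩ := exists_inclW (μ * r) (by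
    rw [mul_right_apply]; simp [r, p]) (by
    rw [mul_left_apply]
    simp only [r]
    show μ.left (Fin.last n) * Function.update (1 : Fin (n+1) → ℤˣ) p (μ.left (Fin.last n)) p = 1
    rw [Function.update_self]
    exact Int.units_mul_self _)
  exact ⟨τ, r, hr, hτ⟩

end WB
end

section
open CategoryTheory
namespace WB
namespace RT

section one
variable {G V : Type} [Group G] [AddCommGroup V] [Module ℚ V] {ρ : Representation ℚ G V}

theorem inv_left (ρ : Representation ℚ G V) (g : G) (v : V) : ρ g⁻¹ (ρ g v) = v := by
  rw [← Module.End.mul_apply, ← map_mul]; simp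

/-- An invariant set with a nonzero element spans. -/
theorem span_top (h : IsIrreducibleRep ρ) (X : Set V) (hX : ∀ g, ∀ x ∈ X, ρ g x ∈ X)
    (h0 : ∃ x ∈ Submodule.span ℚ X, x ≠ 0) : Submodule.span ℚ X = ⊤ := by
  refine (h.2 _ fun g v hv => ?_).resolve_left ?_
  · induction hv using Submodule.span_induction with
    | mem x hx => exact Submodule.subset_span (hX g x hx)
    | zero => simp
    | add x y _ _ hx hy => rw [map_add]; exact Submodule.add_mem _ hx hy
    | smul r x _ hx => rw [map_smul]; exact Submodule.smul_mem _ _ hx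
  · obtain ⟨x, hx, hx0⟩ := h0
    intro hb
    rw [hb] at hx
    exact hx0 (by simpa using hx)

/-- Translates of a nonzero functional separate points. -/
theorem sep (h : IsIrreducibleRep ρ) {z : V →ₗ[ℚ] ℚ} (hz : z ≠ 0) {v : V}
    (hv : ∀ g, z (ρ g v) = 0) : v = 0 := by
  let q : Submodule ℚ V := ⨅ g : G, LinearMap.ker (z ∘ₗ ρ g)
  have mq : ∀ x, x ∈ q ↔ ∀ g, z (ρ g x) = 0 := fun x => by simp [q]
  rcases h.2 q (fun g x hx => (mq _).2 fun k => by
    rw [← Module.End.mul_apply, ← map_mul]; exact (mq x).1 hx _) with hq | hq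
  · have : v ∈ q := (mq v).2 hv
    rw [hq] at this
    simpa using this
  · exact absurd (LinearMap.ext fun x => by
      have : x ∈ q := by rw [hq]; trivial
      simpa using (mq x).1 this 1) hz
end one

section two
variable {n : ℕ} {V : Type} [AddCommGroup V] [Module ℚ V] (ρ : Representation ℚ (Wgroup n) V)

/-- functional fixed by `Fx U` -/
def Inv (U : Finset (Fin n)) (z : V →ₗ[ℚ] ℚ) : Prop := ∀ w, Fx U w → ∀ v, z (ρ w v) = z v

/-- weight at most `k` -/
def wt (k : ℕ) : Prop := ∃ (U : Finset (Fin n)) (z : V →ₗ[ℚ] ℚ), U.card ≤ k ∧ z ≠ 0 ∧ Inv ρ U z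

def HH (k : ℕ) (x : V) (U : Finset (Fin n)) : Prop :=
  ∀ (U' : Finset (Fin n)) (z : V →ₗ[ℚ] ℚ), U'.card ≤ k → Inv ρ U' z → ¬ U' ⊆ U → z x = 0

variable {ρ}
theorem wt.mono {k k' : ℕ} (h : wt ρ k) (hk : k ≤ k') : wt ρ k' := by
  obtain ⟨U, z, h1, h2⟩ := h
  exact ⟨U, z, h1.trans hk, h2⟩

theorem Inv.comp {U : Finset (Fin n)} {z : V →ₗ[ℚ] ℚ} (τ : Wgroup n)
    (h : Inv ρ (U.image τ.right) z) : Inv ρ U (z ∘ₗ ρ τ) := by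
  intro w hw v
  have : Fx (U.image τ.right) (τ * w * τ⁻¹) := by
    have := Fx.conj (U := U.image τ.right) (w := w) τ⁻¹ (by
      rw [Finset.image_image]
      have : (⇑(τ⁻¹).right ∘ ⇑τ.right) = id := by
        funext i
        rw [Function.comp_apply, ← mul_right_apply]; simp
      rw [this, Finset.image_id]; exact hw)
    simpa using this
  have h2 := h _ this (ρ τ v)
  rw [LinearMap.comp_apply, LinearMap.comp_apply, ← h2]
  simp only [← Module.End.mul_apply, ← map_mul]
  simp

theorem image_inv (τ : Wgroup n) (U : Finset (Fin n)) :
    (U.image (τ⁻¹).right).image τ.right = U := by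
  rw [Finset.image_image]
  have : (⇑τ.right ∘ ⇑(τ⁻¹).right) = id := by
    funext i
    rw [Function.comp_apply, ← mul_right_apply]; simp
  rw [this, Finset.image_id]

theorem Inv.comp' {U : Finset (Fin n)} {z : V →ₗ[ℚ] ℚ} (τ : Wgroup n)
    (h : Inv ρ U z) : Inv ρ (U.image (τ⁻¹).right) (z ∘ₗ ρ τ) := by
  apply Inv.comp
  rwa [image_inv]

theorem card_im (τ : Wgroup n) (U : Finset (Fin n)) : (U.image τ.right).card = U.card :=
  Finset.card_image_of_injective _ τ.right.injective

theorem HH.smul {k : ℕ} {x : V} {U : Finset (Fin n)} (h : HH ρ k x U) (τ : Wgroup n) :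
    HH ρ k (ρ τ x) (U.image τ.right) := by
  intro U' z hk hz hU
  refine h _ (z ∘ₗ ρ τ) (by rw [card_im]; exact hk) (hz.comp' τ) fun hs => hU ?_
  rw [← image_inv τ U']
  exact Finset.image_subset_image hs

theorem HH.fix (hirr : IsIrreducibleRep ρ) {k : ℕ} (hw : wt ρ k) {x : V} {U : Finset (Fin n)}
    (h : HH ρ k x U) {g : Wgroup n} (hg : Fx U g) : ρ g x = x := by
  obtain ⟨U0, z, hk, hz0, hz⟩ := hw
  refine sub_eq_zero.1 (sep hirr hz0 fun τ => ?_)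
  rw [map_sub, map_sub, sub_eq_zero]
  have hz' := hz.comp' τ
  have hk' : (U0.image (τ⁻¹).right).card ≤ k := by rw [card_im]; exact hk
  by_cases hs : U0.image (τ⁻¹).right ⊆ U
  · exact hz' g (hg.mono hs) x
  · have h1 := h _ _ hk' hz' hs
    have h2 := h.smul g
    rw [hg.image] at h2
    have h2 := h2 _ _ hk' hz' hs
    exact h2.trans h1.symm
end two

section three
variable {n : ℕ} {V V' : Type} [AddCommGroup V] [Module ℚ V] [AddCommGroup V'] [Module ℚ V']
  {ρ : Representation ℚ (Wgroup n) V} {ρ' : Representation ℚ (Wgroup (n + 1)) V'}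
  (f : V →ₗ[ℚ] V') (heq : ∀ w v, f (ρ w v) = ρ' (inclW n w) (f v))

include heq in
theorem Inv.pull {U : Finset (Fin (n + 1))} {z : V' →ₗ[ℚ] ℚ} (h : Inv ρ' U z) :
    Inv ρ (pS U) (z ∘ₗ f) := by
  intro w hw v
  rw [LinearMap.comp_apply, heq]
  exact h _ (Fx_inclW hw) _

include heq in
theorem wt.pull (hirr : IsIrreducibleRep ρ') (hf : f ≠ 0) {k : ℕ} (h : wt ρ' k) : wt ρ k := by
  obtain ⟨U, z, h1, h2, h3⟩ := h
  obtain ⟨v, hv⟩ : ∃ v, f v ≠ 0 := by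
    by_contra! hh
    exact hf (LinearMap.ext hh)
  obtain ⟨τ, hτ⟩ : ∃ τ, z (ρ' τ (f v)) ≠ 0 := by
    by_contra! hh
    exact hv (sep hirr h2 hh)
  refine ⟨_, (z ∘ₗ ρ' τ) ∘ₗ f, (card_pS_le _).trans ?_, fun h0 => hτ (LinearMap.congr_fun h0 v),
    Inv.pull f heq (h3.comp' τ)⟩
  rw [card_im]; exact h1

include heq in
theorem HH.push {k : ℕ} (hk : ∀ k' < k, ¬ wt ρ k') {x : V} {U : Finset (Fin n)}
    (h : HH ρ k x U) : HH ρ' k (f x) (cS U) := by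
  intro U' z hU' hz hs
  have hz' := Inv.pull f heq hz
  by_cases hs' : pS U' ⊆ U
  · have hl : Fin.last n ∈ U' := by
      by_contra hl
      apply hs
      rw [← Finset.erase_eq_of_notMem hl, ← cS_pS]
      exact Finset.image_subset_image hs'
    have : z ∘ₗ f = 0 := by
      by_contra h0
      exact hk _ ((card_pS_lt hl).trans_le hU') ⟨_, _, le_rfl, h0, hz'⟩
    exact LinearMap.congr_fun this x
  · exact h _ _ ((card_pS_le _).trans hU') hz' hs'

include heq in
/-- span of `V'` from a spanning set of `V` -/
theorem span_push (hirr : IsIrreducibleRep ρ') (hf : f ≠ 0) {X : Set V}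
    (hX : Submodule.span ℚ X = ⊤) :
    Submodule.span ℚ {y | ∃ τ, ∃ x ∈ X, y = ρ' τ (f x)} = ⊤ := by
  obtain ⟨v, hv⟩ : ∃ v, f v ≠ 0 := by
    by_contra! hh
    exact hf (LinearMap.ext hh)
  apply span_top hirr
  · rintro g _ ⟨τ, x, hx, rfl⟩
    exact ⟨g * τ, x, hx, by rw [map_mul]; rfl⟩
  · refine ⟨f v, ?_, hv⟩
    have : Submodule.span ℚ X ≤ (Submodule.span ℚ {y | ∃ τ, ∃ x ∈ X, y = ρ' τ (f x)}).comap f := by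
      rw [Submodule.span_le]
      intro x hx
      exact Submodule.subset_span ⟨1, x, hx, by simp⟩
    exact this (by rw [hX]; trivial)

/-- spanned by elements supported on at most `m` indices -/
def Gen (ρ : Representation ℚ (Wgroup n) V) (k m : ℕ) : Prop :=
  Submodule.span ℚ {x | ∃ U, U.card ≤ m ∧ HH ρ k x U} = ⊤

include heq in
theorem Gen.push (hirr : IsIrreducibleRep ρ') (hf : f ≠ 0) {k m : ℕ} (hk : ∀ k' < k, ¬ wt ρ k')
    (h : Gen ρ k m) : Gen ρ' k m := by
  have := span_push f heq hirr hf h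
  unfold Gen
  rw [eq_top_iff, ← this]
  apply Submodule.span_mono
  rintro _ ⟨τ, x, ⟨U, hU, hx⟩, rfl⟩
  exact ⟨(cS U).image τ.right, by rw [card_im, card_cS]; exact hU, (HH.push f heq hk hx).smul τ⟩

include heq in
/-- The key vanishing statement. -/
theorem vanish (hirr : IsIrreducibleRep ρ') (hf : f ≠ 0)
    {k m : ℕ} (hk : ∀ k' < k, ¬ wt ρ k') (hw' : wt ρ' k) (h : Gen ρ k m) {i : ℕ}
    (hn : 2 * i + m < n + 1) (a : (Fin i → SS (n + 1)) → (V' →ₗ[ℚ] ℚ))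
    (ha : ∀ (w : Wgroup (n + 1)) s v, a (fun j => w • s j) (ρ' w v) = a s v)
    (h0 : ∀ (s : Fin i → SS n) v, a (fun j => ssCS (s j)) (f v) = 0) : a = 0 := by
  funext s
  apply LinearMap.ext_on (span_push f heq hirr hf h)
  rintro _ ⟨τ, y, ⟨U, hU, hy⟩, rfl⟩
  obtain ⟨l, hl⟩ : ∃ l, l ∉ supp s ∪ (cS U).image τ.right := by
    by_contra! hh
    have h1 : (Finset.univ : Finset (Fin (n + 1))) ⊆ supp s ∪ (cS U).image τ.right := fun l _ => hh l
    have h2 := Finset.card_le_card h1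
    have h3 := Finset.card_union_le (supp s) ((cS U).image τ.right)
    rw [card_im, card_cS] at h3
    have h4 := card_supp s
    simp only [Finset.card_univ, Fintype.card_fin] at h2
    omega
  rw [Finset.notMem_union] at hl
  obtain ⟨s', hs'⟩ := ss_lift s hl.1
  obtain ⟨τ0, r, hr, hτ0⟩ := straighten (swW l (Fin.last n) * τ) U (by
    intro hh
    obtain ⟨j, hj, hj2⟩ := Finset.mem_image.1 hh
    apply hl.2
    refine Finset.mem_image.2 ⟨j, hj, ?_⟩
    rw [mul_right_apply] at hj2
    have := congrArg (Equiv.swap l (Fin.last n)) hj2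
    simpa [swW] using this)
  have hfix : ρ' r (f y) = f y := (HH.push f heq hk hy).fix hirr hw' hr
  rw [← ha (swW l (Fin.last n)) s, ← hs']
  have e1 : ρ' (swW l (Fin.last n)) (ρ' τ (f y)) = f (ρ τ0 y) := by
    rw [heq, hτ0, map_mul, map_mul, Module.End.mul_apply, Module.End.mul_apply, hfix]
  rw [e1, h0]; rfl

end three

/-- Case of large weight. -/
theorem vanish' {n : ℕ} {V : Type} [AddCommGroup V] [Module ℚ V] {ρ : Representation ℚ (Wgroup n) V}
    {i : ℕ} (hw : ¬ wt ρ (2 * i)) (a : (Fin i → SS n) → (V →ₗ[ℚ] ℚ))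
    (ha : ∀ (w : Wgroup n) s v, a (fun j => w • s j) (ρ w v) = a s v) : a = 0 := by
  funext s
  by_contra h0
  refine hw ⟨supp s, a s, card_supp s, h0, fun w hfx v => ?_⟩
  rw [← ha w s v, hfx.ss]

/-- Eventual injectivity of restriction. -/
theorem eventually {V : ℕ → Type} [∀ n, AddCommGroup (V n)] [∀ n, Module ℚ (V n)]
    (ρ : ∀ n, Representation ℚ (Wgroup n) (V n)) (f : ∀ n, V n →ₗ[ℚ] V (n + 1)) (N0 : ℕ)
    (hirr : ∀ n, N0 ≤ n → IsIrreducibleRep (ρ n)) (hf : ∀ n, N0 ≤ n → f n ≠ 0)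
    (heq : ∀ n, N0 ≤ n → ∀ w v, f n (ρ n w v) = ρ (n + 1) (inclW n w) (f n v)) (i : ℕ) :
    ∃ N, N0 ≤ N ∧ ∀ n, N ≤ n → ∀ a : (Fin i → SS (n + 1)) → (V (n + 1) →ₗ[ℚ] ℚ),
      (∀ (w : Wgroup (n + 1)) s v, a (fun j => w • s j) (ρ (n + 1) w v) = a s v) →
      (∀ (s : Fin i → SS n) v, a (fun j => ssCS (s j)) (f n v) = 0) → a = 0 := by
  have mono : ∀ m, N0 ≤ m → ∀ n, m ≤ n → ∀ k, wt (ρ n) k → wt (ρ m) k := by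
    intro m hm n hn k
    induction n, hn using Nat.le_induction with
    | base => exact id
    | succ n hn ih =>
      exact fun h => ih (h.pull (f n) (heq n (hm.trans hn)) (hirr _ (hm.trans (hn.trans n.le_succ)))
        (hf n (hm.trans hn)))
  by_cases hc : ∀ n, N0 ≤ n → wt (ρ n) (2 * i)
  · classical
    have hex : ∃ k, ∀ n, N0 ≤ n → wt (ρ n) k := ⟨_, hc⟩
    let k := Nat.find hex
    have hk : ∀ n, N0 ≤ n → wt (ρ n) k := Nat.find_spec hex
    obtain ⟨m, hm, hmk⟩ : ∃ m, N0 ≤ m ∧ ∀ k' < k, ¬ wt (ρ m) k' := by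
      by_cases h0 : k = 0
      · exact ⟨N0, le_rfl, fun k' h => by omega⟩
      · have := Nat.find_min hex (m := k - 1) (by omega)
        push Not at this
        obtain ⟨m, hm, h⟩ := this
        exact ⟨m, hm, fun k' hk' hh => h (hh.mono (by omega))⟩
    have hnk : ∀ n, m ≤ n → ∀ k' < k, ¬ wt (ρ n) k' := fun n hn k' hk' h =>
      hmk k' hk' (mono m hm n hn k' h)
    have hgen : ∀ n, m ≤ n → Gen (ρ n) k m := by
      intro n hn
      induction n, hn using Nat.le_induction with
      | base =>
        unfold Gen
        rw [eq_top_iff]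
        intro x _
        exact Submodule.subset_span ⟨Finset.univ, by simp, fun U' z _ _ h =>
          absurd (Finset.subset_univ _) h⟩
      | succ n hn ih =>
        exact ih.push (f n) (heq n (hm.trans hn)) (hirr _ (hm.trans (hn.trans n.le_succ)))
          (hf n (hm.trans hn)) (hnk n hn)
    refine ⟨2 * i + m, by omega, fun n hn a ha h0 => ?_⟩
    have hn' : m ≤ n := by omega
    exact vanish (f n) (heq n (hm.trans hn')) (hirr _ (by omega)) (hf n (by omega)) (hnk n hn')
      (hk _ (by omega)) (hgen n hn') (by omega) a ha h0
  · push Not at hc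
    obtain ⟨m, hm, h⟩ := hc
    exact ⟨m, hm, fun n hn a ha _ => vanish' (fun hh => h (mono m hm _ (by omega) _ hh)) a ha⟩

end RT
end WB
end

section
open CategoryTheory
namespace WB

noncomputable def TDn (n : ℕ) : TD (WBraidGrp n) (PG n) (Wgroup n) (SS n) where
  π := pW n
  ι := wpureToWBraid n
  surj := pW_surjective n
  inj := wpure_injective n
  ker := pW_ker n
  u := uG n
  u_mul := fun s g h => uG_mul n s g h
  gen := by
    intro i c h1 h2
    have : (fun s => UU (fun p => uG n s (wpureToWBraid n p))) = fun s => UU (uP n s) := by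
      funext s
      congr 1
      funext p
      exact uG_pure n s p
    rw [this]
    exact pure_gen n i c h1 h2

theorem TDn_UP (n : ℕ) (s : SS n) (x y : PG n) : (TDn n).UP s x y = uP n s y - uP n s x := by
  show uG n s (wpureToWBraid n y) - uG n s (wpureToWBraid n x) = _
  rw [uG_pure, uG_pure]; rfl

theorem TDn_UP_phi (n : ℕ) (s : SS n) (x y : PG (n + 1)) :
    (TDn (n + 1)).UP (ssCS s) x y = (TDn n).UP s (phiP n x) (phiP n y) := by
  rw [TDn_UP, TDn_UP, uP_phiP, uP_phiP]

theorem J_push (n i : ℕ) {y : (Fin i → SS n) → ℚ} (hy : y ∈ (TDn n).J i) :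
    (fun t => ∑ s, if (fun j => ssCS (s j)) = t then y s else 0) ∈ (TDn (n + 1)).J i := by
  rw [TD.mem_J] at hy ⊢
  obtain ⟨e, h1, h2, h3⟩ := hy
  refine ⟨fun x => e (fun k => phiP n (x k)), fun g x => ?_, fun h => by rw [h2 h]; rfl, fun x => ?_⟩
  · have := h1 (phiP n g) (fun k => phiP n (x k))
    simpa using this
  · rw [dd_pull, h3]
    simp only [lcU, smul_eq_mul, Finset.mul_sum, mul_ite, mul_zero]
    rw [Finset.sum_comm]
    refine Finset.sum_congr rfl fun s _ => ?_
    rw [Finset.sum_ite_eq]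
    simp only [Finset.mem_univ, if_true]
    congr 1
    simp only [prodU, TDn_UP_phi]

theorem D_pull (n i : ℕ) {V V' : Type} [AddCommGroup V] [Module ℚ V] [AddCommGroup V'] [Module ℚ V']
    {ρ : Representation ℚ (Wgroup n) V} {ρ' : Representation ℚ (Wgroup (n + 1)) V'}
    (f : V →ₗ[ℚ] V') (heq : ∀ w v, f (ρ w v) = ρ' (inclW n w) (f v))
    {a : (Fin i → SS (n + 1)) → (V' →ₗ[ℚ] ℚ)} (ha : a ∈ (TDn (n + 1)).D ρ' i) :
    (fun s : Fin i → SS n => a (fun j => ssCS (s j)) ∘ₗ f) ∈ (TDn n).D ρ i := by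
  refine ⟨fun w s v => ?_, fun v y hy => ?_⟩
  · rw [LinearMap.comp_apply, LinearMap.comp_apply, heq]
    simp only [ssCS_smul]
    exact ha.1 (inclW n w) (fun j => ssCS (s j)) (f v)
  · have := ha.2 (f v) _ (J_push n i hy)
    rw [← this]
    simp only [Finset.mul_sum, mul_ite, mul_zero]
    rw [Finset.sum_comm]
    refine Finset.sum_congr rfl fun s _ => ?_
    rw [Finset.sum_ite_eq]
    simp

theorem finrank_le (n i : ℕ) {V V' : Type} [AddCommGroup V] [Module ℚ V] [AddCommGroup V']
    [Module ℚ V'] [FiniteDimensional ℚ V]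
    {ρ : Representation ℚ (Wgroup n) V} {ρ' : Representation ℚ (Wgroup (n + 1)) V'}
    (f : V →ₗ[ℚ] V') (heq : ∀ w v, f (ρ w v) = ρ' (inclW n w) (f v))
    (hinj : ∀ a : (Fin i → SS (n + 1)) → (V' →ₗ[ℚ] ℚ),
      (∀ (w : Wgroup (n + 1)) s v, a (fun j => w • s j) (ρ' w v) = a s v) →
      (∀ (s : Fin i → SS n) v, a (fun j => ssCS (s j)) (f v) = 0) → a = 0) :
    Module.finrank ℚ ((TDn (n + 1)).D ρ' i) ≤ Module.finrank ℚ ((TDn n).D ρ i) := by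
  let L : (TDn (n + 1)).D ρ' i →ₗ[ℚ] (TDn n).D ρ i :=
    { toFun := fun a => ⟨fun s => a.1 (fun j => ssCS (s j)) ∘ₗ f, D_pull n i f heq a.2⟩
      map_add' := fun a b => rfl
      map_smul' := fun r a => rfl }
  apply LinearMap.finrank_le_finrank_of_injective (f := L)
  rw [injective_iff_map_eq_zero]
  intro a h
  refine Subtype.ext (hinj a.1 a.2.1 fun s v => ?_)
  have := congrFun (congrArg Subtype.val h) s
  exact LinearMap.congr_fun this v

theorem antitone_eventually (d : ℕ → ℕ) (N : ℕ) (h : ∀ n, N ≤ n → d (n + 1) ≤ d n) :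
    ∃ M, N ≤ M ∧ ∀ n, M ≤ n → d (n + 1) = d n := by
  obtain ⟨k, ⟨M, hM, hk⟩, hmin⟩ : ∃ k, (∃ M, N ≤ M ∧ d M = k) ∧
      ∀ k', (∃ M, N ≤ M ∧ d M = k') → k ≤ k' := by
    classical
    have hex : ∃ k, ∃ M, N ≤ M ∧ d M = k := ⟨_, N, le_rfl, rfl⟩
    exact ⟨Nat.find hex, Nat.find_spec hex, fun k' h => Nat.find_min' hex h⟩
  have hc : ∀ n, M ≤ n → d n = k := by
    intro n hn
    induction n, hn using Nat.le_induction with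
    | base => exact hk
    | succ n hn ih =>
      exact le_antisymm ((h n (hM.trans hn)).trans ih.le) (hmin _ ⟨n + 1, by omega, rfl⟩)
  exact ⟨M, hM, fun n hn => by rw [hc n hn, hc (n + 1) (by omega)]⟩

theorem main (S : WnIrrSystem) (lam : DoublePartition) (i : ℕ) : ∃ N, lam.minN ≤ N ∧ ∀ n, N ≤ n →
        Nonempty
          ((grpHomology (WBraidGrp n) (Rep.of ((S.rep lam n).comp (pW n))) i) ≃ₗ[ℚ]
            (grpHomology (WBraidGrp (n + 1))
              (Rep.of ((S.rep lam (n + 1)).comp (pW (n + 1)))) i)) := by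
  classical
  haveI : ∀ n, FiniteDimensional ℚ (S.V lam n) := fun n => by
    haveI : Fintype (Wgroup n) := wFintype n
    infer_instance
  have hb : ∀ n, ∃ f : ↥(S.V lam n) →ₗ[ℚ] ↥(S.V lam (n + 1)), lam.minN ≤ n → f ≠ 0 ∧
      ∀ w v, f (S.rep lam n w v) = S.rep lam (n + 1) (inclW n w) (f v) := by
    intro n
    by_cases h : lam.minN ≤ n
    · obtain ⟨f, h1, h2⟩ := S.branch lam n h
      exact ⟨f, fun _ => ⟨h1, h2⟩⟩
    · exact ⟨0, fun h' => absurd h' h⟩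
  choose f hf using hb
  obtain ⟨N, hN, hinj⟩ := RT.eventually (fun n => S.rep lam n) f lam.minN (fun n hn => S.irr lam n hn)
    (fun n hn => (hf n hn).1) (fun n hn => (hf n hn).2) i
  obtain ⟨M, hM, hd⟩ := antitone_eventually
    (fun n => Module.finrank ℚ ((TDn n).D (S.rep lam n) i)) N
    (fun n hn => finrank_le n i (f n) (hf n (hN.trans hn)).2 (hinj n hn))
  refine ⟨M, hN.trans hM, fun n hn => ?_⟩
  have key : ∀ n, FiniteDimensional ℚ (grpHomology (WBraidGrp n) (Rep.of ((S.rep lam n).comp (pW n))) i) ∧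
      Module.finrank ℚ (grpHomology (WBraidGrp n) (Rep.of ((S.rep lam n).comp (pW n))) i) =
        Module.finrank ℚ ((TDn n).D (S.rep lam n) i) := fun n => by
    haveI : Fintype (Wgroup n) := wFintype n
    exact (TDn n).hom_dim (S.rep lam n) i
  haveI := (key n).1
  haveI := (key (n + 1)).1
  exact ⟨LinearEquiv.ofFinrankEq _ _ (by rw [(key n).2, (key (n + 1)).2]; exact (hd n hn).symm)⟩

end WB
end

/-- For the projections `p_n : WB_n → W_n` (characterized by surjectivity
together with `ker p_n = WP_n`, the image of `π₁(X′_n)`), and for any double partition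
`λ = (λ⁺,λ⁻)` and fixed `i ≥ 0`, the twisted homology stabilizes: for all sufficiently large
`n` there is an isomorphism of `ℚ`-vector spaces
`H_i(WB_n; V(λ)_n) ≅ H_i(WB_{n+1}; V(λ)_{n+1})`, where `WB_n` acts on `V(λ)_n` through
`p_n`.  This holds for any system of irreducible `W_n`-representations as in
`WnIrrSystem`. -/
theorem generalized_braid_twisted_homology_stability (S : WnIrrSystem) :
    ∃ p : ∀ n, WBraidGrp n →* Wgroup n,
      (∀ n, Function.Surjective (p n) ∧
        MonoidHom.ker (p n) = MonoidHom.range (wpureToWBraid n)) ∧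
      ∀ (lam : DoublePartition) (i : ℕ), ∃ N, lam.minN ≤ N ∧ ∀ n, N ≤ n →
        Nonempty
          ((grpHomology (WBraidGrp n) (Rep.of ((S.rep lam n).comp (p n))) i) ≃ₗ[ℚ]
            (grpHomology (WBraidGrp (n + 1))
              (Rep.of ((S.rep lam (n + 1)).comp (p (n + 1)))) i)) := by
  exact ⟨WB.pW, fun n => ⟨WB.pW_surjective n, WB.pW_ker n⟩, WB.main S⟩
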